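/- arXiv:1507.08349 — 4 statements merged into one kernel-verified Lean document; each statement's English description precedes it below -/
import Mathlib

section
/- Let X be a random vector in ℝ^d with pdf f_X, fix κ, η > 0, and for each D > 0 set ε = (D/κ)^{1/r}. For a quantizer q with E[‖X − q(X)‖^r] ≤ D, with regions S_i and reconstruction values x̂_i, let B_{i,ε} = { x ∈ S_i : ‖x − x̂_i‖ ≤ ε }, Λ_{i,ε} = Lebesgue measure of B_{i,ε}, I = { i : Λ_{i,ε} ≥ η·V_d·ε^d }, and define the pdf f^{(Λ)}(x) = P(X ∈ B_{i,ε})/Λ_{i,ε} on B_{i,ε} for i ∈ I, and f^{(Λ)}(x) = f_X(x) elsewhere. Then lim_{D↓0} sup_q ∫ | f^{(Λ)}(x) − f_X(x) | dx = 0, the supremum being over all quantizers with E[‖X − q(X)‖^r] ≤ D. -/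
open MeasureTheory Filter Set
open scoped ENNReal Topology ProbabilityTheory Pointwise

noncomputable section

/-- `N` is a norm on `ℝ^d`. -/
structure IsNorm {d : ℕ} (N : (Fin d → ℝ) → ℝ) : Prop where
  nonneg : ∀ x, 0 ≤ N x
  eq_zero_iff : ∀ x, N x = 0 ↔ x = 0
  smul : ∀ (c : ℝ) (x : Fin d → ℝ), N (c • x) = |c| * N x
  triangle : ∀ x y, N (x + y) ≤ N x + N y

/-- Lebesgue volume `V_d` of the unit ball of the norm `N`. -/
def unitBallVol {d : ℕ} (N : (Fin d → ℝ) → ℝ) : ℝ :=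
  (volume {x : Fin d → ℝ | N x ≤ 1}).toReal

/-- A (symbol-wise) quantizer: countably many disjoint Borel quantization regions `S i`
covering the space, with reconstruction values `c i`. -/
structure Quantizer (E : Type*) [MeasurableSpace E] where
  S : ℤ → Set E
  c : ℤ → E
  meas : ∀ i, MeasurableSet (S i)
  disj : Pairwise (Function.onFun Disjoint S)
  cover : ⋃ i, S i = Set.univ

/-- Expected `r`-th power distortion `E[‖X - q(X)‖^r]` of a quantizer, for a source with law `μ`
and norm `N`. -/
def Quantizer.distortion {E : Type*} [MeasurableSpace E] [Sub E] (q : Quantizer E)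
    (μ : Measure E) (N : E → ℝ) (r : ℝ) : ℝ≥0∞ :=
  ∑' i, ∫⁻ x in q.S i, ENNReal.ofReal (N (x - q.c i) ^ r) ∂μ

/-- Output entropy `H(q(X)) = -∑ pᵢ log pᵢ` of a quantizer (as an extended nonneg. real). -/
def Quantizer.entropy {E : Type*} [MeasurableSpace E] (q : Quantizer E) (μ : Measure E) : ℝ≥0∞ :=
  ∑' i, ENNReal.ofReal (Real.negMulLog (μ (q.S i)).toReal)

/-- Output entropy `H(q(X)) = -∑ pᵢ log pᵢ` of a quantizer (as a real number). -/
def Quantizer.entropyR {E : Type*} [MeasurableSpace E] (q : Quantizer E) (μ : Measure E) : ℝ :=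
  ∑' i, Real.negMulLog (μ (q.S i)).toReal

open scoped Classical in
/-- Kullback-Leibler divergence between two measures. -/
def klDiv {α : Type*} [MeasurableSpace α] (μ ν : Measure α) : ℝ≥0∞ :=
  if μ ≪ ν ∧ Integrable (fun x => Real.log (μ.rnDeriv ν x).toReal) μ
  then ENNReal.ofReal (∫ x, Real.log (μ.rnDeriv ν x).toReal ∂μ)
  else ⊤

/-- Mutual information of a joint law `π`, i.e. the KL divergence of `π` from the product of
its marginals. -/
def mutualInfo {α β : Type*} [MeasurableSpace α] [MeasurableSpace β]
    (π : Measure (α × β)) : ℝ≥0∞ :=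
  klDiv π ((π.map Prod.fst).prod (π.map Prod.snd))

/-- The rate-distortion function `R(D)`: the infimum of the mutual information `I(X; X̂)` over
all Markov kernels `P_{X̂|X}` with expected `r`-th power distortion at most `D`. -/
def RDfun {E : Type*} [MeasurableSpace E] [Sub E] (μ : Measure E) (N : E → ℝ) (r D : ℝ) :
    ℝ≥0∞ :=
  ⨅ (κ : ProbabilityTheory.Kernel E E) (_ : ProbabilityTheory.IsMarkovKernel κ)
    (_ : ∫⁻ p, ENNReal.ofReal (N (p.1 - p.2) ^ r) ∂(μ.compProd κ) ≤ ENNReal.ofReal D),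
    mutualInfo (μ.compProd κ)

/-- The smallest output entropy `R_{r,d}(D)` of a quantizer with `r`-th power distortion
at most `D`. -/
def RQfun {E : Type*} [MeasurableSpace E] [Sub E] (μ : Measure E) (N : E → ℝ) (r D : ℝ) :
    ℝ≥0∞ :=
  ⨅ (q : Quantizer E) (_ : q.distortion μ N r ≤ ENNReal.ofReal D), q.entropy μ

/-- The asymptotic excess rate `ℛ = liminf_{D ↓ 0} (R_{r,d}(D) - R(D))`. -/
def excessRate {E : Type*} [MeasurableSpace E] [Sub E] (μ : Measure E) (N : E → ℝ) (r : ℝ) :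
    ℝ :=
  Filter.liminf (fun D => (RQfun μ N r D).toReal - (RDfun μ N r D).toReal) (𝓝[>] (0:ℝ))

/-- The upper incomplete Gamma function `Γ(s, a) = ∫_a^∞ ξ^(s-1) e^(-ξ) dξ`. -/
def uGamma (s a : ℝ) : ℝ := ∫ ξ in Set.Ioi a, ξ ^ (s - 1) * Real.exp (-ξ)

/-- The part of the quantization cell `S i` within distance `ε` of the reconstruction point. -/
def Bcell {E : Type*} [MeasurableSpace E] [Sub E] (q : Quantizer E) (N : E → ℝ) (ε : ℝ)
    (i : ℤ) : Set E :=
  {x | x ∈ q.S i ∧ N (x - q.c i) ≤ ε}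


open scoped Classical in
/-- The piecewise-constant density `f^{(Λ)}`: it equals `P(X ∈ B_{i,ε}) / Λ_{i,ε}` on each
cell `B_{i,ε}` with `Λ_{i,ε} ≥ η V_d ε^d`, and `f_X` elsewhere. -/
def fLam {d : ℕ} (q : Quantizer (Fin d → ℝ)) (N : (Fin d → ℝ) → ℝ)
    (μ : Measure (Fin d → ℝ)) (f : (Fin d → ℝ) → ℝ) (ε η : ℝ) : (Fin d → ℝ) → ℝ :=
  fun x =>
    if h : ∃ i, η * unitBallVol N * ε ^ d ≤ (volume (Bcell q N ε i)).toReal ∧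
        x ∈ Bcell q N ε i
    then (μ (Bcell q N ε h.choose)).toReal / (volume (Bcell q N ε h.choose)).toReal
    else f x

/-- A norm on `ℝ^d` is continuous. -/
lemma IsNorm.continuous {d : ℕ} {N : (Fin d → ℝ) → ℝ} (hN : IsNorm N) : Continuous N := by
  let p : Seminorm ℝ (Fin d → ℝ) :=
    Seminorm.of N hN.triangle fun c x => by rw [hN.smul, Real.norm_eq_abs]
  have hp : ConvexOn ℝ univ N := p.convexOn
  exact continuousOn_univ.mp (hp.continuousOn isOpen_univ)

/-- Every norm on `ℝ^d` dominates a multiple of the sup norm. -/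
lemma IsNorm.exists_norm_le_mul {d : ℕ} {N : (Fin d → ℝ) → ℝ} (hN : IsNorm N) :
    ∃ C : ℝ, 0 < C ∧ ∀ x, ‖x‖ ≤ C * N x := by
  have hpos : ∀ x, x ≠ 0 → 0 < N x := fun x hx =>
    lt_of_le_of_ne (hN.nonneg x) fun h => hx ((hN.eq_zero_iff x).mp h.symm)
  rcases (Metric.sphere (0 : Fin d → ℝ) 1).eq_empty_or_nonempty with he | hne
  · refine ⟨1, one_pos, fun x => ?_⟩
    by_cases hx : x = 0
    · simpa [hx] using hN.nonneg 0
    · have : ‖x‖⁻¹ • x ∈ Metric.sphere (0 : Fin d → ℝ) 1 := by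
        simp [norm_smul, hx]
      simp [he] at this
  · obtain ⟨z, hz, hmin⟩ := (isCompact_sphere (0 : Fin d → ℝ) 1).exists_isMinOn hne
      hN.continuous.continuousOn
    have hz0 : z ≠ 0 := by
      rintro rfl
      simp at hz
    refine ⟨(N z)⁻¹, inv_pos.mpr (hpos z hz0), fun x => ?_⟩
    by_cases hx : x = 0
    · simpa [hx] using mul_nonneg (inv_nonneg.mpr (hN.nonneg z)) (hN.nonneg 0)
    · have hx' : 0 < ‖x‖ := norm_pos_iff.mpr hx
      have hmem : ‖x‖⁻¹ • x ∈ Metric.sphere (0 : Fin d → ℝ) 1 := by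
        simp [norm_smul, hx]
      have h := hmin hmem
      simp only [mem_ofPred_eq, hN.smul, abs_inv, abs_norm] at h
      rw [inv_mul_eq_div, le_div_iff₀ (hpos z hz0)]
      rwa [inv_mul_eq_div, le_div_iff₀ hx', mul_comm] at h

/-- The `L¹` oscillation of `f` around its mean on `A` is at most twice its `L¹` distance to `g`,
up to the pointwise oscillation of `g`. -/
lemma lintegral_enorm_average_sub_le {α : Type*} [MeasurableSpace α] {μ : Measure α}
    {A : Set α} (hA : MeasurableSet A) (hAtop : μ A ≠ ∞) {f g : α → ℝ}
    (hf : Integrable f μ) (hfm : Measurable f) (hg : Measurable g) {φ : α → ℝ≥0∞}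
    (hφ : Measurable φ) (h : ∀ x ∈ A, ∀ y ∈ A, ‖g y - g x‖ₑ ≤ φ x) :
    ∫⁻ x in A, ‖(⨍ y in A, f y ∂μ) - f x‖ₑ ∂μ
      ≤ 2 * ∫⁻ x in A, ‖f x - g x‖ₑ ∂μ + ∫⁻ x in A, φ x ∂μ := by
  by_cases hA0 : μ A = 0
  · rw [setLIntegral_measure_zero _ _ hA0]
    exact zero_le
  set a := ∫⁻ y in A, ‖f y - g y‖ₑ ∂μ with ha
  have hfin : IsFiniteMeasure (μ.restrict A) := ⟨by simpa using hAtop.lt_top⟩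
  have hpt : ∀ x ∈ A, ‖(⨍ y in A, f y ∂μ) - f x‖ₑ ≤ (μ A)⁻¹ * a + (φ x + ‖f x - g x‖ₑ) := by
    intro x hx
    have heq : (⨍ y in A, f y ∂μ) - f x = ⨍ y in A, (f y - f x) ∂μ := by
      have hne : (μ.real A) ≠ 0 := by
        simp [Measure.real, ENNReal.toReal_eq_zero_iff, hA0, hAtop]
      rw [setAverage_eq, setAverage_eq, integral_sub hf.integrableOn (integrable_const _)]
      simp only [integral_const, measureReal_restrict_apply_univ, smul_eq_mul]
      field_simp
    have hinv : ‖(μ.real A)⁻¹‖ₑ = (μ A)⁻¹ := by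
      rw [enorm_inv (by simp [Measure.real, ENNReal.toReal_eq_zero_iff, hA0, hAtop]),
        Measure.real, Real.enorm_of_nonneg ENNReal.toReal_nonneg, ENNReal.ofReal_toReal hAtop]
    rw [heq, setAverage_eq, enorm_smul, hinv]
    calc (μ A)⁻¹ * ‖∫ y in A, (f y - f x) ∂μ‖ₑ
        ≤ (μ A)⁻¹ * ∫⁻ y in A, (‖f y - g y‖ₑ + (φ x + ‖f x - g x‖ₑ)) ∂μ := by
          gcongr
          refine (enorm_integral_le_lintegral_enorm _).trans
            (setLIntegral_mono' hA fun y hy => ?_)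
          have e : f y - f x = (f y - g y) + ((g y - g x) + (g x - f x)) := by ring
          rw [e]
          refine (enorm_add_le _ _).trans (add_le_add le_rfl ((enorm_add_le _ _).trans ?_))
          exact add_le_add (h x hx y hy) (enorm_sub_rev _ _).le
      _ = (μ A)⁻¹ * a + (φ x + ‖f x - g x‖ₑ) := by
          rw [lintegral_add_left (by fun_prop), setLIntegral_const, mul_add, ← ha,
            mul_comm _ (μ A), ← mul_assoc, ENNReal.inv_mul_cancel hA0 hAtop, one_mul]
  calc ∫⁻ x in A, ‖(⨍ y in A, f y ∂μ) - f x‖ₑ ∂μ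
      ≤ ∫⁻ x in A, ((μ A)⁻¹ * a + (φ x + ‖f x - g x‖ₑ)) ∂μ := setLIntegral_mono' hA hpt
    _ = 2 * a + ∫⁻ x in A, φ x ∂μ := by
        rw [lintegral_add_left (by fun_prop), lintegral_add_left hφ, setLIntegral_const, ← ha,
          mul_right_comm, ENNReal.inv_mul_cancel hA0 hAtop, one_mul, two_mul]
        ring

lemma Bcell_subset {E : Type*} [MeasurableSpace E] [Sub E] (q : Quantizer E) (N : E → ℝ)
    (ε : ℝ) (i : ℤ) : Bcell q N ε i ⊆ q.S i := fun _ hx => hx.1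

lemma measurableSet_Bcell {d : ℕ} {N : (Fin d → ℝ) → ℝ} (hN : IsNorm N)
    (q : Quantizer (Fin d → ℝ)) (ε : ℝ) (i : ℤ) : MeasurableSet (Bcell q N ε i) :=
  (q.meas i).inter (measurableSet_le
    (hN.continuous.comp (continuous_id.sub continuous_const)).measurable measurable_const)

lemma dist_le_of_mem_Bcell {d : ℕ} {N : (Fin d → ℝ) → ℝ} {C : ℝ} (hC : 0 < C)
    (hNC : ∀ x, ‖x‖ ≤ C * N x) {q : Quantizer (Fin d → ℝ)} {ε : ℝ} {i : ℤ}
    {x : Fin d → ℝ} (hx : x ∈ Bcell q N ε i) : dist x (q.c i) ≤ C * ε := by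
  rw [dist_eq_norm]
  exact (hNC _).trans (mul_le_mul_of_nonneg_left hx.2 hC.le)

/-- On a quantization region, `f^{(Λ)}` differs from `f` at most by replacing `f` with its cell
mean. -/
lemma enorm_fLam_sub_le {d : ℕ} (q : Quantizer (Fin d → ℝ)) (N : (Fin d → ℝ) → ℝ)
    (μ : Measure (Fin d → ℝ)) (f : (Fin d → ℝ) → ℝ) (ε η : ℝ) {i : ℤ} {x : Fin d → ℝ}
    (hx : x ∈ q.S i) :
    ‖fLam q N μ f ε η x - f x‖ₑ ≤ (Bcell q N ε i).indicator
      (fun x => ‖(μ (Bcell q N ε i)).toReal / (volume (Bcell q N ε i)).toReal - f x‖ₑ) x := by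
  unfold fLam
  split_ifs with h
  · have hmem := h.choose_spec.2
    have hi : h.choose = i := by
      by_contra hne
      exact Set.disjoint_left.mp (q.disj hne) hmem.1 hx
    rw [hi] at hmem ⊢
    rw [indicator_of_mem hmem]
  · simp

/-- The `L¹` distance between `f^{(Λ)}` and `f` is controlled by that between `f` and any `g`
of small oscillation on the cells. -/
lemma lintegral_enorm_fLam_sub_le {d : ℕ} {N : (Fin d → ℝ) → ℝ} (hN : IsNorm N)
    {μ : Measure (Fin d → ℝ)} {f g : (Fin d → ℝ) → ℝ} (hfm : Measurable f)
    (hf0 : ∀ x, 0 ≤ f x) (hf : Integrable f)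
    (hμf : μ = volume.withDensity fun x => ENNReal.ofReal (f x))
    (q : Quantizer (Fin d → ℝ)) (ε η : ℝ) (hg : Measurable g) {φ : (Fin d → ℝ) → ℝ≥0∞}
    (hφ : Measurable φ)
    (h : ∀ i, ∀ x ∈ Bcell q N ε i, ∀ y ∈ Bcell q N ε i, ‖g y - g x‖ₑ ≤ φ x) :
    ∫⁻ x, ‖fLam q N μ f ε η x - f x‖ₑ ≤ 2 * (∫⁻ x, ‖f x - g x‖ₑ) + ∫⁻ x, φ x := by
  obtain ⟨C, hC, hNC⟩ := hN.exists_norm_le_mul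
  have hsum : ∀ F : (Fin d → ℝ) → ℝ≥0∞, ∫⁻ x, F x = ∑' i, ∫⁻ x in q.S i, F x := fun F => by
    rw [← lintegral_iUnion q.meas q.disj, q.cover, Measure.restrict_univ]
  rw [hsum, hsum fun x => ‖f x - g x‖ₑ, hsum φ, ← ENNReal.tsum_mul_left, ← ENNReal.tsum_add]
  refine ENNReal.tsum_le_tsum fun i => ?_
  set B := Bcell q N ε i with hB
  have hBm : MeasurableSet B := measurableSet_Bcell hN q ε i
  have hBtop : volume B ≠ ∞ := by
    refine ((measure_mono fun x hx => ?_).trans_lt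
      (measure_closedBall_lt_top (x := q.c i) (r := C * ε))).ne
    exact dist_le_of_mem_Bcell hC hNC hx
  have havg : (μ B).toReal / (volume B).toReal = ⨍ y in B, f y := by
    rw [setAverage_eq, hμf, withDensity_apply _ hBm,
      integral_eq_lintegral_of_nonneg_ae (Eventually.of_forall hf0) hfm.aestronglyMeasurable,
      smul_eq_mul, Measure.real, inv_mul_eq_div]
  calc ∫⁻ x in q.S i, ‖fLam q N μ f ε η x - f x‖ₑ
      ≤ ∫⁻ x in q.S i, B.indicator (fun x => ‖(⨍ y in B, f y) - f x‖ₑ) x := by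
        refine setLIntegral_mono' (q.meas i) fun x hx => ?_
        rw [← havg]
        exact enorm_fLam_sub_le q N μ f ε η hx
    _ = ∫⁻ x in B, ‖(⨍ y in B, f y) - f x‖ₑ := by
        rw [setLIntegral_indicator hBm, inter_eq_left.mpr (Bcell_subset q N ε i)]
    _ ≤ 2 * (∫⁻ x in B, ‖f x - g x‖ₑ) + ∫⁻ x in B, φ x :=
        lintegral_enorm_average_sub_le hBm hBtop hf hfm hg hφ (h i)
    _ ≤ _ := by
        gcongr <;> exact Bcell_subset q N ε i

/-- Eq. (78): the `L¹` distance between `f^{(Λ)}` and `f_X`, uniformly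
over all quantizers with distortion at most `D`, vanishes as `D ↓ 0`. -/
theorem L1_distance_fLam_tendsto_zero {d : ℕ} (hd : 0 < d) {r : ℝ} (hr : 0 < r)
    {N : (Fin d → ℝ) → ℝ} (hN : IsNorm N)
    (μ : Measure (Fin d → ℝ)) [IsProbabilityMeasure μ]
    (f : (Fin d → ℝ) → ℝ) (hfm : Measurable f) (hf0 : ∀ x, 0 ≤ f x)
    (hμf : μ = volume.withDensity fun x => ENNReal.ofReal (f x))
    (κ η : ℝ) (hκ : 0 < κ) (hη : 0 < η) :
    Tendsto (fun D =>
        sSup {v : ℝ | ∃ q : Quantizer (Fin d → ℝ),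
          q.distortion μ N r ≤ ENNReal.ofReal D ∧
          v = ∫ x, |fLam q N μ f ((D / κ) ^ (1 / r)) η x - f x|})
      (𝓝[>] (0:ℝ)) (𝓝 0) := by
  have hf : Integrable f := by
    refine ⟨hfm.aestronglyMeasurable, ?_⟩
    have h1 : ∫⁻ x, ENNReal.ofReal (f x) = 1 := by
      rw [← setLIntegral_univ, ← withDensity_apply _ MeasurableSet.univ, ← hμf, measure_univ]
    rw [hasFiniteIntegral_iff_ofReal (Eventually.of_forall hf0), h1]
    exact ENNReal.one_lt_top
  obtain ⟨C, hC, hNC⟩ := hN.exists_norm_le_mul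
  rw [Metric.tendsto_nhds]
  intro δ hδ
  obtain ⟨g, hgs, hfg, hgc, -⟩ := hf.exists_hasCompactSupport_lintegral_sub_le
    (ε := ENNReal.ofReal (δ / 8)) (by simpa using hδ)
  set K := Metric.cthickening 1 (tsupport g) with hK
  have hKc : IsCompact K := hgs.isCompact.cthickening
  have hKtop : volume K ≠ ∞ := hKc.measure_ne_top
  set V := (volume K).toReal with hV
  have hV0 : 0 ≤ V := ENNReal.toReal_nonneg
  set ω := δ / (4 * (V + 1)) with hω
  have hω0 : 0 < ω := by positivity
  obtain ⟨ρ, hρ, hgρ⟩ := Metric.uniformContinuous_iff.mp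
    (hgs.uniformContinuous_of_continuous hgc) ω hω0
  have hlim : Tendsto (fun D : ℝ => 2 * (C * (D / κ) ^ (1 / r))) (𝓝[>] 0) (𝓝 0) := by
    have hc : Continuous fun D : ℝ => 2 * (C * (D / κ) ^ (1 / r)) := by
      have := Real.continuous_rpow_const (q := 1 / r) (by positivity)
      fun_prop
    have h0 := (hc.tendsto 0).mono_left (nhdsWithin_le_nhds (s := Ioi 0))
    rwa [zero_div, Real.zero_rpow (by positivity), mul_zero, mul_zero] at h0
  filter_upwards [hlim.eventually_lt_const (lt_min hρ one_pos)] with D hD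
  set ε := (D / κ) ^ (1 / r) with hε
  have hbound : ∀ q : Quantizer (Fin d → ℝ),
      ∫ x, |fLam q N μ f ε η x - f x| ≤ δ / 2 := by
    intro q
    have hosc : ∀ i, ∀ x ∈ Bcell q N ε i, ∀ y ∈ Bcell q N ε i,
        ‖g y - g x‖ₑ ≤ K.indicator (fun _ => ENNReal.ofReal ω) x := by
      intro i x hx y hy
      have hxy : dist y x < min ρ 1 := by
        have := dist_triangle_right y x (q.c i)
        have := dist_le_of_mem_Bcell hC hNC hx
        have := dist_le_of_mem_Bcell hC hNC hy
        linarith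
      by_cases hxK : x ∈ K
      · rw [indicator_of_mem hxK, ← ofReal_norm]
        refine ENNReal.ofReal_le_ofReal ?_
        rw [← dist_eq_norm]
        exact (hgρ (hxy.trans_le (min_le_left _ _))).le
      · have hgx : g x = 0 := image_eq_zero_of_notMem_tsupport fun hx' =>
          hxK (Metric.self_subset_cthickening _ hx')
        have hgy : g y = 0 := image_eq_zero_of_notMem_tsupport fun hy' =>
          hxK (Metric.mem_cthickening_of_dist_le x y 1 _ hy'
            (by rw [dist_comm]; exact (hxy.trans_le (min_le_right _ _)).le))
        simp [hgx, hgy]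
    have hmain := lintegral_enorm_fLam_sub_le hN hfm hf0 hf hμf q ε η hgc.measurable
      (measurable_const.indicator hKc.measurableSet) hosc
    rw [lintegral_indicator_const hKc.measurableSet, ← ENNReal.ofReal_toReal hKtop, ← hV,
      ← ENNReal.ofReal_mul hω0.le] at hmain
    have hωV : ω * V ≤ δ / 4 := by
      rw [hω, div_mul_eq_mul_div, div_le_div_iff₀ (by positivity) (by positivity)]
      nlinarith
    have hle : ∫⁻ x, ‖fLam q N μ f ε η x - f x‖ₑ ≤ ENNReal.ofReal (δ / 2) := by
      calc _ ≤ 2 * ENNReal.ofReal (δ / 8) + ENNReal.ofReal (δ / 4) :=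
            hmain.trans (by gcongr)
        _ = ENNReal.ofReal (δ / 2) := by
            rw [two_mul, ← ENNReal.ofReal_add (by positivity) (by positivity),
              ← ENNReal.ofReal_add (by positivity) (by positivity)]
            ring_nf
    have henorm := enorm_integral_le_lintegral_enorm (μ := volume)
      fun x => |fLam q N μ f ε η x - f x|
    simp only [Real.enorm_abs] at henorm
    rw [Real.enorm_of_nonneg (integral_nonneg fun _ => abs_nonneg _)] at henorm
    exact (ENNReal.ofReal_le_ofReal_iff (by positivity)).mp (henorm.trans hle)
  rw [Real.dist_0_eq_abs, abs_of_nonneg]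
  · refine (Real.sSup_le ?_ (by positivity)).trans_lt (half_lt_self hδ)
    rintro v ⟨q, -, rfl⟩
    exact hbound q
  · refine Real.sSup_nonneg ?_
    rintro v ⟨q, -, rfl⟩
    exact integral_nonneg fun _ => abs_nonneg _

end
end

section
/- Let X be a real-valued random variable with pdf f_X, and let q be a quantizer with quantization regions S_i of finite Lebesgue measure Δ_i, reconstruction values x̂_i, and p_i = P(X ∈ S_i), satisfying E[(X − q(X))^2] ≤ D and sup_i sup_{x ∈ S_i} (x − x̂_i)^2 ≤ α·D for some constant α > 0. Define the piecewise-constant pdf f^{(Δ)}(x) = ∑_i (p_i/Δ_i)·1{x ∈ S_i}. Then ∑_i p_i Δ_i^2 ≤ 12·D·( 1 + α ∫ | f^{(Δ)}(x) − f_X(x) | dx ). -/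
open MeasureTheory Filter Set
open scoped ENNReal Topology ProbabilityTheory Pointwise

noncomputable section

/-- Among the sets of a given finite Lebesgue measure, the centred interval minimises the second
moment about `c`. -/
lemma volume_pow_three_div_twelve_le_setIntegral {S : Set ℝ} (hS : MeasurableSet S)
    (hfin : volume S ≠ ⊤) (c : ℝ) (hint : IntegrableOn (fun x => (x - c) ^ 2) S) :
    (volume S).toReal ^ 3 / 12 ≤ ∫ x in S, (x - c) ^ 2 := by
  set Δ := (volume S).toReal with hΔ
  have hΔ0 : 0 ≤ Δ := ENNReal.toReal_nonneg
  have hIcalc : ∫ x in Ioc (c - Δ / 2) (c + Δ / 2), ((x - c) ^ 2 - (Δ / 2) ^ 2)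
      = Δ ^ 3 / 12 - (Δ / 2) ^ 2 * Δ := by
    rw [← intervalIntegral.integral_of_le (by linarith),
      intervalIntegral.integral_sub (Continuous.intervalIntegrable (by fun_prop) _ _)
        (Continuous.intervalIntegrable (by fun_prop) _ _),
      intervalIntegral.integral_comp_sub_right (fun x => x ^ 2), integral_pow]
    simp
    ring
  have hScalc : ∫ x in S, ((x - c) ^ 2 - (Δ / 2) ^ 2)
      = (∫ x in S, (x - c) ^ 2) - (Δ / 2) ^ 2 * Δ := by
    rw [integral_sub hint (integrableOn_const hfin), setIntegral_const]
    simp [Measure.real, ← hΔ, mul_comm]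
  have hle : ∫ x in Ioc (c - Δ / 2) (c + Δ / 2), ((x - c) ^ 2 - (Δ / 2) ^ 2)
      ≤ ∫ x in S, ((x - c) ^ 2 - (Δ / 2) ^ 2) := by
    rw [← integral_indicator measurableSet_Ioc, ← integral_indicator hS]
    refine integral_mono ?_ ?_ fun x => ?_
    · exact (Continuous.integrableOn_Ioc (by fun_prop)).integrable_indicator measurableSet_Ioc
    · exact (hint.sub (integrableOn_const hfin)).integrable_indicator hS
    · by_cases h₁ : x ∈ Ioc (c - Δ / 2) (c + Δ / 2) <;> by_cases h₂ : x ∈ S <;>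
        simp only [h₁, h₂, indicator_of_mem, indicator_of_notMem, not_false_eq_true, le_refl]
      · nlinarith [h₁.1, h₁.2]
      · by_contra! h
        have h₃ := abs_lt_of_sq_lt_sq' (sub_neg.mp h) (by positivity)
        exact h₁ ⟨by linarith, by linarith⟩
  linarith

/-- The law of a random variable with a density does not charge Lebesgue-null sets, so a cell's
mass is recovered from its density value and its length. -/
lemma ofReal_div_mul_volume {μ : Measure ℝ} [IsFiniteMeasure μ] (hμ : μ ≪ volume) {S : Set ℝ}
    (hfin : volume S ≠ ⊤) :
    ENNReal.ofReal ((μ S).toReal / (volume S).toReal) * volume S = μ S := by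
  rcases eq_or_ne (volume S) 0 with h | h
  · simp [h, hμ h]
  · rw [← ENNReal.toReal_div, ENNReal.ofReal_toReal (ENNReal.div_ne_top (measure_ne_top _ _) h),
      ENNReal.div_mul_cancel h hfin]

/-- On the cell `S i`, the piecewise constant function with values `v` equals `v i`. -/
lemma Quantizer.tsum_indicator_eq {E : Type*} [MeasurableSpace E] (q : Quantizer E) (v : ℤ → ℝ)
    {i : ℤ} {x : E} (hx : x ∈ q.S i) :
    ∑' j, (q.S j).indicator (fun _ => v j) x = v i := by
  rw [tsum_eq_single i, indicator_of_mem hx]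
  exact fun j hj => indicator_of_notMem (fun h => (q.disj hj).le_bot ⟨h, hx⟩) _

lemma Quantizer.measurable_of_eqOn_cells {E : Type*} [MeasurableSpace E] (q : Quantizer E)
    {g : E → ℝ} {v : ℤ → ℝ} (hg : ∀ i, ∀ x ∈ q.S i, g x = v i) : Measurable g := by
  intro t _
  have : g ⁻¹' t = ⋃ i ∈ {i | v i ∈ t}, q.S i := by
    ext x
    obtain ⟨i, hi⟩ := mem_iUnion.mp (q.cover ▸ mem_univ x)
    simp only [mem_preimage, mem_iUnion, mem_ofPred_eq, exists_prop]
    exact ⟨fun h => ⟨i, hg i x hi ▸ h, hi⟩, fun ⟨j, hj, hxj⟩ => hg j x hxj ▸ hj⟩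
  rw [this]
  exact MeasurableSet.biUnion (to_countable _) fun i _ => q.meas i

lemma Quantizer.tsum_setLIntegral {E : Type*} [MeasurableSpace E] (q : Quantizer E)
    (ν : Measure E) (h : E → ℝ≥0∞) : ∑' i, ∫⁻ x in q.S i, h x ∂ν = ∫⁻ x, h x ∂ν := by
  rw [← lintegral_iUnion q.meas q.disj, q.cover, setLIntegral_univ]

lemma Quantizer.tsum_measure {E : Type*} [MeasurableSpace E] (q : Quantizer E)
    (ν : Measure E) : ∑' i, ν (q.S i) = ν univ := by
  rw [← measure_iUnion q.disj q.meas, q.cover]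

/-- The bound for a single cell on which the piecewise constant density `g` equals `p / Δ`. -/
lemma ofReal_mul_sq_le_setLIntegral {μ : Measure ℝ} {S : Set ℝ} (hS : MeasurableSet S)
    (hfin : volume S ≠ ⊤) {f g : ℝ → ℝ} (hfm : Measurable f) (hf0 : ∀ x, 0 ≤ f x)
    (hμf : μ = volume.withDensity fun x => ENNReal.ofReal (f x)) {c B : ℝ}
    (hsup : ∀ x ∈ S, (x - c) ^ 2 ≤ B)
    (hg : ∀ x ∈ S, g x = (μ S).toReal / (volume S).toReal) :
    ENNReal.ofReal ((μ S).toReal * (volume S).toReal ^ 2)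
      ≤ 12 * (∫⁻ x in S, ENNReal.ofReal (|x - c| ^ (2 : ℝ)) ∂μ
        + ENNReal.ofReal B * ∫⁻ x in S, ENNReal.ofReal |g x - f x|) := by
  have hint : IntegrableOn (fun x => (x - c) ^ 2) S :=
    Measure.integrableOn_of_bounded (M := B) hfin
      (Continuous.aestronglyMeasurable (by fun_prop))
      ((ae_restrict_iff' hS).mpr <| .of_forall fun x hx => by
        rw [Real.norm_of_nonneg (sq_nonneg _)]; exact hsup x hx)
  have hmom := volume_pow_three_div_twelve_le_setIntegral hS hfin c hint
  set p := (μ S).toReal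
  set Δ := (volume S).toReal
  have hp : 0 ≤ p := ENNReal.toReal_nonneg
  have hΔ0 : 0 ≤ Δ := ENNReal.toReal_nonneg
  have hreal : p * Δ ^ 2 ≤ 12 * ((p / Δ) * ∫ x in S, (x - c) ^ 2) := by
    rcases hΔ0.eq_or_lt with h | h
    · simp [← h]
    · calc p * Δ ^ 2 = 12 * ((p / Δ) * (Δ ^ 3 / 12)) := by field_simp
        _ ≤ _ := by gcongr
  have hpoint : ∀ x ∈ S, ENNReal.ofReal (p / Δ) * ENNReal.ofReal ((x - c) ^ 2)
      ≤ ENNReal.ofReal (f x) * ENNReal.ofReal (|x - c| ^ (2 : ℝ))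
        + ENNReal.ofReal B * ENNReal.ofReal |g x - f x| := by
    intro x hx
    have hB : 0 ≤ B := (sq_nonneg _).trans (hsup x hx)
    rw [← hg x hx, Real.rpow_two, sq_abs, ← ENNReal.ofReal_mul' (sq_nonneg _),
      ← ENNReal.ofReal_mul (hf0 x), ← ENNReal.ofReal_mul hB,
      ← ENNReal.ofReal_add (mul_nonneg (hf0 x) (sq_nonneg _)) (by positivity)]
    refine ENNReal.ofReal_le_ofReal ?_
    nlinarith [mul_le_mul_of_nonneg_right (hsup x hx) (abs_nonneg (g x - f x)),
      mul_le_mul_of_nonneg_left (le_abs_self (g x - f x)) (sq_nonneg (x - c))]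
  calc ENNReal.ofReal (p * Δ ^ 2)
      ≤ ENNReal.ofReal (12 * ((p / Δ) * ∫ x in S, (x - c) ^ 2)) := ENNReal.ofReal_le_ofReal hreal
    _ = 12 * ∫⁻ x in S, ENNReal.ofReal (p / Δ) * ENNReal.ofReal ((x - c) ^ 2) := by
        rw [ENNReal.ofReal_mul (by norm_num), ENNReal.ofReal_mul (by positivity),
          ofReal_integral_eq_lintegral_ofReal hint (.of_forall fun x => sq_nonneg _),
          lintegral_const_mul _ (by fun_prop), ENNReal.ofReal_ofNat]
    _ ≤ 12 * ∫⁻ x in S, (ENNReal.ofReal (f x) * ENNReal.ofReal (|x - c| ^ (2 : ℝ))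
          + ENNReal.ofReal B * ENNReal.ofReal |g x - f x|) := by
        gcongr 12 * ?_
        exact setLIntegral_mono' hS hpoint
    _ = _ := by
        rw [lintegral_add_left (by fun_prop), lintegral_const_mul' _ _ ENNReal.ofReal_ne_top, hμf,
          setLIntegral_withDensity_eq_setLIntegral_mul _ (by fun_prop) (by fun_prop) hS]
        rfl

/-- Eq. (25): for scalar quantizers with quadratic distortion whose cells
satisfy `sup_{x ∈ Sᵢ} (x - x̂ᵢ)² ≤ α D`, one has
`∑ᵢ pᵢ Δᵢ² ≤ 12 D (1 + α ∫ |f^{(Δ)} - f_X|)`. -/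
theorem sum_p_sq_cell_lengths_le
    (μ : Measure ℝ) [IsProbabilityMeasure μ]
    (f : ℝ → ℝ) (hfm : Measurable f) (hf0 : ∀ x, 0 ≤ f x)
    (hμf : μ = volume.withDensity fun x => ENNReal.ofReal (f x))
    (q : Quantizer ℝ) (D α : ℝ) (hD : 0 < D) (hα : 0 < α)
    (hfin : ∀ i, volume (q.S i) < ⊤)
    (hdist : q.distortion μ (fun x => |x|) 2 ≤ ENNReal.ofReal D)
    (hsup : ∀ i, ∀ x ∈ q.S i, (x - q.c i) ^ 2 ≤ α * D)
    (g : ℝ → ℝ)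
    (hg : ∀ x, g x = ∑' i : ℤ,
      Set.indicator (q.S i)
        (fun _ => (μ (q.S i)).toReal / (volume (q.S i)).toReal) x) :
    ∑' i : ℤ, ENNReal.ofReal ((μ (q.S i)).toReal * (volume (q.S i)).toReal ^ 2)
      ≤ ENNReal.ofReal (12 * D * (1 + α * ∫ x, |g x - f x|)) := by
  have hgcell : ∀ i, ∀ x ∈ q.S i, g x = (μ (q.S i)).toReal / (volume (q.S i)).toReal :=
    fun i x hx => by rw [hg]; exact q.tsum_indicator_eq _ hx
  have hμ : μ ≪ volume := hμf ▸ withDensity_absolutelyContinuous _ _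
  have hgm : Measurable g := q.measurable_of_eqOn_cells hgcell
  have hfint : Integrable f := by
    refine ⟨hfm.aestronglyMeasurable, ?_⟩
    rw [hasFiniteIntegral_iff_ofReal (.of_forall hf0), ← setLIntegral_univ,
      ← withDensity_apply _ MeasurableSet.univ, ← hμf]
    exact measure_lt_top _ _
  have hgint : Integrable g := by
    have hg0 : ∀ x, 0 ≤ g x := fun x => by
      rw [hg]
      exact tsum_nonneg fun i => indicator_nonneg (fun _ _ => by positivity) _
    refine ⟨hgm.aestronglyMeasurable, ?_⟩
    rw [hasFiniteIntegral_iff_ofReal (.of_forall hg0), ← q.tsum_setLIntegral]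
    calc ∑' i, ∫⁻ x in q.S i, ENNReal.ofReal (g x) = ∑' i, μ (q.S i) := by
          congr 1 with i
          rw [setLIntegral_congr_fun (q.meas i) (fun x hx => by rw [hgcell i x hx]),
            setLIntegral_const, ofReal_div_mul_volume hμ (hfin i).ne]
      _ < ⊤ := by rw [q.tsum_measure]; exact measure_lt_top _ _
  calc ∑' i : ℤ, ENNReal.ofReal ((μ (q.S i)).toReal * (volume (q.S i)).toReal ^ 2)
      ≤ ∑' i, 12 * (∫⁻ x in q.S i, ENNReal.ofReal (|x - q.c i| ^ (2 : ℝ)) ∂μ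
        + ENNReal.ofReal (α * D) * ∫⁻ x in q.S i, ENNReal.ofReal |g x - f x|) :=
        ENNReal.tsum_le_tsum fun i =>
          ofReal_mul_sq_le_setLIntegral (q.meas i) (hfin i).ne hfm hf0 hμf (hsup i) (hgcell i)
    _ = 12 * (q.distortion μ (fun x => |x|) 2
        + ENNReal.ofReal (α * D) * ∫⁻ x, ENNReal.ofReal |g x - f x|) := by
        rw [ENNReal.tsum_mul_left, ENNReal.tsum_add, ENNReal.tsum_mul_left, q.tsum_setLIntegral]
        rfl
    _ ≤ 12 * (ENNReal.ofReal D
        + ENNReal.ofReal (α * D) * ENNReal.ofReal (∫ x, |g x - f x|)) := by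
        rw [ofReal_integral_eq_lintegral_ofReal (f := fun x => |g x - f x|)
          (hgint.sub hfint).abs (.of_forall fun x => abs_nonneg _)]
        gcongr
    _ = ENNReal.ofReal (12 * D * (1 + α * ∫ x, |g x - f x|)) := by
        have hI : 0 ≤ ∫ x, |g x - f x| := integral_nonneg fun x => abs_nonneg _
        rw [← ENNReal.ofReal_mul (by positivity), ← ENNReal.ofReal_add hD.le (by positivity),
          ← ENNReal.ofReal_ofNat 12, ← ENNReal.ofReal_mul (by norm_num)]
        congr 1
        ring


end
end

section
/- Let ‖·‖ be a norm on ℝ^d, V_d the Lebesgue measure of its unit ball, r > 0, a > 0, and ε ≥ 0. Then ∫_{{x ∈ ℝ^d : ‖x‖ > ε}} exp( −‖x‖^r / a ) dx = (d/r) · V_d · a^{d/r} · Γ( d/r, ε^r / a ), where Γ(s, u) = ∫_u^∞ ξ^{s−1} e^{−ξ} dξ is the upper incomplete Gamma function. -/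
open MeasureTheory Filter Set
open scoped ENNReal Topology ProbabilityTheory Pointwise

noncomputable section

theorem integral_pow_mul_exp_neg_rpow_div_Ioi {n : ℕ} (hn : 0 < n) {r a ε : ℝ} (hr : 0 < r)
    (ha : 0 < a) (hε : 0 ≤ ε) :
    ∫ y in Ioi ε, y ^ (n - 1) * Real.exp (-(y ^ r) / a)
      = a ^ ((n : ℝ) / r) / r * uGamma ((n : ℝ) / r) (ε ^ r / a) := by
  have key := integral_comp_rpow_Ioi_of_pos'
    (g := fun u : ℝ => (u * a⁻¹) ^ ((n : ℝ) / r - 1) * Real.exp (-(u * a⁻¹))) hr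
    (Real.rpow_nonneg hε r)
  rw [Real.rpow_rpow_inv hε hr.ne', integral_comp_mul_right_Ioi
    (fun ξ : ℝ => ξ ^ ((n : ℝ) / r - 1) * Real.exp (-ξ)) _ (inv_pos.2 ha), inv_inv] at key
  have hcongr : ∀ x ∈ Ioi ε, (r * x ^ (r - 1)) •
        ((x ^ r * a⁻¹) ^ ((n : ℝ) / r - 1) * Real.exp (-(x ^ r * a⁻¹)))
      = r * a / a ^ ((n : ℝ) / r) * (x ^ (n - 1) * Real.exp (-(x ^ r) / a)) := by
    intro x hx
    have hx0 : 0 < x := hε.trans_lt hx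
    have hpow : x ^ (r - 1) * (x ^ r) ^ ((n : ℝ) / r - 1) = x ^ (n - 1) := by
      rw [← Real.rpow_mul hx0.le, ← Real.rpow_add hx0, ← Real.rpow_natCast, Nat.cast_pred hn]
      congr 1
      field_simp
      ring
    have hexp : -(x ^ r * a⁻¹) = -(x ^ r) / a := by ring
    rw [hexp, Real.mul_rpow (by positivity) (by positivity), Real.inv_rpow ha.le,
      Real.rpow_sub_one ha.ne', ← hpow, smul_eq_mul, inv_div]
    ring
  rw [setIntegral_congr_fun measurableSet_Ioi hcongr, integral_const_mul, smul_eq_mul,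
    ← div_eq_mul_inv] at key
  have hpos : 0 < a ^ ((n : ℝ) / r) := Real.rpow_pos_of_pos ha _
  rw [uGamma]
  field_simp at key ⊢
  linarith

theorem setLIntegral_exp_neg_norm_rpow_div {F : Type*} [NormedAddCommGroup F] [NormedSpace ℝ F]
    [FiniteDimensional ℝ F] [Nontrivial F] [MeasurableSpace F] [BorelSpace F] (μ : Measure F)
    [μ.IsAddHaarMeasure] {r a ε : ℝ} (hr : 0 < r) (ha : 0 < a) (hε : 0 ≤ ε) :
    ∫⁻ x in {x : F | ε < ‖x‖}, ENNReal.ofReal (Real.exp (-(‖x‖ ^ r) / a)) ∂μ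
      = ENNReal.ofReal ((Module.finrank ℝ F : ℝ) / r * μ.real {x : F | ‖x‖ ≤ 1}
          * a ^ ((Module.finrank ℝ F : ℝ) / r)
          * uGamma ((Module.finrank ℝ F : ℝ) / r) (ε ^ r / a)) := by
  have hn : 0 < Module.finrank ℝ F := Module.finrank_pos
  have hS : MeasurableSet {x : F | ε < ‖x‖} := measurableSet_lt measurable_const measurable_norm
  have hint : Integrable (fun x : F => Real.exp (-(‖x‖ ^ r) / a)) μ := by
    rw [integrable_fun_norm_addHaar μ (f := fun y : ℝ => Real.exp (-(y ^ r) / a))]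
    refine (integrableOn_rpow_mul_exp_neg_mul_rpow (p := r)
      (s := ((Module.finrank ℝ F - 1 : ℕ) : ℝ)) (b := a⁻¹)
      (by linarith [Nat.cast_nonneg (α := ℝ) (Module.finrank ℝ F - 1)]) hr
      (inv_pos.2 ha)).congr_fun (fun x _ => ?_) measurableSet_Ioi
    simp only [Real.rpow_natCast, smul_eq_mul]
    congr 2
    ring
  have hball : μ.real {x : F | ‖x‖ ≤ 1} = μ.real (Metric.ball 0 1) := by
    rw [← Measure.addHaar_real_closedBall_eq_addHaar_real_ball]
    congr 1
    ext x
    simp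
  rw [← ofReal_integral_eq_lintegral_ofReal hint.integrableOn
    (.of_forall fun x => (Real.exp_pos _).le), ← integral_indicator hS]
  congr 1
  have hind : {x : F | ε < ‖x‖}.indicator (fun x => Real.exp (-(‖x‖ ^ r) / a))
      = fun x => (Ioi ε).indicator (fun y : ℝ => Real.exp (-(y ^ r) / a)) ‖x‖ := by
    ext x
    simp [indicator]
  rw [hind, integral_fun_norm_addHaar μ]
  simp_rw [smul_eq_mul, ← indicator_mul_right (Ioi ε) (fun y : ℝ => y ^ (Module.finrank ℝ F - 1))]
  rw [setIntegral_indicator measurableSet_Ioi, Ioi_inter_Ioi, max_eq_right hε,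
    integral_pow_mul_exp_neg_rpow_div_Ioi hn hr ha hε, hball, nsmul_eq_mul]
  ring

theorem setLIntegral_exp_neg_norm_comp_linearEquiv {E F : Type*} [AddCommGroup E] [Module ℝ E]
    [TopologicalSpace E] [IsTopologicalAddGroup E] [ContinuousSMul ℝ E] [T2Space E]
    [FiniteDimensional ℝ E] [Nontrivial E] [MeasurableSpace E] [BorelSpace E] (μ : Measure E)
    [μ.IsAddHaarMeasure] [NormedAddCommGroup F] [NormedSpace ℝ F] (e : E ≃ₗ[ℝ] F)
    {r a ε : ℝ} (hr : 0 < r) (ha : 0 < a) (hε : 0 ≤ ε) :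
    ∫⁻ x in {x : E | ε < ‖e x‖}, ENNReal.ofReal (Real.exp (-(‖e x‖ ^ r) / a)) ∂μ
      = ENNReal.ofReal ((Module.finrank ℝ E : ℝ) / r * μ.real {x : E | ‖e x‖ ≤ 1}
          * a ^ ((Module.finrank ℝ E : ℝ) / r)
          * uGamma ((Module.finrank ℝ E : ℝ) / r) (ε ^ r / a)) := by
  borelize F
  have : FiniteDimensional ℝ F := e.finiteDimensional
  have : Nontrivial F := e.symm.toEquiv.nontrivial
  let φ : E ≃L[ℝ] F := e.toContinuousLinearEquiv
  have hφ : ∀ x, φ x = e x := fun _ => rfl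
  have hmp : MeasurePreserving φ μ (μ.map φ) := φ.continuous.measurable.measurePreserving μ
  have hme : MeasurableEmbedding φ := φ.toHomeomorph.measurableEmbedding
  have : (μ.map φ).IsAddHaarMeasure := φ.isAddHaarMeasure_map μ
  have h := setLIntegral_exp_neg_norm_rpow_div (μ.map φ) hr ha hε
  rw [← hmp.setLIntegral_comp_preimage_emb hme, measureReal_def, hme.map_apply,
    ← e.finrank_eq] at h
  exact h

theorem setLIntegral_exp_neg_addGroupNorm_rpow_div {E : Type*} [AddCommGroup E] [Module ℝ E]
    [TopologicalSpace E] [IsTopologicalAddGroup E] [ContinuousSMul ℝ E] [T2Space E]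
    [FiniteDimensional ℝ E] [Nontrivial E] [MeasurableSpace E] [BorelSpace E] (μ : Measure E)
    [μ.IsAddHaarMeasure] (p : AddGroupNorm E) (hp : ∀ (c : ℝ) (x : E), p (c • x) ≤ |c| * p x)
    {r a ε : ℝ} (hr : 0 < r) (ha : 0 < a) (hε : 0 ≤ ε) :
    ∫⁻ x in {x : E | ε < p x}, ENNReal.ofReal (Real.exp (-(p x ^ r) / a)) ∂μ
      = ENNReal.ofReal ((Module.finrank ℝ E : ℝ) / r * μ.real {x : E | p x ≤ 1}
          * a ^ ((Module.finrank ℝ E : ℝ) / r)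
          * uGamma ((Module.finrank ℝ E : ℝ) / r) (ε ^ r / a)) := by
  let F : Type _ := E
  let : NormedAddCommGroup F := p.toNormedAddCommGroup
  let : NormedSpace ℝ F := { norm_smul_le := hp }
  exact setLIntegral_exp_neg_norm_comp_linearEquiv μ (LinearEquiv.refl ℝ E : E ≃ₗ[ℝ] F) hr ha hε

/-- Eq. (32): the integral of `exp(-‖x‖^r / a)` outside the ball of radius
`ε` equals `(d/r) V_d a^{d/r} Γ(d/r, ε^r/a)`. -/
theorem integral_exp_neg_norm_rpow {d : ℕ} (hd : 0 < d) {r : ℝ} (hr : 0 < r)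
    {N : (Fin d → ℝ) → ℝ} (hN : IsNorm N)
    (a ε : ℝ) (ha : 0 < a) (hε : 0 ≤ ε) :
    ∫⁻ x in {x : Fin d → ℝ | ε < N x}, ENNReal.ofReal (Real.exp (-(N x ^ r) / a))
      = ENNReal.ofReal (((d : ℝ) / r) * unitBallVol N * a ^ ((d : ℝ) / r)
          * uGamma ((d : ℝ) / r) (ε ^ r / a)) := by
  have : NeZero d := ⟨hd.ne'⟩
  let p : AddGroupNorm (Fin d → ℝ) :=
    { toFun := N
      map_zero' := (hN.eq_zero_iff 0).2 rfl
      add_le' := hN.triangle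
      neg' := fun x => by simpa using hN.smul (-1) x
      eq_zero_of_map_eq_zero' := fun x => (hN.eq_zero_iff x).1 }
  have h := setLIntegral_exp_neg_addGroupNorm_rpow_div volume p (fun c x => (hN.smul c x).le)
    hr ha hε
  rw [Module.finrank_fin_fun] at h
  exact h

end
end

section
/- Let X be a real-valued random variable with a pdf, finite differential entropy h(X), and finite H(⌊X⌋), and fix r > 0. Then the excess rate of scalar quantization equals ℛ_{r,1} = (1/r) · log( Γ(1+1/r)^r · e / (1 + 1/r) ); in particular, for quadratic distortion (r = 2), ℛ_{2,1} = (1/2) log(π e / 6), and this value is achieved by uniform quantizers in the limit of vanishing distortion. -/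
open MeasureTheory Filter Set
open scoped ENNReal Topology ProbabilityTheory Pointwise

noncomputable section

/-- **Gibbs' inequality**, with a minorant of the logarithm to avoid integrability issues. -/
theorem integral_le_log_of_le_log {α : Type*} [MeasurableSpace α] {μ : Measure α}
    [IsProbabilityMeasure μ] {φ b : α → ℝ} {M : ℝ} (hM : 0 < M) (hφ : AEMeasurable φ μ)
    (hpos : ∀ᵐ x ∂μ, 0 < φ x) (hb : Integrable b μ) (hlog : ∀ᵐ x ∂μ, b x ≤ Real.log (φ x))
    (hle : ∫⁻ x, ENNReal.ofReal (φ x) ∂μ ≤ ENNReal.ofReal M) :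
    ∫ x, b x ∂μ ≤ Real.log M := by
  have hpos' : 0 ≤ᵐ[μ] φ := hpos.mono fun x hx => hx.le
  have hint : Integrable φ μ := by
    refine ⟨hφ.aestronglyMeasurable, ?_⟩
    rw [hasFiniteIntegral_iff_ofReal hpos']
    exact hle.trans_lt ENNReal.ofReal_lt_top
  have hI : ∫ x, φ x ∂μ ≤ M := by
    rw [integral_eq_lintegral_of_nonneg_ae hpos' hφ.aestronglyMeasurable]
    exact ENNReal.toReal_le_of_le_ofReal hM.le hle
  calc ∫ x, b x ∂μ ≤ ∫ x, (φ x / M + (Real.log M - 1)) ∂μ := by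
        refine integral_mono_ae hb ((hint.div_const M).add (integrable_const _)) ?_
        filter_upwards [hpos, hlog] with x hx hbx
        have h1 := Real.log_le_sub_one_of_pos (div_pos hx hM)
        rw [Real.log_div hx.ne' hM.ne'] at h1
        linarith
    _ = (∫ x, φ x ∂μ) / M + (Real.log M - 1) := by
        rw [integral_add (hint.div_const M) (integrable_const _), integral_div]
        simp
    _ ≤ 1 + (Real.log M - 1) := by gcongr; exact (div_le_one hM).2 hI
    _ = Real.log M := by ring

/-- The normalising constant of the density proportional to `exp (-|z| ^ r)`. -/
def expPowNorm (r : ℝ) : ℝ := 1 / (2 * Real.Gamma (1 + 1 / r))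

/-- The exponential power density with shape `r` and inverse scale `s`. -/
def expPowDensity (r s z : ℝ) : ℝ := expPowNorm r * s ^ (1 / r) * Real.exp (-s * |z| ^ r)

section ExpPow

variable {r s : ℝ}

theorem expPowNorm_pos (hr : 0 < r) : 0 < expPowNorm r := by
  have : 0 < Real.Gamma (1 + 1 / r) := Real.Gamma_pos_of_pos (by positivity)
  unfold expPowNorm
  positivity

theorem expPowNorm_mul_pos (hr : 0 < r) (hs : 0 < s) : 0 < expPowNorm r * s ^ (1 / r) :=
  mul_pos (expPowNorm_pos hr) (by positivity)

theorem expPowDensity_pos (hr : 0 < r) (hs : 0 < s) (z : ℝ) : 0 < expPowDensity r s z :=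
  mul_pos (expPowNorm_mul_pos hr hs) (Real.exp_pos _)

@[fun_prop]
theorem measurable_expPowDensity : Measurable (expPowDensity r s) := by
  unfold expPowDensity
  fun_prop

theorem log_expPowDensity (hr : 0 < r) (hs : 0 < s) (z : ℝ) :
    Real.log (expPowDensity r s z) = Real.log (expPowNorm r * s ^ (1 / r)) - s * |z| ^ r := by
  unfold expPowDensity
  rw [Real.log_mul (expPowNorm_mul_pos hr hs).ne' (Real.exp_pos _).ne', Real.log_exp]
  ring

theorem expPowDensity_le (hr : 0 < r) (hs : 0 < s) (z : ℝ) :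
    expPowDensity r s z ≤ expPowNorm r * s ^ (1 / r) := by
  unfold expPowDensity
  refine mul_le_of_le_one_right (expPowNorm_mul_pos hr hs).le ?_
  rw [Real.exp_le_one_iff]
  have := Real.rpow_nonneg (abs_nonneg z) r
  nlinarith

theorem log_expPowNorm_mul (hr : 0 < r) (hs : 0 < s) :
    Real.log (expPowNorm r * s ^ (1 / r))
      = -Real.log (2 * Real.Gamma (1 + 1 / r)) + (1 / r) * Real.log s := by
  rw [Real.log_mul (expPowNorm_pos hr).ne' (by positivity), Real.log_rpow hs, expPowNorm,
    one_div, Real.log_inv]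

theorem lintegral_abs_eq {F : ℝ → ℝ} (hF0 : ∀ x, 0 < x → 0 ≤ F x)
    (hF : IntegrableOn F (Ioi 0)) :
    ∫⁻ z, ENNReal.ofReal (F |z|) = ENNReal.ofReal (2 * ∫ x in Ioi 0, F x) := by
  have hint : Integrable fun z : ℝ => F |z| := by
    rw [← integrableOn_univ, ← Iic_union_Ioi (a := (0 : ℝ))]
    have hpos : IntegrableOn (fun z : ℝ => F |z|) (Ioi 0) :=
      hF.congr_fun (fun x hx => by simp [abs_of_pos (show (0 : ℝ) < x from hx)]) measurableSet_Ioi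
    have hneg : IntegrableOn (fun z : ℝ => F |z|) (Iic 0) := by
      have h : IntegrableOn (fun z : ℝ => F |z|) (Ici (-0)) := by
        rw [neg_zero]
        exact Iff.mpr integrableOn_Ici_iff_integrableOn_Ioi hpos
      simpa using h.comp_neg_Iic
    exact hneg.union hpos
  rw [← integral_comp_abs, ofReal_integral_eq_lintegral_ofReal hint]
  have : ∀ᵐ z : ℝ, z ≠ 0 := by simp [ae_iff]
  filter_upwards [this] with z hz using hF0 _ (abs_pos.2 hz)

theorem lintegral_expPowDensity (hr : 0 < r) (hs : 0 < s) :
    ∫⁻ z, ENNReal.ofReal (expPowDensity r s z) = 1 := by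
  have hpos : 0 < Real.Gamma (1 + 1 / r) := Real.Gamma_pos_of_pos (by positivity)
  have hI : IntegrableOn (fun x : ℝ => Real.exp (-s * x ^ r)) (Ioi 0) := by
    simpa using integrableOn_rpow_mul_exp_neg_mul_rpow (s := 0) (by norm_num) hr hs
  have h := lintegral_abs_eq (F := fun x => expPowNorm r * s ^ (1 / r) * Real.exp (-s * x ^ r))
    (fun x _ => mul_nonneg (expPowNorm_mul_pos hr hs).le (Real.exp_pos _).le) (hI.const_mul _)
  rw [integral_const_mul, integral_exp_neg_mul_rpow hr hs] at h
  refine h.trans ?_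
  rw [← ENNReal.ofReal_one]
  congr 1
  rw [expPowNorm, add_comm (1 / r) 1, show -1 / r = -(1 / r) by ring, Real.rpow_neg hs.le]
  have : s ^ (1 / r) ≠ 0 := by positivity
  field_simp

theorem lintegral_rpow_mul_expPowDensity (hr : 0 < r) (hs : 0 < s) :
    ∫⁻ z, ENNReal.ofReal (|z| ^ r) * ENNReal.ofReal (expPowDensity r s z)
      = ENNReal.ofReal (1 / (r * s)) := by
  have hpos : 0 < Real.Gamma (1 + 1 / r) := Real.Gamma_pos_of_pos (by positivity)
  have hI : IntegrableOn (fun x : ℝ => x ^ r * Real.exp (-s * x ^ r)) (Ioi 0) :=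
    integrableOn_rpow_mul_exp_neg_mul_rpow (by linarith) hr hs
  have h := lintegral_abs_eq
    (F := fun x => expPowNorm r * s ^ (1 / r) * (x ^ r * Real.exp (-s * x ^ r)))
    (fun x hx => mul_nonneg (expPowNorm_mul_pos hr hs).le (by positivity)) (hI.const_mul _)
  rw [integral_const_mul, integral_rpow_mul_exp_neg_mul_rpow hr (by linarith) hs] at h
  have h2 : ∀ z : ℝ, ENNReal.ofReal (|z| ^ r) * ENNReal.ofReal (expPowDensity r s z)
      = ENNReal.ofReal (expPowNorm r * s ^ (1 / r) * (|z| ^ r * Real.exp (-s * |z| ^ r))) := by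
    intro z
    rw [← ENNReal.ofReal_mul (by positivity), expPowDensity]
    ring_nf
  simp_rw [h2]
  refine h.trans ?_
  congr 1
  have e1 : (r + 1) / r = 1 + 1 / r := by field_simp
  have e2 : s ^ (-(r + 1) / r) = (s ^ (1 / r))⁻¹ * s⁻¹ := by
    rw [← Real.rpow_neg hs.le, ← Real.rpow_neg_one s, ← Real.rpow_add hs]
    congr 1
    field_simp
    ring
  rw [expPowNorm, e2, e1]
  have : s ^ (1 / r) ≠ 0 := by positivity
  field_simp

end ExpPow

section Density

variable {μ : Measure ℝ} {f : ℝ → ℝ}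

theorem ae_density_pos (hfm : Measurable f)
    (hμf : μ = volume.withDensity fun x => ENNReal.ofReal (f x)) : ∀ᵐ x ∂μ, 0 < f x := by
  rw [hμf, ae_withDensity_iff (by fun_prop)]
  exact Eventually.of_forall fun x hx => by simpa using hx

theorem integrable_log_density (hfm : Measurable f) (hf0 : ∀ x, 0 ≤ f x)
    (hμf : μ = volume.withDensity fun x => ENNReal.ofReal (f x))
    (hent : Integrable (fun x => f x * Real.log (f x))) :
    Integrable (fun x => Real.log (f x)) μ := by
  rw [hμf, integrable_withDensity_iff_integrable_smul' (by fun_prop) (by simp)]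
  simpa [ENNReal.toReal_ofReal, hf0] using hent

theorem lintegral_density (hfm : Measurable f)
    (hμf : μ = volume.withDensity fun x => ENNReal.ofReal (f x)) {F : ℝ → ℝ≥0∞}
    (hF : Measurable F) : ∫⁻ x, F x ∂μ = ∫⁻ x, ENNReal.ofReal (f x) * F x := by
  rw [hμf, lintegral_withDensity_eq_lintegral_mul _ (by fun_prop) hF]
  rfl

/-- Dividing by the density turns an expectation into at most a Lebesgue integral. -/
theorem lintegral_div_density_le (hfm : Measurable f)
    (hμf : μ = volume.withDensity fun x => ENNReal.ofReal (f x)) {G : ℝ → ℝ}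
    (hG : Measurable G) :
    ∫⁻ x, ENNReal.ofReal (G x / f x) ∂μ ≤ ∫⁻ x, ENNReal.ofReal (G x) := by
  rw [lintegral_density hfm hμf (by fun_prop)]
  refine lintegral_mono fun x => ?_
  rcases le_or_gt (f x) 0 with hx | hx
  · simp [ENNReal.ofReal_of_nonpos hx]
  · rw [← ENNReal.ofReal_mul hx.le, mul_div_cancel₀ _ hx.ne']

end Density

/-- The Shannon lower bound for `r`-th power distortion. -/
def shannonBound (μ : Measure ℝ) (f : ℝ → ℝ) (r D : ℝ) : ℝ :=
  -∫ x, Real.log (f x) ∂μ + Real.log (expPowNorm r * (1 / (r * D)) ^ (1 / r)) - 1 / r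

section Shannon

variable {r D : ℝ} {μ : Measure ℝ} [IsProbabilityMeasure μ] {f : ℝ → ℝ}

theorem shannonBound_le_mutualInfo (hr : 0 < r) (hD : 0 < D)
    (hfm : Measurable f)
    (hμf : μ = volume.withDensity fun x => ENNReal.ofReal (f x))
    (hlogf : Integrable (fun x => Real.log (f x)) μ)
    (κ : ProbabilityTheory.Kernel ℝ ℝ) [ProbabilityTheory.IsMarkovKernel κ]
    (hκ : ∫⁻ p, ENNReal.ofReal (|p.1 - p.2| ^ r) ∂(μ.compProd κ) ≤ ENNReal.ofReal D) :
    ENNReal.ofReal (shannonBound μ f r D) ≤ mutualInfo (μ.compProd κ) := by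
  set π := μ.compProd κ with hπ
  have hfst : π.map Prod.fst = μ := Measure.fst_compProd μ κ
  unfold mutualInfo
  rw [hfst]
  set ν := π.map Prod.snd with hν
  have : IsProbabilityMeasure ν := Measure.isProbabilityMeasure_map measurable_snd.aemeasurable
  set ρ := μ.prod ν with hρ
  unfold klDiv
  split_ifs with hcond
  swap
  · exact le_top
  obtain ⟨hac, hllr⟩ := hcond
  refine ENNReal.ofReal_le_ofReal ?_
  set s := 1 / (r * D) with hs_def
  have hs : 0 < s := by positivity
  set θ : ℝ × ℝ → ℝ := fun p => (π.rnDeriv ρ p).toReal with hθ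
  have hθm : Measurable θ := (Measure.measurable_rnDeriv π ρ).ennreal_toReal
  have hθpos : ∀ᵐ p ∂π, 0 < θ p := by
    filter_upwards [Measure.rnDeriv_pos hac, hac.ae_le (Measure.rnDeriv_lt_top π ρ)] with p h1 h2
    exact ENNReal.toReal_pos h1.ne' h2.ne
  have hfpos : ∀ᵐ p ∂π, 0 < f p.1 := by
    have := ae_density_pos hfm hμf
    rw [← hfst] at this
    exact ae_of_ae_map measurable_fst.aemeasurable this
  have hlogf' : Integrable (fun p : ℝ × ℝ => Real.log (f p.1)) π := by
    rw [← hfst] at hlogf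
    exact hlogf.comp_measurable measurable_fst
  have hdm : Measurable fun p : ℝ × ℝ => |p.1 - p.2| ^ r := by fun_prop
  have hdist : Integrable (fun p : ℝ × ℝ => |p.1 - p.2| ^ r) π := by
    refine ⟨hdm.aestronglyMeasurable, ?_⟩
    rw [hasFiniteIntegral_iff_ofReal (Eventually.of_forall fun p => by positivity)]
    exact hκ.trans_lt ENNReal.ofReal_lt_top
  have hdistle : ∫ p, |p.1 - p.2| ^ r ∂π ≤ D := by
    rw [integral_eq_lintegral_of_nonneg_ae (Eventually.of_forall fun p => by positivity)
      hdm.aestronglyMeasurable]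
    exact ENNReal.toReal_le_of_le_ofReal hD.le hκ
  set φ : ℝ × ℝ → ℝ := fun p => expPowDensity r s (p.1 - p.2) / f p.1 / θ p with hφ
  have hφm : Measurable φ := by fun_prop
  have hφpos : ∀ᵐ p ∂π, 0 < φ p := by
    filter_upwards [hθpos, hfpos] with p h1 h2
    have := expPowDensity_pos hr hs (p.1 - p.2)
    positivity
  have hlogφ : ∀ᵐ p ∂π, Real.log (φ p) = Real.log (expPowNorm r * s ^ (1 / r))
      - s * |p.1 - p.2| ^ r - Real.log (f p.1) - Real.log (θ p) := by
    filter_upwards [hθpos, hfpos] with p h1 h2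
    have := expPowDensity_pos hr hs (p.1 - p.2)
    rw [hφ]
    simp only
    rw [Real.log_div (by positivity) h1.ne', Real.log_div this.ne' h2.ne', log_expPowDensity hr hs]
  have hint1 : Integrable (fun p : ℝ × ℝ => Real.log (expPowNorm r * s ^ (1 / r))
      - s * |p.1 - p.2| ^ r - Real.log (f p.1) - Real.log (θ p)) π :=
    (((integrable_const _).sub (hdist.const_mul s)).sub hlogf').sub hllr
  have hle : ∫⁻ p, ENNReal.ofReal (φ p) ∂π ≤ ENNReal.ofReal 1 := by
    rw [← lintegral_rnDeriv_mul hac (by fun_prop)]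
    calc ∫⁻ p, π.rnDeriv ρ p * ENNReal.ofReal (φ p) ∂ρ
        ≤ ∫⁻ p, ENNReal.ofReal (expPowDensity r s (p.1 - p.2) / f p.1) ∂ρ := by
          refine lintegral_mono_ae ?_
          filter_upwards [Measure.rnDeriv_lt_top π ρ] with p hp
          rw [← ENNReal.ofReal_toReal hp.ne, ← ENNReal.ofReal_mul ENNReal.toReal_nonneg]
          change ENNReal.ofReal (θ p * (_ / θ p)) ≤ _
          rcases eq_or_ne (θ p) 0 with h0 | h0
          · simp [h0]
          · rw [mul_div_cancel₀ _ h0]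
      _ = ∫⁻ y, ∫⁻ x, ENNReal.ofReal (expPowDensity r s (x - y) / f x) ∂μ ∂ν :=
          lintegral_prod_symm' _ (by fun_prop)
      _ ≤ ∫⁻ y, 1 ∂ν := by
          refine lintegral_mono fun y => ?_
          refine (lintegral_div_density_le hfm hμf
            (G := fun x => expPowDensity r s (x - y)) (by fun_prop)).trans ?_
          rw [lintegral_sub_right_eq_self (fun x => ENNReal.ofReal (expPowDensity r s x)) y,
            lintegral_expPowDensity hr hs]
      _ = ENNReal.ofReal 1 := by simp
  have hgibbs := integral_le_log_of_le_log one_pos hφm.aemeasurable hφpos hint1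
    (hlogφ.mono fun p hp => hp.symm.le) hle
  rw [integral_sub _ hllr, integral_sub _ hlogf',
    integral_sub (integrable_const _) (hdist.const_mul s), integral_const_mul] at hgibbs
  rotate_left
  · exact (integrable_const _).sub (hdist.const_mul s)
  · exact ((integrable_const _).sub (hdist.const_mul s)).sub hlogf'
  have hf' : ∫ p, Real.log (f p.1) ∂π = ∫ x, Real.log (f x) ∂μ := by
    rw [← hfst, integral_map measurable_fst.aemeasurable]
    rw [hfst]
    exact hlogf.aestronglyMeasurable
  have hsD : s * ∫ p, |p.1 - p.2| ^ r ∂π ≤ 1 / r := by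
    calc _ ≤ s * D := by gcongr
      _ = 1 / r := by rw [hs_def]; field_simp
  rw [hf'] at hgibbs
  simp only [integral_const, probReal_univ, one_smul, Real.log_one] at hgibbs
  unfold shannonBound
  rw [← hs_def]
  linarith

theorem shannonBound_le_RDfun (hr : 0 < r) (hD : 0 < D)
    (hfm : Measurable f)
    (hμf : μ = volume.withDensity fun x => ENNReal.ofReal (f x))
    (hlogf : Integrable (fun x => Real.log (f x)) μ) :
    ENNReal.ofReal (shannonBound μ f r D) ≤ RDfun μ (fun x => |x|) r D :=
  le_iInf fun κ => le_iInf fun _ => le_iInf fun hκ =>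
    shannonBound_le_mutualInfo hr hD hfm hμf hlogf κ hκ

end Shannon

theorem integral_rpow_abs_symm {r a : ℝ} (hr : 0 < r) (ha : 0 ≤ a) (c : ℝ) :
    ∫ x in Icc (c - a) (c + a), |x - c| ^ r = 2 * a ^ (r + 1) / (r + 1) := by
  rw [integral_Icc_eq_integral_Ioc, ← intervalIntegral.integral_of_le (by linarith),
    intervalIntegral.integral_comp_sub_right (fun x => |x| ^ r) c]
  simp only [sub_sub_cancel_left, add_sub_cancel_left]
  have hi : ∀ u v : ℝ, IntervalIntegrable (fun x : ℝ => |x| ^ r) volume u v := fun u v =>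
    (by fun_prop (disch := exact hr.le) : Continuous fun x : ℝ => |x| ^ r).intervalIntegrable u v
  have h0 : ∫ x in (0 : ℝ)..a, |x| ^ r = a ^ (r + 1) / (r + 1) := by
    rw [intervalIntegral.integral_congr (g := fun x => x ^ r), integral_rpow (Or.inl (by linarith))]
    · rw [Real.zero_rpow (by linarith), sub_zero]
    · intro x hx
      rw [uIcc_of_le ha] at hx
      simp [abs_of_nonneg hx.1]
  rw [← intervalIntegral.integral_add_adjacent_intervals (hi (-a) 0) (hi 0 a), h0]
  have := intervalIntegral.integral_comp_neg (a := 0) (b := a) (fun x : ℝ => |x| ^ r)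
  simp only [abs_neg, neg_zero] at this
  rw [← this, h0]
  ring

/-- **Bathtub principle**: among sets of given volume, an interval centred at `c` minimises the
`r`-th absolute moment about `c`. -/
theorem rpow_volume_le_setLIntegral {r : ℝ} (hr : 0 < r) {L : Set ℝ} (hL : MeasurableSet L)
    (hLfin : volume L ≠ ∞) (c : ℝ) :
    ENNReal.ofReal ((volume L).toReal ^ (r + 1) / (2 ^ r * (r + 1)))
      ≤ ∫⁻ x in L, ENNReal.ofReal (|x - c| ^ r) := by
  set a := (volume L).toReal / 2 with ha_def
  have ha : 0 ≤ a := by positivity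
  by_cases hfin : ∫⁻ x in L, ENNReal.ofReal (|x - c| ^ r) = ∞
  · simp [hfin]
  have hm : Measurable fun x : ℝ => |x - c| ^ r := by fun_prop
  have hint : IntegrableOn (fun x : ℝ => |x - c| ^ r) L := by
    refine ⟨hm.aestronglyMeasurable, ?_⟩
    rw [hasFiniteIntegral_iff_ofReal (Eventually.of_forall fun p => by positivity)]
    exact lt_top_iff_ne_top.2 hfin
  rw [← ofReal_integral_eq_lintegral_ofReal hint (Eventually.of_forall fun p => by positivity)]
  refine ENNReal.ofReal_le_ofReal ?_
  set B := Icc (c - a) (c + a) with hB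
  have hconst : IntegrableOn (fun _ : ℝ => a ^ r) L := integrableOn_const hLfin
  have hd : IntegrableOn (fun x : ℝ => a ^ r - |x - c| ^ r) L := hconst.sub hint
  have hcont : Continuous fun x : ℝ => a ^ r - |x - c| ^ r := by
    fun_prop (disch := exact hr.le)
  have hdB : IntegrableOn (fun x : ℝ => a ^ r - |x - c| ^ r) B :=
    hcont.continuousOn.integrableOn_Icc
  have hBm : MeasurableSet B := measurableSet_Icc
  have hBmem : ∀ x, x ∈ B ↔ |x - c| ≤ a := fun x => by
    rw [hB, mem_Icc, abs_le]
    constructor <;> intro h <;> constructor <;> linarith [h.1, h.2]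
  have key : ∫ x in L, (a ^ r - |x - c| ^ r) ≤ ∫ x in B, (a ^ r - |x - c| ^ r) := by
    rw [← integral_indicator hL, ← integral_indicator hBm]
    refine integral_mono ((integrable_indicator_iff hL).2 hd)
      ((integrable_indicator_iff hBm).2 hdB) fun x => ?_
    by_cases hxB : x ∈ B
    · have h1 : |x - c| ^ r ≤ a ^ r := Real.rpow_le_rpow (abs_nonneg _) ((hBmem x).1 hxB) hr.le
      by_cases hxL : x ∈ L <;>
        simp only [indicator_of_mem, indicator_of_notMem, hxB, hxL, not_false_eq_true] <;> linarith
    · have h1 : a ^ r ≤ |x - c| ^ r :=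
        Real.rpow_le_rpow ha (not_le.1 fun h => hxB ((hBmem x).2 h)).le hr.le
      by_cases hxL : x ∈ L <;>
        simp only [indicator_of_mem, indicator_of_notMem, hxB, hxL, not_false_eq_true] <;> linarith
  have hcB : IntegrableOn (fun _ : ℝ => a ^ r) B := integrableOn_const (by simp [hB])
  have hpB : IntegrableOn (fun x : ℝ => |x - c| ^ r) B :=
    (by fun_prop (disch := exact hr.le) :
      Continuous fun x : ℝ => |x - c| ^ r).continuousOn.integrableOn_Icc
  rw [integral_sub hconst hint, integral_sub hcB hpB, integral_rpow_abs_symm hr ha] at key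
  have hvB : volume.real B = 2 * a := by
    rw [hB, Real.volume_real_Icc_of_le (by linarith)]; ring
  have hvL : volume.real L = 2 * a := by rw [ha_def, Measure.real]; ring
  simp only [setIntegral_const, hvB, hvL, smul_eq_mul] at key
  have e : (volume L).toReal ^ (r + 1) / (2 ^ r * (r + 1)) = 2 * a ^ (r + 1) / (r + 1) := by
    rw [show (volume L).toReal = 2 * a by rw [ha_def]; ring,
      Real.mul_rpow (by norm_num) ha, Real.rpow_add (by norm_num), Real.rpow_one]
    field_simp
  rw [e]
  linarith

theorem exists_set_density_oscillation_le {μ : Measure ℝ} [IsProbabilityMeasure μ] {f : ℝ → ℝ}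
    (hfm : Measurable f) (hlogf : Integrable (fun x => Real.log (f x)) μ)
    {η β : ℝ} (hη : 0 < η) (hβ : 0 < β) :
    ∃ K : Set ℝ, ∃ ρ > 0, MeasurableSet K ∧ μ.real Kᶜ ≤ β ∧
      ∀ x ∈ K, ∀ y ∈ K, |x - y| ≤ 2 * ρ → |Real.log (f x) - Real.log (f y)| ≤ 3 * η := by
  obtain ⟨u, hus, hu, huc, hui⟩ :=
    hlogf.exists_hasCompactSupport_integral_sub_le (mul_pos hη hβ)
  have huu := hus.uniformContinuous_of_continuous huc
  rw [Metric.uniformContinuous_iff] at huu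
  obtain ⟨δ, hδ, hδu⟩ := huu η hη
  refine ⟨{x | |Real.log (f x) - u x| ≤ η}, δ / 4, by positivity, ?_, ?_, ?_⟩
  · exact measurableSet_le (by fun_prop) measurable_const
  · have hmk := mul_meas_ge_le_integral_of_nonneg (μ := μ)
      (f := fun x => ‖Real.log (f x) - u x‖) (Eventually.of_forall fun x => norm_nonneg _)
      (hlogf.sub hui).norm η
    have h1 : μ.real {x | |Real.log (f x) - u x| ≤ η}ᶜ
        ≤ μ.real {x | η ≤ ‖Real.log (f x) - u x‖} :=
      measureReal_mono fun x hx => by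
        simp only [mem_compl_iff, mem_ofPred_eq, not_le] at hx
        exact hx.le
    have h2 := hmk.trans hu
    exact h1.trans (le_of_mul_le_mul_left h2 hη)
  · intro x hx y hy hxy
    have h := hδu (a := x) (b := y) (by rw [Real.dist_eq]; linarith)
    rw [Real.dist_eq] at h
    simp only [mem_ofPred_eq] at hx hy
    rw [abs_le] at hx hy ⊢
    rw [abs_lt] at h
    constructor <;> linarith [hx.1, hx.2, hy.1, hy.2, h.1, h.2]

namespace Quantizer

section Index

variable {E : Type*} [MeasurableSpace E] (q : Quantizer E)

theorem exists_mem (x : E) : ∃ i, x ∈ q.S i :=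
  mem_iUnion.1 (q.cover ▸ mem_univ x)

/-- The index of the quantization region containing a point. -/
def idx (x : E) : ℤ := (q.exists_mem x).choose

theorem mem_idx (x : E) : x ∈ q.S (q.idx x) := (q.exists_mem x).choose_spec

theorem idx_eq_iff {x : E} {i : ℤ} : q.idx x = i ↔ x ∈ q.S i := by
  refine ⟨fun h => h ▸ q.mem_idx x, fun h => ?_⟩
  by_contra hne
  exact (disjoint_left.1 (q.disj hne)) (q.mem_idx x) h

theorem measurable_idx : Measurable q.idx := by
  refine measurable_to_countable' fun i => ?_
  convert q.meas i using 1
  ext x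
  exact q.idx_eq_iff

variable (μ : Measure E)

theorem tsum_setLIntegral_inter {G : Set E} (hG : MeasurableSet G) (F : E → ℝ≥0∞) :
    ∑' i, ∫⁻ x in G ∩ q.S i, F x ∂μ = ∫⁻ x in G, F x ∂μ := by
  rw [← lintegral_iUnion (fun i => hG.inter (q.meas i))
    (fun i j hij => (q.disj hij).mono inter_subset_right inter_subset_right),
    ← inter_iUnion, q.cover, inter_univ]

theorem tsum_setLIntegral_s16 (F : E → ℝ≥0∞) :
    ∑' i, ∫⁻ x in q.S i, F x ∂μ = ∫⁻ x, F x ∂μ := by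
  simpa using q.tsum_setLIntegral_inter μ MeasurableSet.univ F

theorem tsum_measure_eq : ∑' i, μ (q.S i) = μ univ := by
  simpa using q.tsum_setLIntegral_s16 μ 1

theorem setLIntegral_inter_idx (G : Set E) (i : ℤ) (hG : MeasurableSet G) (F : ℤ → E → ℝ≥0∞) :
    ∫⁻ x in G ∩ q.S i, F (q.idx x) x ∂μ = ∫⁻ x in G ∩ q.S i, F i x ∂μ :=
  setLIntegral_congr_fun (hG.inter (q.meas i)) fun x hx => by
    simp only [q.idx_eq_iff.2 hx.2]

theorem setLIntegral_idx (i : ℤ) (F : ℤ → E → ℝ≥0∞) :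
    ∫⁻ x in q.S i, F (q.idx x) x ∂μ = ∫⁻ x in q.S i, F i x ∂μ := by
  simpa using q.setLIntegral_inter_idx μ univ i MeasurableSet.univ F

theorem distortion_eq_lintegral [Sub E] (N : E → ℝ) (r : ℝ) :
    q.distortion μ N r = ∫⁻ x, ENNReal.ofReal (N (x - q.c (q.idx x)) ^ r) ∂μ := by
  rw [← q.tsum_setLIntegral_s16 μ]
  exact tsum_congr fun i =>
    (q.setLIntegral_idx μ i fun i x => ENNReal.ofReal (N (x - q.c i) ^ r)).symm

theorem entropy_eq_lintegral [IsFiniteMeasure μ] :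
    q.entropy μ = ∫⁻ x, ENNReal.ofReal (-Real.log (μ.real (q.S (q.idx x)))) ∂μ := by
  rw [← q.tsum_setLIntegral_s16 μ]
  refine tsum_congr fun i => ?_
  rw [q.setLIntegral_idx μ i fun i _ => ENNReal.ofReal (-Real.log (μ.real (q.S i))),
    setLIntegral_const]
  change ENNReal.ofReal (Real.negMulLog (μ.real (q.S i))) = _
  rw [← ofReal_measureReal (μ := μ) (s := q.S i), ← ENNReal.ofReal_mul' measureReal_nonneg,
    Real.negMulLog]
  ring_nf

theorem ae_measureReal_idx_pos [IsFiniteMeasure μ] : ∀ᵐ x ∂μ, 0 < μ.real (q.S (q.idx x)) := by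
  have : ∀ᵐ x ∂μ, ∀ i, x ∈ q.S i → 0 < μ.real (q.S i) := by
    rw [ae_all_iff]
    intro i
    by_cases h : μ (q.S i) = 0
    · filter_upwards [measure_eq_zero_iff_ae_notMem.1 h] with x hx hx'
      exact absurd hx' hx
    · exact Eventually.of_forall fun x _ => ENNReal.toReal_pos h (measure_ne_top _ _)
  filter_upwards [this] with x hx using hx _ (q.mem_idx x)

theorem integrable_log_idx [IsProbabilityMeasure μ] (hH : q.entropy μ ≠ ∞) :
    Integrable (fun x => Real.log (μ.real (q.S (q.idx x)))) μ := by
  have hm : Measurable fun x => Real.log (μ.real (q.S (q.idx x))) :=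
    (Measurable.of_discrete (f := fun i => Real.log (μ.real (q.S i)))).comp q.measurable_idx
  rw [← integrable_neg_iff]
  refine ⟨hm.neg.aestronglyMeasurable, ?_⟩
  rw [hasFiniteIntegral_iff_ofReal]
  · simpa [q.entropy_eq_lintegral μ, lt_top_iff_ne_top] using hH
  · exact Eventually.of_forall fun x => by
      simpa using Real.log_nonpos measureReal_nonneg measureReal_le_one

theorem entropy_toReal_eq [IsProbabilityMeasure μ] :
    (q.entropy μ).toReal = -∫ x, Real.log (μ.real (q.S (q.idx x))) ∂μ := by
  have hm : Measurable fun x => Real.log (μ.real (q.S (q.idx x))) :=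
    (Measurable.of_discrete (f := fun i => Real.log (μ.real (q.S i)))).comp q.measurable_idx
  rw [q.entropy_eq_lintegral μ, ← integral_neg,
    integral_eq_lintegral_of_nonneg_ae (f := fun x => -Real.log (μ.real (q.S (q.idx x)))) _
      hm.neg.aestronglyMeasurable]
  exact Eventually.of_forall fun x => by
    simpa using Real.log_nonpos measureReal_nonneg measureReal_le_one

end Index

section LowerBound

variable {r D Λ : ℝ} {μ : Measure ℝ} {f : ℝ → ℝ} (q : Quantizer ℝ)

/-- A cell on which the density varies by a factor of at most `Λ` has distortion at least that of
an interval of the same length, up to the factor `Λ`. -/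
theorem rpow_mul_measure_le [IsFiniteMeasure μ] (hr : 0 < r) (hfm : Measurable f)
    (hμf : μ = volume.withDensity fun x => ENNReal.ofReal (f x)) (hΛ : 0 < Λ) {L : Set ℝ}
    (hL : MeasurableSet L) (hLfin : volume L ≠ ∞) (hosc : ∀ x ∈ L, ∀ y ∈ L, f x ≤ Λ * f y)
    (c : ℝ) :
    ENNReal.ofReal ((volume L).toReal ^ r) * μ L
      ≤ ENNReal.ofReal (Λ * (2 ^ r * (r + 1))) * ∫⁻ x in L, ENNReal.ofReal (|x - c| ^ r) ∂μ := by
  set l := (volume L).toReal with hl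
  rcases eq_or_ne l 0 with h0 | h0
  · simp [h0, Real.zero_rpow hr.ne']
  have hlpos : 0 < l := lt_of_le_of_ne ENNReal.toReal_nonneg h0.symm
  have hbelow : ∀ x ∈ L, ENNReal.ofReal (μ.real L / (Λ * l)) ≤ ENNReal.ofReal (f x) := by
    intro x hx
    have h1 : μ L ≤ ENNReal.ofReal (Λ * f x) * volume L := by
      rw [hμf, withDensity_apply _ hL, ← setLIntegral_const]
      exact setLIntegral_mono' hL fun y hy => ENNReal.ofReal_le_ofReal (hosc y hy x hx)
    rcases le_or_gt (f x) 0 with hfx | hfx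
    · have : μ L = 0 := by
        simpa [ENNReal.ofReal_of_nonpos (mul_nonpos_of_nonneg_of_nonpos hΛ.le hfx)] using h1
      simp [Measure.real, this]
    refine ENNReal.ofReal_le_ofReal ?_
    rw [← ENNReal.ofReal_toReal hLfin, ← ENNReal.ofReal_mul (by positivity)] at h1
    have h2 := ENNReal.toReal_le_of_le_ofReal (by positivity) h1
    rw [div_le_iff₀ (by positivity)]
    calc μ.real L ≤ Λ * f x * l := h2
      _ = f x * (Λ * l) := by ring
  calc ENNReal.ofReal (l ^ r) * μ L
      = ENNReal.ofReal (Λ * (2 ^ r * (r + 1))) * (ENNReal.ofReal (μ.real L / (Λ * l))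
          * ENNReal.ofReal (l ^ (r + 1) / (2 ^ r * (r + 1)))) := by
        rw [← ofReal_measureReal, ← ENNReal.ofReal_mul (by positivity),
          ← ENNReal.ofReal_mul (by positivity), ← ENNReal.ofReal_mul (by positivity),
          Real.rpow_add hlpos, Real.rpow_one]
        congr 1
        field_simp
    _ ≤ ENNReal.ofReal (Λ * (2 ^ r * (r + 1))) * (ENNReal.ofReal (μ.real L / (Λ * l))
          * ∫⁻ x in L, ENNReal.ofReal (|x - c| ^ r)) := by
        gcongr
        exact rpow_volume_le_setLIntegral hr hL hLfin c
    _ ≤ ENNReal.ofReal (Λ * (2 ^ r * (r + 1))) * ∫⁻ x in L, ENNReal.ofReal (|x - c| ^ r) ∂μ := by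
        gcongr
        rw [hμf, setLIntegral_withDensity_eq_setLIntegral_mul _ (by fun_prop) (by fun_prop) hL,
          ← lintegral_const_mul _ (by fun_prop)]
        refine setLIntegral_mono' hL fun x hx => ?_
        rw [← hμf]
        exact mul_le_mul_left (hbelow x hx) _

end LowerBound

end Quantizer

namespace Quantizer

section LowerBound

variable {r D Λ ε : ℝ} {μ : Measure ℝ} [IsProbabilityMeasure μ] {f : ℝ → ℝ} (q : Quantizer ℝ)

theorem setLIntegral_rpow_volume_le (hr : 0 < r) (hfm : Measurable f)
    (hμf : μ = volume.withDensity fun x => ENNReal.ofReal (f x)) (hΛ : 0 < Λ)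
    (hq : q.distortion μ (fun x => |x|) r ≤ ENNReal.ofReal D) {G : Set ℝ} (hG : MeasurableSet G)
    (hGfin : ∀ i, volume (G ∩ q.S i) ≠ ∞)
    (hosc : ∀ i, ∀ x ∈ G ∩ q.S i, ∀ y ∈ G ∩ q.S i, f x ≤ Λ * f y) :
    ∫⁻ x in G, ENNReal.ofReal ((volume (G ∩ q.S (q.idx x))).toReal ^ r) ∂μ
      ≤ ENNReal.ofReal (Λ * (2 ^ r * (r + 1)) * D) := by
  rw [← q.tsum_setLIntegral_inter μ hG]
  calc ∑' i, ∫⁻ x in G ∩ q.S i, ENNReal.ofReal ((volume (G ∩ q.S (q.idx x))).toReal ^ r) ∂μ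
      ≤ ∑' i, ENNReal.ofReal (Λ * (2 ^ r * (r + 1))) *
          ∫⁻ x in G ∩ q.S i, ENNReal.ofReal (|x - q.c (q.idx x)| ^ r) ∂μ := by
        refine ENNReal.tsum_le_tsum fun i => ?_
        rw [q.setLIntegral_inter_idx μ G i hG
            fun i _ => ENNReal.ofReal ((volume (G ∩ q.S i)).toReal ^ r),
          q.setLIntegral_inter_idx μ G i hG fun i x => ENNReal.ofReal (|x - q.c i| ^ r),
          setLIntegral_const]
        exact rpow_mul_measure_le hr hfm hμf hΛ (hG.inter (q.meas i)) (hGfin i) (hosc i) _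
    _ ≤ ENNReal.ofReal (Λ * (2 ^ r * (r + 1))) * q.distortion μ (fun x => |x|) r := by
        rw [ENNReal.tsum_mul_left, q.tsum_setLIntegral_inter μ hG, q.distortion_eq_lintegral]
        gcongr
        exact Measure.restrict_le_self
    _ ≤ ENNReal.ofReal (Λ * (2 ^ r * (r + 1)) * D) := by
        rw [ENNReal.ofReal_mul (p := Λ * (2 ^ r * (r + 1))) (by positivity)]
        exact mul_le_mul_right hq _

/-- A test density for cell `S i`: a mixture of the uniform density on `G ∩ S i` and an
exponential power density centred at the reconstruction point. -/
def testDensity (G : Set ℝ) (r s ε x : ℝ) : ℝ :=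
  G.indicator (fun x => (1 - ε) / (volume (G ∩ q.S (q.idx x))).toReal) x
    + ε * expPowDensity r s (x - q.c (q.idx x))

theorem measurable_testDensity {G : Set ℝ} (hG : MeasurableSet G) (r s ε : ℝ) :
    Measurable (q.testDensity G r s ε) := by
  have h1 : Measurable fun x => (1 - ε) / (volume (G ∩ q.S (q.idx x))).toReal :=
    (Measurable.of_discrete
      (f := fun i => (1 - ε) / (volume (G ∩ q.S i)).toReal)).comp q.measurable_idx
  have h2 : Measurable fun x => q.c (q.idx x) :=
    (Measurable.of_discrete (f := q.c)).comp q.measurable_idx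
  exact (h1.indicator hG).add
    (measurable_const.mul (measurable_expPowDensity.comp (measurable_id.sub h2)))

theorem setLIntegral_testDensity_le (hr : 0 < r) {s : ℝ} (hs : 0 < s) (hε0 : 0 < ε) (hε1 : ε < 1)
    {G : Set ℝ} (hG : MeasurableSet G) (hGfin : ∀ i, volume (G ∩ q.S i) ≠ ∞) (i : ℤ) :
    ∫⁻ x in q.S i, ENNReal.ofReal (q.testDensity G r s ε x) ≤ 1 := by
  have hε1' : 0 ≤ 1 - ε := by linarith
  calc ∫⁻ x in q.S i, ENNReal.ofReal (q.testDensity G r s ε x)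
      = ∫⁻ x in q.S i, ENNReal.ofReal
          (G.indicator (fun _ => (1 - ε) / (volume (G ∩ q.S i)).toReal) x
            + ε * expPowDensity r s (x - q.c i)) := by
        refine setLIntegral_congr_fun (q.meas i) fun x hx => ?_
        simp only [testDensity, indicator, q.idx_eq_iff.2 hx]
    _ ≤ ∫⁻ x in q.S i, (G.indicator
          (fun _ => ENNReal.ofReal ((1 - ε) / (volume (G ∩ q.S i)).toReal)) x
            + ENNReal.ofReal ε * ENNReal.ofReal (expPowDensity r s (x - q.c i))) := by
        refine lintegral_mono fun x => ENNReal.ofReal_add_le.trans ?_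
        rw [ENNReal.ofReal_mul hε0.le]
        gcongr
        by_cases hx : x ∈ G <;> simp [hx]
    _ ≤ ENNReal.ofReal (1 - ε) + ENNReal.ofReal ε := by
        rw [lintegral_add_left (measurable_const.indicator hG), lintegral_indicator hG,
          Measure.restrict_restrict hG, setLIntegral_const]
        gcongr
        · by_cases h0 : (volume (G ∩ q.S i)).toReal = 0
          · simp [h0]
          · refine (mul_le_mul_right (ENNReal.ofReal_toReal (hGfin i)).ge _).trans ?_
            rw [← ENNReal.ofReal_mul (by positivity), div_mul_cancel₀ _ h0]
        · rw [lintegral_const_mul _ (by fun_prop)]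
          refine mul_le_of_le_one_right' ?_
          refine (setLIntegral_le_lintegral _ _).trans ?_
          rw [lintegral_sub_right_eq_self (fun x => ENNReal.ofReal (expPowDensity r s x)),
            lintegral_expPowDensity hr hs]
    _ = 1 := by rw [← ENNReal.ofReal_add hε1' hε0.le]; simp

/-- Gibbs' inequality for the output of a quantizer. -/
theorem integral_sub_le_entropy (hfm : Measurable f)
    (hμf : μ = volume.withDensity fun x => ENNReal.ofReal (f x))
    (hlogf : Integrable (fun x => Real.log (f x)) μ) (hH : q.entropy μ ≠ ∞)
    {ψ b : ℝ → ℝ} (hψ : Measurable ψ) (hψpos : ∀ᵐ x ∂μ, 0 < ψ x)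
    (hψint : ∀ i, ∫⁻ x in q.S i, ENNReal.ofReal (ψ x) ≤ 1) (hb : Integrable b μ)
    (hbψ : ∀ᵐ x ∂μ, b x ≤ Real.log (ψ x)) :
    ∫ x, b x ∂μ - ∫ x, Real.log (f x) ∂μ ≤ (q.entropy μ).toReal := by
  have hP : Measurable fun x => μ.real (q.S (q.idx x)) :=
    (Measurable.of_discrete (f := fun i => μ.real (q.S i))).comp q.measurable_idx
  have hlogP := q.integrable_log_idx μ hH
  have hbP : Integrable (fun x => b x + Real.log (μ.real (q.S (q.idx x)))) μ := hb.add hlogP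
  have hle : ∫⁻ x, ENNReal.ofReal (μ.real (q.S (q.idx x)) * ψ x / f x) ∂μ ≤ ENNReal.ofReal 1 := by
    refine (lintegral_div_density_le hfm hμf (hP.mul hψ)).trans ?_
    rw [← q.tsum_setLIntegral_s16, ENNReal.ofReal_one]
    calc ∑' i, ∫⁻ x in q.S i, ENNReal.ofReal (μ.real (q.S (q.idx x)) * ψ x)
        ≤ ∑' i, μ (q.S i) := by
          refine ENNReal.tsum_le_tsum fun i => ?_
          rw [q.setLIntegral_idx volume i fun i x => ENNReal.ofReal (μ.real (q.S i) * ψ x)]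
          simp_rw [ENNReal.ofReal_mul measureReal_nonneg]
          rw [lintegral_const_mul _ (by fun_prop), ofReal_measureReal]
          exact mul_le_of_le_one_right' (hψint i)
      _ = 1 := by rw [q.tsum_measure_eq, measure_univ]
  have hPpos := q.ae_measureReal_idx_pos μ
  have hfpos := ae_density_pos hfm hμf
  have hgibbs := integral_le_log_of_le_log
    (b := fun x => b x + Real.log (μ.real (q.S (q.idx x))) - Real.log (f x)) one_pos
    ((hP.mul hψ).div hfm).aemeasurable
    (by filter_upwards [hPpos, hfpos, hψpos] with x h1 h2 h3
        exact div_pos (mul_pos h1 h3) h2)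
    (hbP.sub hlogf)
    (by filter_upwards [hPpos, hfpos, hψpos, hbψ] with x h1 h2 h3 h4
        change _ ≤ Real.log (_ * _ / _)
        rw [Real.log_div (mul_pos h1 h3).ne' h2.ne', Real.log_mul h1.ne' h3.ne']
        linarith)
    hle
  rw [integral_sub hbP hlogf, integral_add hb hlogP, Real.log_one] at hgibbs
  rw [q.entropy_toReal_eq]
  linarith

theorem le_entropy_of_oscillation_le (hr : 0 < r) (hD : 0 < D) (hfm : Measurable f)
    (hμf : μ = volume.withDensity fun x => ENNReal.ofReal (f x))
    (hlogf : Integrable (fun x => Real.log (f x)) μ) (hΛ : 0 < Λ)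
    (hq : q.distortion μ (fun x => |x|) r ≤ ENNReal.ofReal D) (hH : q.entropy μ ≠ ∞)
    {G : Set ℝ} (hG : MeasurableSet G)
    (hGfin : ∀ i, volume (G ∩ q.S i) ≠ ∞)
    (hosc : ∀ i, ∀ x ∈ G ∩ q.S i, ∀ y ∈ G ∩ q.S i, f x ≤ Λ * f y) (hε0 : 0 < ε) (hε1 : ε < 1) :
    (Real.log (1 - ε) + 1 / r - 1 / r * Real.log (2 ^ r * (r + 1) * D)) * μ.real G
      - Λ / r
      + (Real.log ε + Real.log (expPowNorm r * (ε / D) ^ (1 / r))) * μ.real Gᶜ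
      - ε - ∫ x, Real.log (f x) ∂μ ≤ (q.entropy μ).toReal := by
  set s := ε / D with hs_def
  have hs : 0 < s := by positivity
  set a := 2 ^ r * (r + 1) * D with ha_def
  have ha : 0 < a := by positivity
  set l : ℝ → ℝ := fun x => (volume (G ∩ q.S (q.idx x))).toReal with hl_def
  have hl : Measurable l :=
    (Measurable.of_discrete (f := fun i => (volume (G ∩ q.S i)).toReal)).comp q.measurable_idx
  have hc : Measurable fun x => q.c (q.idx x) :=
    (Measurable.of_discrete (f := q.c)).comp q.measurable_idx
  set dist : ℝ → ℝ := fun x => |x - q.c (q.idx x)| ^ r with hdist_def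
  have hdm : Measurable dist := by fun_prop
  have hdist0 : ∀ x, 0 ≤ dist x := fun x => by positivity
  have hlr0 : ∀ x, 0 ≤ l x ^ r := fun x => Real.rpow_nonneg ENNReal.toReal_nonneg r
  rw [q.distortion_eq_lintegral] at hq
  have hdist : Integrable dist μ := by
    refine ⟨hdm.aestronglyMeasurable, ?_⟩
    rw [hasFiniteIntegral_iff_ofReal (Eventually.of_forall hdist0)]
    exact hq.trans_lt ENNReal.ofReal_lt_top
  have hdistD : ∫ x in Gᶜ, dist x ∂μ ≤ D := by
    refine (setIntegral_le_integral hdist (Eventually.of_forall hdist0)).trans ?_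
    rw [integral_eq_lintegral_of_nonneg_ae (Eventually.of_forall hdist0) hdm.aestronglyMeasurable]
    exact ENNReal.toReal_le_of_le_ofReal hD.le hq
  rw [← q.distortion_eq_lintegral μ (fun x => |x|)] at hq
  have hvol := q.setLIntegral_rpow_volume_le hr hfm hμf hΛ hq hG hGfin hosc
  have hlm : Measurable fun x => l x ^ r := by fun_prop
  have hlint : IntegrableOn (fun x => l x ^ r) G μ := by
    refine ⟨hlm.aestronglyMeasurable, ?_⟩
    rw [hasFiniteIntegral_iff_ofReal (Eventually.of_forall hlr0)]
    exact hvol.trans_lt ENNReal.ofReal_lt_top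
  have hlD : ∫ x in G, l x ^ r ∂μ ≤ Λ * a := by
    rw [integral_eq_lintegral_of_nonneg_ae (Eventually.of_forall hlr0) hlm.aestronglyMeasurable]
    refine (ENNReal.toReal_le_of_le_ofReal (by positivity) hvol).trans_eq ?_
    rw [ha_def]; ring
  have hlpos : ∀ᵐ x ∂μ, x ∈ G → 0 < l x := by
    have : ∀ᵐ x ∂μ, ∀ i, x ∈ G ∩ q.S i → 0 < (volume (G ∩ q.S i)).toReal := by
      rw [ae_all_iff]
      intro i
      by_cases h : volume (G ∩ q.S i) = 0
      · have h' : μ (G ∩ q.S i) = 0 := hμf ▸ withDensity_absolutelyContinuous _ _ h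
        filter_upwards [measure_eq_zero_iff_ae_notMem.1 h'] with x hx hx'
        exact absurd hx' hx
      · exact Eventually.of_forall fun x _ => ENNReal.toReal_pos h (hGfin i)
    filter_upwards [this] with x hx hxG using hx _ ⟨hxG, q.mem_idx x⟩
  set k₁ := Real.log (1 - ε) + 1 / r - 1 / r * Real.log a with hk₁
  set k₂ := Real.log ε + Real.log (expPowNorm r * s ^ (1 / r)) with hk₂
  set b₁ : ℝ → ℝ := fun x => k₁ - 1 / (r * a) * l x ^ r with hb₁
  set b₂ : ℝ → ℝ := fun x => k₂ - s * dist x with hb₂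
  have hb₁i : IntegrableOn b₁ G μ := (integrable_const _).sub (hlint.const_mul _)
  have hb₂i : IntegrableOn b₂ Gᶜ μ := (integrable_const _).sub (hdist.integrableOn.const_mul _)
  have hmix : ∀ x, 0 < ε * expPowDensity r s (x - q.c (q.idx x)) := fun x =>
    mul_pos hε0 (expPowDensity_pos hr hs _)
  have hψpos : ∀ x, 0 < q.testDensity G r s ε x := fun x => by
    refine add_pos_of_nonneg_of_pos (indicator_nonneg (fun x _ => ?_) x) (hmix x)
    have : 0 ≤ 1 - ε := by linarith
    positivity
  have hmain := q.integral_sub_le_entropy hfm hμf hlogf hH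
    (b := fun x => G.indicator b₁ x + Gᶜ.indicator b₂ x)
    (q.measurable_testDensity hG r s ε) (Eventually.of_forall hψpos)
    (q.setLIntegral_testDensity_le hr hs hε0 hε1 hG hGfin)
    ((hb₁i.integrable_indicator hG).add (hb₂i.integrable_indicator hG.compl)) ?_
  · rw [integral_add (hb₁i.integrable_indicator hG) (hb₂i.integrable_indicator hG.compl),
      integral_indicator hG, integral_indicator hG.compl,
      integral_sub (integrable_const _) (hlint.const_mul _),
      integral_sub (integrable_const _) (hdist.integrableOn.const_mul _),
      integral_const_mul, integral_const_mul, setIntegral_const, setIntegral_const,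
      smul_eq_mul, smul_eq_mul] at hmain
    have h1 : 1 / (r * a) * ∫ x in G, l x ^ r ∂μ ≤ Λ / r := by
      calc _ ≤ 1 / (r * a) * (Λ * a) := by gcongr
        _ = Λ / r := by field_simp
    have h2 : s * ∫ x in Gᶜ, dist x ∂μ ≤ ε := by
      calc _ ≤ s * D := by gcongr
        _ = ε := by rw [hs_def]; field_simp
    linarith
  · filter_upwards [hlpos] with x hx
    by_cases hxG : x ∈ G
    · have hlx := hx hxG
      have h1ε : 0 < 1 - ε := by linarith
      have hstep : Real.log ((1 - ε) / l x) ≤ Real.log (q.testDensity G r s ε x) := by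
        refine Real.log_le_log (by positivity) ?_
        rw [testDensity, indicator_of_mem hxG]
        exact (le_add_iff_nonneg_right _).2 (hmix x).le
      simp only [indicator_of_mem hxG, indicator_of_notMem (notMem_compl_iff.2 hxG), add_zero]
      refine le_trans ?_ hstep
      rw [Real.log_div h1ε.ne' hlx.ne', hb₁]
      have ht := Real.log_le_sub_one_of_pos (show 0 < l x ^ r / a by positivity)
      rw [Real.log_div (by positivity) ha.ne', Real.log_rpow hlx] at ht
      have h3 : Real.log (l x) ≤ 1 / r * (l x ^ r / a - 1 + Real.log a) := by
        rw [one_div, ← div_eq_inv_mul, le_div_iff₀ hr]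
        linarith
      have h4 : 1 / (r * a) * l x ^ r = 1 / r * (l x ^ r / a) := by field_simp
      simp only [hk₁, h4]
      linarith
    · simp only [indicator_of_notMem hxG, indicator_of_mem (mem_compl hxG), zero_add]
      rw [testDensity, indicator_of_notMem hxG, zero_add,
        Real.log_mul hε0.ne' (expPowDensity_pos hr hs _).ne', log_expPowDensity hr hs]
      simp only [hb₂, hk₂, hdist_def]
      linarith

end LowerBound

end Quantizer

namespace Quantizer

theorem measureReal_lt_abs_sub_le {r D ρ : ℝ} (hD : 0 ≤ D) (hr : 0 < r) (hρ : 0 < ρ)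
    {μ : Measure ℝ} [IsFiniteMeasure μ]
    (q : Quantizer ℝ) (hq : q.distortion μ (fun x => |x|) r ≤ ENNReal.ofReal D) :
    μ.real {x | ρ < |x - q.c (q.idx x)|} ≤ D / ρ ^ r := by
  have hρr : 0 < ρ ^ r := by positivity
  have hc : Measurable fun x => q.c (q.idx x) :=
    (Measurable.of_discrete (f := q.c)).comp q.measurable_idx
  rw [q.distortion_eq_lintegral] at hq
  have hM := mul_meas_ge_le_lintegral (μ := μ)
    (f := fun x => ENNReal.ofReal (|x - q.c (q.idx x)| ^ r)) (by fun_prop) (ENNReal.ofReal (ρ ^ r))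
  have hsub : {x | ρ < |x - q.c (q.idx x)|}
      ⊆ {x | ENNReal.ofReal (ρ ^ r) ≤ ENNReal.ofReal (|x - q.c (q.idx x)| ^ r)} := fun x hx =>
    ENNReal.ofReal_le_ofReal (Real.rpow_le_rpow hρ.le (le_of_lt hx) hr.le)
  rw [le_div_iff₀ hρr, mul_comm]
  have h := ((mul_le_mul_right (measure_mono hsub) _).trans hM).trans hq
  rw [← ofReal_measureReal, ← ENNReal.ofReal_mul hρr.le] at h
  exact (ENNReal.ofReal_le_ofReal_iff hD).1 h

/-- Asymptotic lower bound for the entropy of quantizers of vanishing distortion. -/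
theorem eventually_le_entropy {r τ : ℝ} (hr : 0 < r) (hτ : 0 < τ) {μ : Measure ℝ}
    [IsProbabilityMeasure μ] {f : ℝ → ℝ} (hfm : Measurable f)
    (hμf : μ = volume.withDensity fun x => ENNReal.ofReal (f x))
    (hlogf : Integrable (fun x => Real.log (f x)) μ) :
    ∀ᶠ D in 𝓝[>] (0 : ℝ), ∀ q : Quantizer ℝ,
      q.distortion μ (fun x => |x|) r ≤ ENNReal.ofReal D →
      ENNReal.ofReal (-∫ x, Real.log (f x) ∂μ - 1 / r * Real.log (2 ^ r * (r + 1) * D) - τ)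
        ≤ q.entropy μ := by
  set ε := min (1 / 2) (τ / 16) with hε
  have hε0 : 0 < ε := by positivity
  have hε2 : ε ≤ 1 / 2 := min_le_left _ _
  have hετ : ε ≤ τ / 16 := min_le_right _ _
  have hε1 : ε < 1 := by linarith
  have hlogε : -(2 * ε) ≤ Real.log (1 - ε) := by
    have h := Real.one_sub_inv_le_log_of_pos (show 0 < 1 - ε by linarith)
    have h2 : (1 - ε)⁻¹ ≤ 1 + 2 * ε := by
      rw [inv_le_iff_one_le_mul₀ (by linarith)]
      nlinarith
    linarith
  set Λ := 1 + r * τ / 4 with hΛ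
  have hΛ1 : 1 < Λ := by rw [hΛ]; linarith [show 0 < r * τ / 4 by positivity]
  set X := Real.log ε - Real.log (2 * Real.Gamma (1 + 1 / r)) + 1 / r * Real.log ε
    + 1 / r * Real.log (2 ^ r * (r + 1)) - 1 / r with hX
  set β := τ / 4 / (|X| + 1) with hβ
  have hβ0 : 0 < β := by positivity
  have hβX : β * |X| ≤ τ / 4 := by
    rw [hβ, div_mul_eq_mul_div, div_le_iff₀ (by positivity)]
    nlinarith [abs_nonneg X]
  obtain ⟨K, ρ, hρ, hK, hKβ, hosc⟩ := exists_set_density_oscillation_le (μ := μ) hfm hlogf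
    (show 0 < Real.log Λ / 3 from div_pos (Real.log_pos hΛ1) (by norm_num)) (half_pos hβ0)
  have hev : ∀ᶠ D in 𝓝[>] (0 : ℝ), D < β / 2 * ρ ^ r :=
    nhdsWithin_le_nhds (Iio_mem_nhds (by positivity))
  filter_upwards [hev, self_mem_nhdsWithin] with D hDβ hD q hq
  have hD : 0 < D := hD
  by_cases hH : q.entropy μ = ∞
  · simp [hH]
  refine ENNReal.ofReal_le_of_le_toReal ?_
  have hc : Measurable fun x => q.c (q.idx x) :=
    (Measurable.of_discrete (f := q.c)).comp q.measurable_idx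
  set G : Set ℝ := K ∩ {x | 0 < f x} ∩ {x | |x - q.c (q.idx x)| ≤ ρ} with hGdef
  have hG : MeasurableSet G := (hK.inter (measurableSet_lt measurable_const hfm)).inter
    (measurableSet_le (by fun_prop) measurable_const)
  have hball : ∀ i, ∀ x ∈ G ∩ q.S i, |x - q.c i| ≤ ρ := fun i x hx => by
    have := hx.1.2
    rwa [mem_ofPred_eq, q.idx_eq_iff.2 hx.2] at this
  have hGfin : ∀ i, volume (G ∩ q.S i) ≠ ∞ := fun i => by
    refine ((measure_mono fun x hx => ?_).trans_lt
      (measure_closedBall_lt_top (x := q.c i) (r := ρ))).ne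
    rw [Metric.mem_closedBall, Real.dist_eq]
    exact hball i x hx
  have hoscG : ∀ i, ∀ x ∈ G ∩ q.S i, ∀ y ∈ G ∩ q.S i, f x ≤ Λ * f y := fun i x hx y hy => by
    have h1 : |x - y| ≤ 2 * ρ := by
      have h1 := abs_le.1 (hball i x hx)
      have h2 := abs_le.1 (hball i y hy)
      exact abs_le.2 ⟨by linarith, by linarith⟩
    have h2 := (abs_le.1 (hosc x hx.1.1.1 y hy.1.1.1 h1)).2
    have hfx : 0 < f x := hx.1.1.2
    have hfy : 0 < f y := hy.1.1.2
    rw [← Real.log_le_log_iff hfx (by positivity), Real.log_mul (by positivity) hfy.ne']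
    linarith
  have hGβ : μ.real Gᶜ ≤ β := by
    have hf0 : μ.real {x | 0 < f x}ᶜ = 0 := by
      rw [measureReal_eq_zero_iff]
      exact ae_density_pos hfm hμf
    have h1 := q.measureReal_lt_abs_sub_le hD.le hr hρ hq
    have h2 : D / ρ ^ r ≤ β / 2 := by
      rw [div_le_iff₀ (by positivity)]
      exact hDβ.le
    have h3 : {x | |x - q.c (q.idx x)| ≤ ρ}ᶜ = {x | ρ < |x - q.c (q.idx x)|} := by
      ext; simp
    have h4 : μ.real Gᶜ ≤ μ.real Kᶜ + μ.real {x | 0 < f x}ᶜ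
        + μ.real {x | |x - q.c (q.idx x)| ≤ ρ}ᶜ := by
      rw [hGdef, compl_inter, compl_inter]
      exact (measureReal_union_le _ _).trans (by gcongr; exact measureReal_union_le _ _)
    rw [h3, hf0] at h4
    linarith
  have hmain := q.le_entropy_of_oscillation_le hr hD hfm hμf hlogf (zero_lt_one.trans hΛ1) hq hH
    hG hGfin hoscG hε0 hε1
  refine le_trans ?_ hmain
  rw [log_expPowNorm_mul hr (div_pos hε0 hD), Real.log_div hε0.ne' hD.ne',
    Real.log_mul (x := 2 ^ r * (r + 1)) (by positivity) hD.ne', measureReal_compl hG,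
    probReal_univ]
  rw [measureReal_compl hG, probReal_univ] at hGβ
  set p := μ.real G
  have hp1 : p ≤ 1 := measureReal_le_one
  have hp0 : 0 ≤ p := measureReal_nonneg
  have e1 : Λ / r = 1 / r + τ / 4 := by rw [hΛ]; field_simp
  have e2 : -(2 * ε) ≤ Real.log (1 - ε) * p := by nlinarith
  have e3 : -(τ / 4) ≤ (1 - p) * X := by
    have : (1 - p) * (-X) ≤ β * |X| := by
      refine (mul_le_mul_of_nonneg_left (neg_le_abs X) (by linarith)).trans ?_
      gcongr
    linarith
  rw [e1]
  have e4 : 0 ≤ τ - τ / 4 - ε + Real.log (1 - ε) * p + (1 - p) * X := by linarith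
  rw [hX] at e4
  linear_combination e4

end Quantizer

theorem eventually_le_RQfun {r τ : ℝ} (hr : 0 < r) (hτ : 0 < τ) {μ : Measure ℝ}
    [IsProbabilityMeasure μ] {f : ℝ → ℝ} (hfm : Measurable f)
    (hμf : μ = volume.withDensity fun x => ENNReal.ofReal (f x))
    (hlogf : Integrable (fun x => Real.log (f x)) μ) :
    ∀ᶠ D in 𝓝[>] (0 : ℝ),
      ENNReal.ofReal (-∫ x, Real.log (f x) ∂μ - 1 / r * Real.log (2 ^ r * (r + 1) * D) - τ)
        ≤ RQfun μ (fun x => |x|) r D := by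
  filter_upwards [Quantizer.eventually_le_entropy hr hτ hfm hμf hlogf] with D hD
  exact le_iInf₂ fun q hq => hD q hq

section Grid

/-- The mass that `μ` gives to the `j`-th cell of the grid of mesh `1 / m`. -/
def gridMass (μ : Measure ℝ) (m : ℕ) (j : ℤ) : ℝ := μ.real {y | ⌊(m : ℝ) * y⌋ = j}

variable {μ : Measure ℝ} {m : ℕ}

theorem setOf_floor_mul_eq (hm : 0 < m) (j : ℤ) :
    {y : ℝ | ⌊(m : ℝ) * y⌋ = j} = Ico (j * (1 / m : ℝ)) ((j + 1) * (1 / m : ℝ)) := by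
  have hm' : (0 : ℝ) < m := Nat.cast_pos.2 hm
  ext y
  rw [mem_ofPred_eq, Int.floor_eq_iff, mem_Ico, mul_one_div, mul_one_div, div_le_iff₀ hm',
    lt_div_iff₀ hm', mul_comm y]

theorem measurable_floor_mul (m : ℕ) : Measurable fun y : ℝ => ⌊(m : ℝ) * y⌋ :=
  Int.measurable_floor.comp (measurable_const_mul _)

theorem volume_setOf_floor_mul_eq (hm : 0 < m) (j : ℤ) :
    volume {y : ℝ | ⌊(m : ℝ) * y⌋ = j} = ENNReal.ofReal (1 / m) := by
  rw [setOf_floor_mul_eq hm, Real.volume_Ico]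
  congr 1; ring

/-- The uniform quantizer with step `1 / m` and reconstruction at midpoints. -/
def uniformQuantizer (m : ℕ) (hm : 0 < m) : Quantizer ℝ where
  S i := Ico (i * (1 / m : ℝ)) ((i + 1) * (1 / m : ℝ))
  c i := i * (1 / m : ℝ) + (1 / m : ℝ) / 2
  meas _ := measurableSet_Ico
  disj i j hij := by
    simp only [Function.onFun, ← setOf_floor_mul_eq hm]
    exact disjoint_left.2 fun x hx hx' => hij (hx.symm.trans hx')
  cover := by
    simp only [← setOf_floor_mul_eq hm]
    exact eq_univ_of_forall fun x => mem_iUnion.2 ⟨⌊(m : ℝ) * x⌋, rfl⟩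

theorem uniformQuantizer_S (hm : 0 < m) (j : ℤ) :
    (uniformQuantizer m hm).S j = {y | ⌊(m : ℝ) * y⌋ = j} :=
  (setOf_floor_mul_eq hm j).symm

theorem uniformQuantizer_idx (hm : 0 < m) (x : ℝ) :
    (uniformQuantizer m hm).idx x = ⌊(m : ℝ) * x⌋ := by
  rw [Quantizer.idx_eq_iff, uniformQuantizer_S]; rfl

theorem measureReal_uniformQuantizer_S (hm : 0 < m) (x : ℝ) :
    μ.real ((uniformQuantizer m hm).S ((uniformQuantizer m hm).idx x))
      = gridMass μ m ⌊(m : ℝ) * x⌋ := by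
  rw [uniformQuantizer_idx, uniformQuantizer_S, gridMass]

theorem gridMass_nonneg (j : ℤ) : 0 ≤ gridMass μ m j := measureReal_nonneg

theorem gridMass_le_one [IsProbabilityMeasure μ] (j : ℤ) : gridMass μ m j ≤ 1 :=
  measureReal_le_one

theorem ae_gridMass_pos [IsFiniteMeasure μ] (hm : 0 < m) :
    ∀ᵐ x ∂μ, 0 < gridMass μ m ⌊(m : ℝ) * x⌋ := by
  filter_upwards [(uniformQuantizer m hm).ae_measureReal_idx_pos μ] with x hx
  rwa [measureReal_uniformQuantizer_S] at hx

theorem lintegral_gridMass_mul [IsFiniteMeasure μ] (hm : 0 < m) (g : ℤ → ℝ≥0∞) :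
    ∫⁻ x, ENNReal.ofReal (m * gridMass μ m ⌊(m : ℝ) * x⌋) * g ⌊(m : ℝ) * x⌋
      = ∫⁻ x, g ⌊(m : ℝ) * x⌋ ∂μ := by
  have hm' : (0 : ℝ) < m := Nat.cast_pos.2 hm
  set q := uniformQuantizer m hm
  simp only [← uniformQuantizer_idx hm]
  rw [← q.tsum_setLIntegral_s16, ← q.tsum_setLIntegral_s16]
  refine tsum_congr fun i => ?_
  rw [q.setLIntegral_idx volume i fun i _ => ENNReal.ofReal (m * gridMass μ m i) * g i,
    q.setLIntegral_idx μ i fun i _ => g i, setLIntegral_const, setLIntegral_const,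
    uniformQuantizer_S, volume_setOf_floor_mul_eq hm, mul_right_comm,
    ← ENNReal.ofReal_mul (mul_nonneg hm'.le (gridMass_nonneg i)),
    mul_comm (m : ℝ), mul_assoc, mul_one_div_cancel hm'.ne', mul_one, gridMass,
    ofReal_measureReal, mul_comm]

theorem lintegral_gridMass [IsProbabilityMeasure μ] (hm : 0 < m) :
    ∫⁻ x, ENNReal.ofReal (m * gridMass μ m ⌊(m : ℝ) * x⌋) = 1 := by
  simpa using lintegral_gridMass_mul (μ := μ) hm 1

theorem floor_mul_ediv (hm : 0 < m) (x : ℝ) : ⌊(m : ℝ) * x⌋ / m = ⌊((1 : ℕ) : ℝ) * x⌋ := by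
  rw [← Int.floor_div_natCast, mul_div_cancel_left₀ _ (Nat.cast_ne_zero.2 hm.ne'),
    Nat.cast_one, one_mul]

theorem gridMass_le_ediv [IsFiniteMeasure μ] (hm : 0 < m) (j : ℤ) :
    gridMass μ m j ≤ gridMass μ 1 (j / m) :=
  measureReal_mono fun x (hx : ⌊(m : ℝ) * x⌋ = j) => by
    rw [mem_ofPred_eq, ← floor_mul_ediv hm, hx]

theorem entropy_uniformQuantizer_one_ne_top [IsProbabilityMeasure μ]
    (hfloor : Summable fun k : ℤ => Real.negMulLog (μ {x | ⌊x⌋ = k}).toReal) :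
    (uniformQuantizer 1 one_pos).entropy μ ≠ ∞ := by
  have := hfloor.tsum_ofReal_ne_top
  simpa only [Quantizer.entropy, uniformQuantizer_S, Nat.cast_one, one_mul] using this

theorem entropy_uniformQuantizer_ne_top [IsProbabilityMeasure μ]
    (hfloor : Summable fun k : ℤ => Real.negMulLog (μ {x | ⌊x⌋ = k}).toReal) (hm : 0 < m) :
    (uniformQuantizer m hm).entropy μ ≠ ∞ := by
  have h1 := entropy_uniformQuantizer_one_ne_top hfloor
  rw [Quantizer.entropy_eq_lintegral] at h1 ⊢
  simp only [measureReal_uniformQuantizer_S, ← floor_mul_ediv hm] at h1 ⊢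
  have hm' : (0 : ℝ) < m := Nat.cast_pos.2 hm
  have h2 : ∫⁻ x, ENNReal.ofReal (gridMass μ 1 (⌊(m : ℝ) * x⌋ / m)
      / gridMass μ m ⌊(m : ℝ) * x⌋) ∂μ ≤ ENNReal.ofReal m := by
    rw [← lintegral_gridMass_mul hm
      fun j => ENNReal.ofReal (gridMass μ 1 (j / m) / gridMass μ m j)]
    calc _ ≤ ∫⁻ x, ENNReal.ofReal m * ENNReal.ofReal (gridMass μ 1 (⌊(m : ℝ) * x⌋ / m)) := by
          refine lintegral_mono fun x => ?_
          rw [← ENNReal.ofReal_mul (mul_nonneg hm'.le (gridMass_nonneg _)),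
            ← ENNReal.ofReal_mul hm'.le]
          refine ENNReal.ofReal_le_ofReal ?_
          rw [mul_assoc]
          refine mul_le_mul_of_nonneg_left ?_ hm'.le
          rcases eq_or_ne (gridMass μ m ⌊(m : ℝ) * x⌋) 0 with h | h
          · simpa [h] using gridMass_nonneg _
          · rw [mul_div_cancel₀ _ h]
      _ = ENNReal.ofReal m := by
          have := lintegral_gridMass (μ := μ) one_pos
          simp only [Nat.cast_one, one_mul] at this
          rw [lintegral_const_mul' _ _ ENNReal.ofReal_ne_top]
          simp only [floor_mul_ediv hm, Nat.cast_one, one_mul, this, mul_one]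
  refine ne_top_of_le_ne_top (ENNReal.add_ne_top.2
    ⟨h1, ne_top_of_le_ne_top ENNReal.ofReal_ne_top h2⟩) ?_
  have hmeas : Measurable fun x : ℝ =>
      ENNReal.ofReal (-Real.log (gridMass μ 1 (⌊(m : ℝ) * x⌋ / m))) :=
    (Measurable.of_discrete
      (f := fun j : ℤ => ENNReal.ofReal (-Real.log (gridMass μ 1 (j / m))))).comp
        (measurable_floor_mul m)
  rw [← lintegral_add_left hmeas]
  refine lintegral_mono_ae ?_
  filter_upwards [ae_gridMass_pos hm] with x hx
  rw [← ENNReal.ofReal_add (neg_nonneg.2 (Real.log_nonpos (gridMass_nonneg _) (gridMass_le_one _)))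
    (div_nonneg (gridMass_nonneg _) (gridMass_nonneg _))]
  refine ENNReal.ofReal_le_ofReal ?_
  have hw := hx.trans_le (gridMass_le_ediv hm _)
  have := Real.log_le_self (div_pos hw hx).le
  rw [Real.log_div hw.ne' hx.ne'] at this
  linarith

theorem integrable_log_gridMass [IsProbabilityMeasure μ]
    (hfloor : Summable fun k : ℤ => Real.negMulLog (μ {x | ⌊x⌋ = k}).toReal) (hm : 0 < m) :
    Integrable (fun x => Real.log (gridMass μ m ⌊(m : ℝ) * x⌋)) μ := by
  have := (uniformQuantizer m hm).integrable_log_idx μ (entropy_uniformQuantizer_ne_top hfloor hm)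
  simpa only [measureReal_uniformQuantizer_S] using this

theorem entropy_uniformQuantizer_toReal [IsProbabilityMeasure μ] (hm : 0 < m) :
    ((uniformQuantizer m hm).entropy μ).toReal
      = -∫ x, Real.log (gridMass μ m ⌊(m : ℝ) * x⌋) ∂μ := by
  simp only [Quantizer.entropy_toReal_eq, measureReal_uniformQuantizer_S]

theorem map_floor_withDensity_gridMass [IsFiniteMeasure μ] (hm : 0 < m) :
    (volume.withDensity fun x => ENNReal.ofReal (m * gridMass μ m ⌊(m : ℝ) * x⌋)).map
      (fun x => ⌊(m : ℝ) * x⌋) = μ.map fun x => ⌊(m : ℝ) * x⌋ := by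
  have hfl := measurable_floor_mul m
  ext s hs
  have h := lintegral_gridMass_mul (μ := μ) hm (s.indicator 1)
  have e : ∀ x : ℝ, s.indicator (1 : ℤ → ℝ≥0∞) ⌊(m : ℝ) * x⌋
      = ((fun x : ℝ => ⌊(m : ℝ) * x⌋) ⁻¹' s).indicator 1 x := fun x => rfl
  rw [Measure.map_apply hfl hs, Measure.map_apply hfl hs, withDensity_apply _ (hfl hs)]
  simp only [e] at h
  rw [lintegral_indicator_one (hfl hs)] at h
  rw [← h, ← lintegral_indicator (hfl hs)]
  refine lintegral_congr fun x => ?_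
  by_cases hx : x ∈ (fun x : ℝ => ⌊(m : ℝ) * x⌋) ⁻¹' s <;> simp [hx]

theorem measurable_gridMass_floor : Measurable fun x : ℝ => gridMass μ m ⌊(m : ℝ) * x⌋ :=
  (Measurable.of_discrete (f := gridMass μ m)).comp (measurable_floor_mul m)

end Grid

theorem setIntegral_density_eq {μ : Measure ℝ} {f : ℝ → ℝ} (hfm : Measurable f) (hf0 : ∀ x, 0 ≤ f x)
    (hμf : μ = volume.withDensity fun x => ENNReal.ofReal (f x)) {s : Set ℝ}
    (hs : MeasurableSet s) : ∫ x in s, f x = μ.real s := by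
  rw [integral_eq_lintegral_of_nonneg_ae (Eventually.of_forall hf0) hfm.aestronglyMeasurable,
    measureReal_def, hμf, withDensity_apply _ hs]

/-- The relative entropy of two probability densities as the integral of a nonnegative function. -/
theorem lintegral_mul_klFun {g w : ℝ → ℝ} (hg : Measurable g) (hg0 : ∀ x, 0 ≤ g x)
    (hw : Measurable w) (hw0 : ∀ x, 0 ≤ w x) (hgw : ∀ᵐ x, w x = 0 → g x = 0)
    (hg1 : ∫⁻ x, ENNReal.ofReal (g x) = 1) (hw1 : ∫⁻ x, ENNReal.ofReal (w x) = 1)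
    {ν : Measure ℝ} (hν : ν = volume.withDensity fun x => ENNReal.ofReal (g x))
    (hlogg : Integrable (fun x => Real.log (g x)) ν)
    (hlogw : Integrable (fun x => Real.log (w x)) ν) :
    0 ≤ ∫ x, Real.log (g x) ∂ν - ∫ x, Real.log (w x) ∂ν ∧
    ∫⁻ x, ENNReal.ofReal (w x * InformationTheory.klFun (g x / w x))
      = ENNReal.ofReal (∫ x, Real.log (g x) ∂ν - ∫ x, Real.log (w x) ∂ν) := by
  have hint : ∀ {h : ℝ → ℝ}, Measurable h → (∀ x, 0 ≤ h x) →
      ∫⁻ x, ENNReal.ofReal (h x) = 1 → Integrable h ∧ ∫ x, h x = 1 := fun hm h0 h1 =>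
    ⟨⟨hm.aestronglyMeasurable, by
      rw [hasFiniteIntegral_iff_ofReal (Eventually.of_forall h0), h1]; exact ENNReal.one_lt_top⟩,
      by rw [integral_eq_lintegral_of_nonneg_ae (Eventually.of_forall h0)
        hm.aestronglyMeasurable, h1, ENNReal.toReal_one]⟩
  obtain ⟨hgi, hgI⟩ := hint hg hg0 hg1
  obtain ⟨hwi, hwI⟩ := hint hw hw0 hw1
  have hd : Integrable (fun x => Real.log (g x) - Real.log (w x)) ν := hlogg.sub hlogw
  have hdν := integral_sub hlogg hlogw
  rw [hν, integrable_withDensity_iff_integrable_smul' hg.ennreal_ofReal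
    (Eventually.of_forall fun _ => ENNReal.ofReal_lt_top)] at hd
  rw [← hdν, hν, integral_withDensity_eq_integral_toReal_smul hg.ennreal_ofReal
    (Eventually.of_forall fun _ => ENNReal.ofReal_lt_top)]
  simp only [smul_eq_mul, ENNReal.toReal_ofReal (hg0 _)] at hd ⊢
  have hae : (fun x => g x * (Real.log (g x) - Real.log (w x)) + w x - g x)
      =ᵐ[volume] fun x => w x * InformationTheory.klFun (g x / w x) := by
    filter_upwards [hgw] with x hx
    rcases eq_or_ne (w x) 0 with h | h
    · simp [h, hx h]
    rcases eq_or_ne (g x) 0 with h' | h'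
    · simp [h', InformationTheory.klFun_zero]
    rw [InformationTheory.klFun_apply, Real.log_div h' h]
    field_simp
  have hnn : ∀ x, 0 ≤ w x * InformationTheory.klFun (g x / w x) := fun x =>
    mul_nonneg (hw0 x) (InformationTheory.klFun_nonneg (div_nonneg (hg0 x) (hw0 x)))
  have hI1 : Integrable (fun x => g x * (Real.log (g x) - Real.log (w x)) + w x) := hd.add hwi
  have hI := (integrable_congr hae).1 (hI1.sub hgi)
  have hval : ∫ x, w x * InformationTheory.klFun (g x / w x)
      = ∫ x, g x * (Real.log (g x) - Real.log (w x)) := by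
    rw [← integral_congr_ae hae, integral_sub hI1 hgi, integral_add hd hwi, hgI, hwI]
    ring
  rw [← hval]
  exact ⟨integral_nonneg hnn,
    (ofReal_integral_eq_lintegral_ofReal hI (Eventually.of_forall hnn)).symm⟩

section GridLimit

variable {μ : Measure ℝ} [IsProbabilityMeasure μ] {f : ℝ → ℝ}

theorem lintegral_density_eq_one
    (hμf : μ = volume.withDensity fun x => ENNReal.ofReal (f x)) :
    ∫⁻ x, ENNReal.ofReal (f x) = 1 := by
  rw [← setLIntegral_univ, ← withDensity_apply _ MeasurableSet.univ, ← hμf, measure_univ]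

theorem integrable_density (hfm : Measurable f) (hf0 : ∀ x, 0 ≤ f x)
    (hμf : μ = volume.withDensity fun x => ENNReal.ofReal (f x)) : Integrable f := by
  refine ⟨hfm.aestronglyMeasurable, ?_⟩
  rw [hasFiniteIntegral_iff_ofReal (Eventually.of_forall hf0), lintegral_density_eq_one hμf]
  exact ENNReal.one_lt_top

theorem ae_tendsto_gridMass (hfm : Measurable f) (hf0 : ∀ x, 0 ≤ f x)
    (hμf : μ = volume.withDensity fun x => ENNReal.ofReal (f x)) :
    ∀ᵐ x : ℝ, Tendsto (fun m : ℕ => m * gridMass μ m ⌊(m : ℝ) * x⌋) atTop (𝓝 (f x)) := by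
  have hloc := (integrable_density hfm hf0 hμf).locallyIntegrable
  filter_upwards [IsUnifLocDoublingMeasure.ae_tendsto_average volume hloc 1] with x hx
  have hδ : Tendsto (fun m : ℕ => 1 / (m : ℝ) / 2) atTop (𝓝[>] 0) := by
    refine tendsto_nhdsWithin_iff.2 ⟨?_, ?_⟩
    · simpa using tendsto_one_div_atTop_nhds_zero_nat.div_const (2 : ℝ)
    · filter_upwards [eventually_gt_atTop 0] with m hm
      have : (0 : ℝ) < m := Nat.cast_pos.2 hm
      exact mem_Ioi.2 (by positivity)
  have hμv : μ ≪ volume := hμf ▸ withDensity_absolutelyContinuous _ _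
  have key := hx (fun m : ℕ => ⌊(m : ℝ) * x⌋ * (1 / m : ℝ) + (1 / m : ℝ) / 2) _ hδ ?_
  · refine key.congr' ?_
    filter_upwards [eventually_gt_atTop 0] with m hm
    have hm' : (0 : ℝ) < m := Nat.cast_pos.2 hm
    rw [setAverage_eq, setIntegral_density_eq hfm hf0 hμf measurableSet_closedBall,
      Real.closedBall_eq_Icc, gridMass, setOf_floor_mul_eq hm, measureReal_def, Real.volume_Icc,
      smul_eq_mul, ENNReal.toReal_ofReal (by ring_nf; positivity)]
    congr 1
    · field_simp; ring
    · refine (measureReal_congr (hμv.ae_eq ?_)).symm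
      have e1 : (⌊(m : ℝ) * x⌋ : ℝ) * (1 / m : ℝ) + (1 / m : ℝ) / 2 - (1 / m : ℝ) / 2
        = ⌊(m : ℝ) * x⌋ * (1 / m : ℝ) := by ring
      have e2 : (⌊(m : ℝ) * x⌋ : ℝ) * (1 / m : ℝ) + (1 / m : ℝ) / 2 + (1 / m : ℝ) / 2
        = (⌊(m : ℝ) * x⌋ + 1) * (1 / m : ℝ) := by ring
      rw [e1, e2]
      exact Ico_ae_eq_Icc
  · filter_upwards [eventually_gt_atTop 0] with m hm
    have hxm : x ∈ {y : ℝ | ⌊(m : ℝ) * y⌋ = ⌊(m : ℝ) * x⌋} := rfl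
    rw [setOf_floor_mul_eq hm] at hxm
    rw [Real.closedBall_eq_Icc]
    exact ⟨by linarith [hxm.1], by linarith [hxm.2]⟩

theorem integral_log_gridMass {m : ℕ} (hm : 0 < m)
    (hfloor : Summable fun k : ℤ => Real.negMulLog (μ {x | ⌊x⌋ = k}).toReal) :
    Integrable (fun x => Real.log (m * gridMass μ m ⌊(m : ℝ) * x⌋)) μ ∧
    ∫ x, Real.log (m * gridMass μ m ⌊(m : ℝ) * x⌋) ∂μ
      = Real.log m + ∫ x, Real.log (gridMass μ m ⌊(m : ℝ) * x⌋) ∂μ := by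
  have hm' : (m : ℝ) ≠ 0 := Nat.cast_ne_zero.2 hm.ne'
  have hi := integrable_log_gridMass hfloor hm
  have hae : (fun x => Real.log m + Real.log (gridMass μ m ⌊(m : ℝ) * x⌋))
      =ᵐ[μ] fun x => Real.log (m * gridMass μ m ⌊(m : ℝ) * x⌋) := by
    filter_upwards [ae_gridMass_pos hm] with x hx
    rw [Real.log_mul hm' hx.ne']
  refine ⟨(integrable_congr hae).1 ((integrable_const _).add hi), ?_⟩
  rw [← integral_congr_ae hae, integral_add (integrable_const _) hi]
  simp

/-- The entropy of the grid discretization exceeds `log m` by at most the differential entropy,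
in the limit. -/
theorem eventually_neg_integral_log_gridMass_le (hfm : Measurable f) (hf0 : ∀ x, 0 ≤ f x)
    (hμf : μ = volume.withDensity fun x => ENNReal.ofReal (f x))
    (hlogf : Integrable (fun x => Real.log (f x)) μ)
    (hfloor : Summable fun k : ℤ => Real.negMulLog (μ {x | ⌊x⌋ = k}).toReal)
    {τ : ℝ} (hτ : 0 < τ) :
    ∀ᶠ m : ℕ in atTop, -∫ x, Real.log (gridMass μ m ⌊(m : ℝ) * x⌋) ∂μ - Real.log m
      ≤ -∫ x, Real.log (f x) ∂μ + τ := by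
  set w : ℝ → ℝ := fun x => gridMass μ 1 ⌊((1 : ℕ) : ℝ) * x⌋ with hw_def
  have hw : Measurable w := measurable_gridMass_floor
  have hw0 : ∀ x, 0 ≤ w x := fun x => gridMass_nonneg _
  have hw1 : ∫⁻ x, ENNReal.ofReal (w x) = 1 := by
    simpa [hw_def] using lintegral_gridMass (μ := μ) one_pos
  have hlogw : Integrable (fun x => Real.log (w x)) μ := integrable_log_gridMass hfloor one_pos
  set u : ℕ → ℝ → ℝ := fun m x => m * gridMass μ m ⌊(m : ℝ) * x⌋ with hu_def
  have hu : ∀ m, Measurable (u m) := fun m => measurable_gridMass_floor.const_mul _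
  have hu0 : ∀ m x, 0 ≤ u m x := fun m x => mul_nonneg (Nat.cast_nonneg m) (gridMass_nonneg _)
  have hwf : ∀ᵐ x, w x = 0 → f x = 0 := by
    have h := ae_gridMass_pos (μ := μ) one_pos
    rw [hμf, ae_withDensity_iff hfm.ennreal_ofReal, ← hμf] at h
    filter_upwards [h] with x hx hwx
    by_contra hne
    exact (hx (ENNReal.ofReal_pos.2 ((hf0 x).lt_of_ne' hne)).ne').ne' hwx
  obtain ⟨-, hA⟩ := lintegral_mul_klFun hfm hf0 hw hw0 hwf (lintegral_density_eq_one hμf) hw1 hμf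
    hlogf hlogw
  have hAm : ∀ m : ℕ, 0 < m →
      0 ≤ ∫ x, Real.log (u m x) ∂μ - ∫ x, Real.log (w x) ∂μ ∧
      ∫⁻ x, ENNReal.ofReal (w x * InformationTheory.klFun (u m x / w x))
        = ENNReal.ofReal (∫ x, Real.log (u m x) ∂μ - ∫ x, Real.log (w x) ∂μ) := by
    intro m hm
    have hmap := map_floor_withDensity_gridMass (μ := μ) hm
    set ν := volume.withDensity fun x => ENNReal.ofReal (u m x) with hν
    have hfl := measurable_floor_mul m
    have htrans : ∀ {h : ℤ → ℝ}, Integrable (fun x : ℝ => h ⌊(m : ℝ) * x⌋) μ →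
        Integrable (fun x : ℝ => h ⌊(m : ℝ) * x⌋) ν ∧
        ∫ x, h ⌊(m : ℝ) * x⌋ ∂ν = ∫ x, h ⌊(m : ℝ) * x⌋ ∂μ := by
      intro h hi
      have hh : Measurable h := .of_discrete
      have e1 := integrable_map_measure (μ := μ) hh.aestronglyMeasurable hfl.aemeasurable
      have e2 := integrable_map_measure (μ := ν) hh.aestronglyMeasurable hfl.aemeasurable
      refine ⟨e2.1 (hmap ▸ e1.2 hi), ?_⟩
      rw [← integral_map hfl.aemeasurable hh.aestronglyMeasurable,
        ← integral_map hfl.aemeasurable hh.aestronglyMeasurable, hmap]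
    have hwm : ∀ x, w x = gridMass μ 1 (⌊(m : ℝ) * x⌋ / m) := fun x => by
      rw [floor_mul_ediv hm]
    obtain ⟨t1, t1'⟩ := htrans (h := fun j => Real.log (m * gridMass μ m j))
      (integral_log_gridMass hm hfloor).1
    obtain ⟨t2, t2'⟩ := htrans (h := fun j => Real.log (gridMass μ 1 (j / m)))
      (by simpa only [hwm] using hlogw)
    have h := lintegral_mul_klFun (hu m) (hu0 m) hw hw0 (Eventually.of_forall fun x hx => ?_)
      (lintegral_gridMass hm) hw1 hν t1 (by simpa only [hwm] using t2)
    · simp only [hwm] at h ⊢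
      rwa [t2', t1'] at h
    · have h1 := gridMass_le_ediv (μ := μ) hm ⌊(m : ℝ) * x⌋
      rw [← hwm, hx] at h1
      simp only [hu_def, le_antisymm h1 (gridMass_nonneg _), mul_zero]
  have hfatou : ∫⁻ x, ENNReal.ofReal (w x * InformationTheory.klFun (f x / w x))
      ≤ liminf (fun m => ∫⁻ x, ENNReal.ofReal (w x * InformationTheory.klFun (u m x / w x)))
        atTop := by
    refine le_trans (lintegral_mono_ae ?_) (lintegral_liminf_le fun m =>
      (hw.mul (InformationTheory.measurable_klFun.comp ((hu m).div hw))).ennreal_ofReal)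
    filter_upwards [ae_tendsto_gridMass hfm hf0 hμf] with x hx
    refine (Tendsto.liminf_eq (ENNReal.tendsto_ofReal (Tendsto.const_mul _ ?_))).ge
    exact (InformationTheory.continuous_klFun.tendsto _).comp (hx.div_const _)
  rw [hA] at hfatou
  set A := ∫ x, Real.log (f x) ∂μ - ∫ x, Real.log (w x) ∂μ with hAdef
  have hconcl : ∀ᶠ m : ℕ in atTop,
      A - τ ≤ ∫ x, Real.log (u m x) ∂μ - ∫ x, Real.log (w x) ∂μ := by
    rcases le_or_gt A 0 with hA0 | hA0
    · filter_upwards [eventually_gt_atTop 0] with m hm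
      linarith [(hAm m hm).1]
    · have hlt : ENNReal.ofReal (A - τ) < ENNReal.ofReal A :=
        (ENNReal.ofReal_lt_ofReal_iff hA0).2 (by linarith)
      filter_upwards [eventually_gt_atTop 0,
        eventually_lt_of_lt_liminf (hlt.trans_le hfatou)] with m hm h
      rw [(hAm m hm).2] at h
      exact ((ENNReal.ofReal_le_ofReal_iff (hAm m hm).1).1 h.le)
  filter_upwards [eventually_gt_atTop 0, hconcl] with m hm h
  have := (integral_log_gridMass (μ := μ) hm hfloor).2
  simp only [hu_def, this] at h
  linarith

end GridLimit

section GridDistortion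

variable {μ : Measure ℝ} [IsProbabilityMeasure μ] {f : ℝ → ℝ} {r : ℝ}

/-- The midpoint of the grid cell of mesh `1 / m` containing a point. -/
def gridMid (m : ℕ) (x : ℝ) : ℝ := ⌊(m : ℝ) * x⌋ * (1 / m : ℝ) + (1 / m : ℝ) / 2

theorem measurable_gridMid (m : ℕ) : Measurable (gridMid m) :=
  (Measurable.of_discrete (f := fun j : ℤ => j * (1 / m : ℝ) + (1 / m : ℝ) / 2)).comp
    (measurable_floor_mul m)

theorem abs_sub_gridMid_le {m : ℕ} (hm : 0 < m) (x : ℝ) : |x - gridMid m x| ≤ 1 / m / 2 := by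
  have hxm : x ∈ {y : ℝ | ⌊(m : ℝ) * y⌋ = ⌊(m : ℝ) * x⌋} := rfl
  rw [setOf_floor_mul_eq hm] at hxm
  rw [gridMid, abs_le]
  constructor <;> linarith [hxm.1, hxm.2]

theorem distortion_uniformQuantizer {μ : Measure ℝ} {m : ℕ} (hm : 0 < m) :
    (uniformQuantizer m hm).distortion μ (fun x => |x|) r
      = ∫⁻ x, ENNReal.ofReal (|x - gridMid m x| ^ r) ∂μ := by
  rw [Quantizer.distortion_eq_lintegral]
  simp only [uniformQuantizer_idx, gridMid]
  rfl

theorem distortion_uniformQuantizer_le (hr : 0 < r) {m : ℕ} (hm : 0 < m) :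
    (uniformQuantizer m hm).distortion μ (fun x => |x|) r
      ≤ ENNReal.ofReal ((1 / m / 2) ^ r) := by
  rw [distortion_uniformQuantizer]
  calc _ ≤ ∫⁻ _, ENNReal.ofReal ((1 / m / 2) ^ r) ∂μ := lintegral_mono fun x =>
        ENNReal.ofReal_le_ofReal
          (Real.rpow_le_rpow (abs_nonneg _) (abs_sub_gridMid_le hm x) hr.le)
    _ = _ := by simp

theorem distortion_uniformQuantizer_ne_zero (hμv : μ ≪ volume) (hr : 0 < r) {m : ℕ} (hm : 0 < m) :
    (uniformQuantizer m hm).distortion μ (fun x => |x|) r ≠ 0 := by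
  have hmid := measurable_gridMid m
  intro h
  rw [distortion_uniformQuantizer, lintegral_eq_zero_iff (by fun_prop)] at h
  have hcount : (range fun j : ℤ => j * (1 / m : ℝ) + (1 / m : ℝ) / 2).Countable :=
    countable_range _
  have hnull : ∀ᵐ x ∂μ, x ∉ range fun j : ℤ => j * (1 / m : ℝ) + (1 / m : ℝ) / 2 :=
    measure_eq_zero_iff_ae_notMem.1 (hμv (hcount.measure_zero _))
  have : ∀ᵐ _ ∂μ, False := by
    filter_upwards [h, hnull] with x hx hx'
    have h0 : |x - gridMid m x| ^ r ≤ 0 := ENNReal.ofReal_eq_zero.1 hx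
    have h1 : |x - gridMid m x| = 0 :=
      (Real.rpow_eq_zero (abs_nonneg _) hr.ne').1 (le_antisymm h0 (by positivity))
    exact hx' ⟨⌊(m : ℝ) * x⌋, (sub_eq_zero.1 (abs_eq_zero.1 h1)).symm⟩
  exact (NeZero.ne μ) (by simpa using this)

theorem lintegral_gridMass_mul_distortion (hr : 0 < r) {m : ℕ} (hm : 0 < m) :
    ∫⁻ x, ENNReal.ofReal (m * gridMass μ m ⌊(m : ℝ) * x⌋) *
        ENNReal.ofReal (|x - gridMid m x| ^ r)
      = ENNReal.ofReal (1 / (2 ^ r * (r + 1)) / m ^ r) := by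
  have hm' : (0 : ℝ) < m := Nat.cast_pos.2 hm
  set q := uniformQuantizer m hm
  have hcell : ∀ i : ℤ, ∫⁻ x in q.S i, ENNReal.ofReal (|x - q.c i| ^ r)
      = ENNReal.ofReal (1 / (2 ^ r * (r + 1)) / m ^ r * (1 / m)) := by
    intro i
    have hSi : q.S i =ᵐ[volume] Icc (q.c i - 1 / m / 2 : ℝ) (q.c i + 1 / m / 2) := by
      have e : q.S i = Ico (q.c i - 1 / m / 2 : ℝ) (q.c i + 1 / m / 2) := by
        change Ico _ _ = _
        congr 1
        · change _ = (i : ℝ) * (1 / m) + 1 / m / 2 - _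
          ring
        · change _ = (i : ℝ) * (1 / m) + 1 / m / 2 + _
          ring
      rw [e]
      exact Ico_ae_eq_Icc
    rw [setLIntegral_congr hSi, ← ofReal_integral_eq_lintegral_ofReal,
      integral_rpow_abs_symm hr (by positivity), Real.rpow_add_one (by positivity),
      Real.div_rpow (by positivity) (by positivity), Real.div_rpow zero_le_one hm'.le,
      Real.one_rpow]
    · congr 1
      field_simp
    · exact ContinuousOn.integrableOn_Icc
        (((continuous_abs.comp (continuous_sub_right _)).rpow_const
          fun _ => Or.inr hr.le).continuousOn)
    · exact Eventually.of_forall fun x => by positivity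
  have hI : ∀ x, ENNReal.ofReal (m * gridMass μ m ⌊(m : ℝ) * x⌋) *
        ENNReal.ofReal (|x - gridMid m x| ^ r)
      = ENNReal.ofReal (m * gridMass μ m (q.idx x)) * ENNReal.ofReal (|x - q.c (q.idx x)| ^ r) := by
    intro x
    rw [uniformQuantizer_idx]; rfl
  simp only [hI]
  rw [← q.tsum_setLIntegral_s16]
  calc _ = ∑' i, μ (q.S i) * ENNReal.ofReal (1 / (2 ^ r * (r + 1)) / m ^ r) := by
        refine tsum_congr fun i => ?_
        rw [q.setLIntegral_idx volume i fun i x => ENNReal.ofReal (m * gridMass μ m i) *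
            ENNReal.ofReal (|x - q.c i| ^ r), lintegral_const_mul _ (by fun_prop), hcell,
          ← ENNReal.ofReal_mul (mul_nonneg hm'.le (gridMass_nonneg i)), ← ofReal_measureReal,
          ← ENNReal.ofReal_mul measureReal_nonneg, uniformQuantizer_S]
        congr 1
        rw [gridMass]
        field_simp
    _ = _ := by rw [ENNReal.tsum_mul_right, q.tsum_measure_eq, measure_univ, one_mul]

theorem eventually_distortion_uniformQuantizer_le (hr : 0 < r) (hfm : Measurable f)
    (hf0 : ∀ x, 0 ≤ f x) (hμf : μ = volume.withDensity fun x => ENNReal.ofReal (f x))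
    {κ : ℝ} (hκ : 1 / (2 ^ r * (r + 1)) < κ) :
    ∀ᶠ m : ℕ in atTop, ∀ hm : 0 < m, (uniformQuantizer m hm).distortion μ (fun x => |x|) r
      ≤ ENNReal.ofReal (κ / m ^ r) := by
  have hu : ∀ m : ℕ, Measurable fun x : ℝ => m * gridMass μ m ⌊(m : ℝ) * x⌋ :=
    fun m => measurable_gridMass_floor.const_mul _
  have hlim : Tendsto (fun m : ℕ => ∫⁻ x, ENNReal.ofReal
      (f x - m * gridMass μ m ⌊(m : ℝ) * x⌋)) atTop (𝓝 0) := by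
    have := tendsto_lintegral_of_dominated_convergence (μ := volume)
      (F := fun (m : ℕ) x => ENNReal.ofReal (f x - m * gridMass μ m ⌊(m : ℝ) * x⌋))
      (f := fun _ => 0) (fun x => ENNReal.ofReal (f x))
      (fun m => (hfm.sub (hu m)).ennreal_ofReal)
      (fun m => Eventually.of_forall fun x => ENNReal.ofReal_le_ofReal
        (sub_le_self _ (mul_nonneg m.cast_nonneg (gridMass_nonneg _))))
      (by rw [lintegral_density_eq_one hμf]; exact ENNReal.one_ne_top)
      (by
        filter_upwards [ae_tendsto_gridMass hfm hf0 hμf] with x hx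
        simpa using ENNReal.tendsto_ofReal (hx.const_sub (f x)))
    simpa using this
  set c := 1 / (2 ^ r * (r + 1)) with hc
  have hc0 : 0 ≤ c := by positivity
  have hgap : 0 < κ - c := by linarith
  filter_upwards [(ENNReal.tendsto_nhds_zero.1 hlim) (ENNReal.ofReal (κ - c))
    (ENNReal.ofReal_pos.2 hgap)] with m hm hm0
  have hm' : (0 : ℝ) < m := Nat.cast_pos.2 hm0
  have hmid := measurable_gridMid m
  have hum := hu m
  rw [distortion_uniformQuantizer, lintegral_density hfm hμf (by fun_prop)]
  calc ∫⁻ x, ENNReal.ofReal (f x) * ENNReal.ofReal (|x - gridMid m x| ^ r)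
      ≤ ∫⁻ x, (ENNReal.ofReal (m * gridMass μ m ⌊(m : ℝ) * x⌋) *
          ENNReal.ofReal (|x - gridMid m x| ^ r)
          + ENNReal.ofReal (f x - m * gridMass μ m ⌊(m : ℝ) * x⌋) *
            ENNReal.ofReal (1 / m ^ r)) := by
        refine lintegral_mono fun x => ?_
        have h1 : |x - gridMid m x| ^ r ≤ 1 / m ^ r := by
          rw [← Real.one_rpow r, ← Real.div_rpow zero_le_one hm'.le]
          refine Real.rpow_le_rpow (abs_nonneg _) ((abs_sub_gridMid_le hm0 x).trans ?_) hr.le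
          linarith [show (0 : ℝ) < 1 / m by positivity]
        calc _ ≤ (ENNReal.ofReal (m * gridMass μ m ⌊(m : ℝ) * x⌋)
              + ENNReal.ofReal (f x - m * gridMass μ m ⌊(m : ℝ) * x⌋)) *
                ENNReal.ofReal (|x - gridMid m x| ^ r) := by
              gcongr
              refine le_trans (ENNReal.ofReal_le_ofReal (by linarith)) ENNReal.ofReal_add_le
          _ ≤ _ := by
              rw [add_mul]
              gcongr
    _ = ENNReal.ofReal (c / m ^ r) + (∫⁻ x, ENNReal.ofReal
          (f x - m * gridMass μ m ⌊(m : ℝ) * x⌋)) * ENNReal.ofReal (1 / m ^ r) := by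
        rw [lintegral_add_left (by fun_prop), lintegral_gridMass_mul_distortion hr hm0,
          lintegral_mul_const _ (by fun_prop)]
    _ ≤ ENNReal.ofReal (c / m ^ r) + ENNReal.ofReal (κ - c) * ENNReal.ofReal (1 / m ^ r) := by
        gcongr
    _ = ENNReal.ofReal (κ / m ^ r) := by
        rw [← ENNReal.ofReal_mul hgap.le, ← ENNReal.ofReal_add (by positivity) (by positivity)]
        congr 1
        ring

/-- Uniform quantizers asymptotically achieve the lower bound on the entropy. -/
theorem exists_uniformQuantizer_entropy_le (hr : 0 < r) (hfm : Measurable f)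
    (hf0 : ∀ x, 0 ≤ f x) (hμf : μ = volume.withDensity fun x => ENNReal.ofReal (f x))
    (hlogf : Integrable (fun x => Real.log (f x)) μ)
    (hfloor : Summable fun k : ℤ => Real.negMulLog (μ {x | ⌊x⌋ = k}).toReal) :
    ∃ (n : ℝ → ℕ) (hn : ∀ D, 0 < n D),
      (∀ D, 0 < D →
        (uniformQuantizer (n D) (hn D)).distortion μ (fun x => |x|) r ≤ ENNReal.ofReal D) ∧
      ∀ τ, 0 < τ → ∀ᶠ D in 𝓝[>] (0 : ℝ),
        ((uniformQuantizer (n D) (hn D)).entropy μ).toReal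
          ≤ -∫ x, Real.log (f x) ∂μ - 1 / r * Real.log (2 ^ r * (r + 1) * D) + τ := by
  classical
  have hμv : μ ≪ volume := hμf ▸ withDensity_absolutelyContinuous _ _
  let P : ℝ → ℕ → Prop := fun D m => ∃ hm : 0 < m,
    (uniformQuantizer m hm).distortion μ (fun x => |x|) r ≤ ENNReal.ofReal D
  have hex : ∀ D, 0 < D → ∃ m, P D m := by
    intro D hD
    have h1 : Tendsto (fun m : ℕ => (1 / (m : ℝ) / 2) ^ r) atTop (𝓝 0) := by
      have h := (tendsto_one_div_atTop_nhds_zero_nat (𝕜 := ℝ)).div_const 2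
      have h2 := h.rpow_const (Or.inr hr.le) (p := r)
      simpa [Real.zero_rpow hr.ne'] using h2
    obtain ⟨m, hm, hm0⟩ :=
      ((h1.eventually_lt_const hD).and (eventually_gt_atTop 0)).exists
    exact ⟨m, hm0, (distortion_uniformQuantizer_le hr hm0).trans
      (ENNReal.ofReal_le_ofReal hm.le)⟩
  let n : ℝ → ℕ := fun D => if h : 0 < D then Nat.find (hex D h) else 1
  have hnP : ∀ D, 0 < D → P D (n D) := fun D hD => by
    simp only [n, dif_pos hD]
    exact Nat.find_spec (hex D hD)
  have hn : ∀ D, 0 < n D := fun D => by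
    by_cases hD : 0 < D
    · exact (hnP D hD).1
    · simp [n, hD]
  have hmin : ∀ D, 0 < D → ∀ m, m < n D → ¬P D m := fun D hD m hm => by
    simp only [n, dif_pos hD] at hm
    exact Nat.find_min (hex D hD) hm
  have hnlim : Tendsto n (𝓝[>] 0) atTop := by
    refine tendsto_atTop.2 fun M => ?_
    have h0 : Tendsto ENNReal.ofReal (𝓝[>] 0) (𝓝 0) := by
      simpa using (ENNReal.continuous_ofReal.tendsto 0).mono_left nhdsWithin_le_nhds
    have hall : ∀ m ∈ Finset.range M, ∀ᶠ D in 𝓝[>] (0 : ℝ), ¬P D m := by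
      intro m _
      by_cases hm : 0 < m
      · filter_upwards [h0.eventually_lt_const
          (pos_iff_ne_zero.2 (distortion_uniformQuantizer_ne_zero (r := r) hμv hr hm))] with D hD
        exact fun ⟨_, h⟩ => absurd hD h.not_gt
      · exact Eventually.of_forall fun D h => hm h.1
    filter_upwards [(Filter.eventually_all_finset _).2 hall, self_mem_nhdsWithin] with D hD hD0
    by_contra! hlt
    exact hD (n D) (Finset.mem_range.2 hlt) (hnP D hD0)
  refine ⟨n, hn, fun D hD => (hnP D hD).2, fun τ hτ => ?_⟩
  set c := 1 / (2 ^ r * (r + 1)) with hc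
  have hc0 : 0 < c := by positivity
  set κ := c * Real.exp (r * (τ / 3)) with hκ
  have hcκ : c < κ := by
    rw [hκ]
    exact lt_mul_of_one_lt_right hc0 (Real.one_lt_exp_iff.2 (by positivity))
  have hpred : Tendsto (fun D => n D - 1) (𝓝[>] 0) atTop :=
    (tendsto_sub_atTop_nat 1).comp hnlim
  have hratio : Tendsto (fun m : ℕ => Real.log ((m + 1 : ℝ) / m)) atTop (𝓝 0) := by
    have h1 : Tendsto (fun m : ℕ => (m + 1 : ℝ) / m) atTop (𝓝 1) := by
      have h := (tendsto_one_div_atTop_nhds_zero_nat (𝕜 := ℝ)).const_add 1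
      rw [add_zero] at h
      refine h.congr' ?_
      filter_upwards [eventually_gt_atTop 0] with m hm
      have hm' : (m : ℝ) ≠ 0 := Nat.cast_ne_zero.2 hm.ne'
      field_simp
    simpa using h1.log one_ne_zero
  filter_upwards [self_mem_nhdsWithin, hnlim.eventually_ge_atTop 2,
    hnlim.eventually (eventually_neg_integral_log_gridMass_le hfm hf0 hμf hlogf hfloor
      (show 0 < τ / 3 by positivity)),
    hpred.eventually (eventually_distortion_uniformQuantizer_le hr hfm hf0 hμf hcκ),
    hpred.eventually (hratio.eventually_le_const (show 0 < τ / 3 by positivity))]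
    with D hD hn2 hent hdist hrat
  have hD : 0 < D := hD
  have hpos : 0 < n D - 1 := by omega
  have hnot := hmin D hD (n D - 1) (by omega)
  have hlt : ENNReal.ofReal D < ENNReal.ofReal (κ / ((n D - 1 : ℕ) : ℝ) ^ r) := by
    refine lt_of_lt_of_le ?_ (hdist hpos)
    by_contra! hle
    exact hnot ⟨hpos, hle⟩
  have hp : (0 : ℝ) < (n D - 1 : ℕ) := Nat.cast_pos.2 hpos
  have hκ0 : 0 < κ := hc0.trans hcκ
  have hlt' := (ENNReal.ofReal_lt_ofReal_iff (by positivity)).1 hlt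
  have hlog := Real.log_lt_log hD hlt'
  have hcast : (((n D - 1 : ℕ) : ℝ) + 1) = n D := by exact_mod_cast Nat.sub_add_cancel (hn D)
  rw [hcast, Real.log_div (Nat.cast_ne_zero.2 (hn D).ne') hp.ne'] at hrat
  rw [Real.log_div hκ0.ne' (by positivity), Real.log_rpow hp, hκ,
    Real.log_mul hc0.ne' (Real.exp_ne_zero _), Real.log_exp, hc, one_div, Real.log_inv] at hlog
  rw [entropy_uniformQuantizer_toReal, Real.log_mul (by positivity) hD.ne']
  have h3 : Real.log ((n D - 1 : ℕ) : ℝ)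
      ≤ 1 / r * (-Real.log (2 ^ r * (r + 1)) - Real.log D) + τ / 3 := by
    have : r * Real.log ((n D - 1 : ℕ) : ℝ)
      ≤ r * (1 / r * (-Real.log (2 ^ r * (r + 1)) - Real.log D) + τ / 3) := by
      rw [mul_add, ← mul_assoc, mul_one_div_cancel hr.ne']
      linarith
    exact le_of_mul_le_mul_left this hr
  linarith

end GridDistortion

section AddNoise

open ProbabilityTheory

/-- The additive-noise channel `x ↦ x + Z`, where `Z` has law `γ`. -/
def addNoise (γ : Measure ℝ) [SFinite γ] : Kernel ℝ ℝ :=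
  (Kernel.id ×ₖ Kernel.const ℝ γ).map fun q => q.1 + q.2

/-- The density of `X + Z`, where `X` has law `μ` and `Z` is independent with density `g`. -/
def outputDensity (μ : Measure ℝ) (g : ℝ → ℝ) (y : ℝ) : ℝ :=
  (∫⁻ x, ENNReal.ofReal (g (y - x)) ∂μ).toReal

instance (γ : Measure ℝ) [IsProbabilityMeasure γ] : IsMarkovKernel (addNoise γ) :=
  Kernel.IsMarkovKernel.map _ (by fun_prop)

theorem compProd_addNoise (μ γ : Measure ℝ) [IsProbabilityMeasure μ] [IsProbabilityMeasure γ] :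
    μ.compProd (addNoise γ) = (μ.prod γ).map fun q => (q.1, q.1 + q.2) := by
  refine Measure.ext_of_lintegral _ fun F hF => ?_
  rw [Measure.lintegral_compProd hF, lintegral_map hF (by fun_prop),
    lintegral_prod _ (by fun_prop)]
  refine lintegral_congr fun x => ?_
  have h : addNoise γ x = γ.map fun z => x + z := by
    rw [addNoise, Kernel.map_apply _ (by fun_prop), Kernel.prod_apply, Kernel.id_apply,
      Kernel.const_apply, Measure.dirac_prod, Measure.map_map (by fun_prop) (by fun_prop)]
    rfl
  rw [h, lintegral_map (by fun_prop) (by fun_prop)]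

variable {μ : Measure ℝ} [IsProbabilityMeasure μ] {g : ℝ → ℝ} {B : ℝ}

theorem isProbabilityMeasure_withDensity_ofReal (hg1 : ∫⁻ z, ENNReal.ofReal (g z) = 1) :
    IsProbabilityMeasure (volume.withDensity fun z => ENNReal.ofReal (g z)) :=
  ⟨by rw [withDensity_apply _ MeasurableSet.univ, setLIntegral_univ, hg1]⟩

theorem measurable_outputDensity (hgm : Measurable g) : Measurable (outputDensity μ g) := by
  refine Measurable.ennreal_toReal ?_
  exact Measurable.lintegral_prod_right'
    (f := fun p : ℝ × ℝ => ENNReal.ofReal (g (p.1 - p.2))) (by fun_prop)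

theorem lintegral_shift_le (hgB : ∀ z, g z ≤ B) (y : ℝ) :
    ∫⁻ x, ENNReal.ofReal (g (y - x)) ∂μ ≤ ENNReal.ofReal B :=
  (lintegral_mono fun x => ENNReal.ofReal_le_ofReal (hgB (y - x))).trans (by simp)

theorem outputDensity_le (hB : 0 ≤ B) (hgB : ∀ z, g z ≤ B) (y : ℝ) : outputDensity μ g y ≤ B :=
  ENNReal.toReal_le_of_le_ofReal hB (lintegral_shift_le hgB y)

theorem ofReal_outputDensity (hgB : ∀ z, g z ≤ B) (y : ℝ) :
    ENNReal.ofReal (outputDensity μ g y) = ∫⁻ x, ENNReal.ofReal (g (y - x)) ∂μ :=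
  ENNReal.ofReal_toReal ((lintegral_shift_le hgB y).trans_lt ENNReal.ofReal_lt_top).ne

theorem outputDensity_pos (hgm : Measurable g) (hg0 : ∀ z, 0 < g z) (hgB : ∀ z, g z ≤ B)
    (y : ℝ) : 0 < outputDensity μ g y := by
  rw [← ENNReal.ofReal_pos, ofReal_outputDensity hgB, lintegral_pos_iff_support (by fun_prop)]
  have : (Function.support fun x => ENNReal.ofReal (g (y - x))) = univ := by
    ext x
    simp [hg0]
  simp [this]

theorem lintegral_add_noise (hgm : Measurable g)
    (hgB : ∀ z, g z ≤ B) {F : ℝ → ℝ≥0∞} (hF : Measurable F) :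
    ∫⁻ q, F (q.1 + q.2) ∂(μ.prod (volume.withDensity fun z => ENNReal.ofReal (g z)))
      = ∫⁻ y, F y ∂(volume.withDensity fun y => ENNReal.ofReal (outputDensity μ g y)) := by
  have hp := measurable_outputDensity (μ := μ) hgm
  rw [lintegral_prod _ (by fun_prop),
    lintegral_withDensity_eq_lintegral_mul _ (by fun_prop) hF]
  simp only [Pi.mul_apply, ofReal_outputDensity hgB]
  calc ∫⁻ x, ∫⁻ z, F (x + z) ∂(volume.withDensity fun z => ENNReal.ofReal (g z)) ∂μ
      = ∫⁻ x, (∫⁻ y, ENNReal.ofReal (g (y - x)) * F y) ∂μ := by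
        refine lintegral_congr fun x => ?_
        rw [lintegral_withDensity_eq_lintegral_mul _ (by fun_prop) (by fun_prop),
          ← lintegral_sub_right_eq_self _ x]
        simp
    _ = ∫⁻ y, ∫⁻ x, ENNReal.ofReal (g (y - x)) * F y ∂μ := by
        rw [lintegral_lintegral_swap]
        fun_prop
    _ = _ := by
        refine lintegral_congr fun y => ?_
        rw [lintegral_mul_const _ (by fun_prop)]

theorem mutualInfo_compProd_addNoise (hgm : Measurable g) (hg0 : ∀ z, 0 < g z)
    (hgB : ∀ z, g z ≤ B)
    [IsProbabilityMeasure (volume.withDensity fun z => ENNReal.ofReal (g z))]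
    (hint : Integrable (fun q : ℝ × ℝ => Real.log (g q.2) - Real.log (outputDensity μ g (q.1 + q.2)))
      (μ.prod (volume.withDensity fun z => ENNReal.ofReal (g z)))) :
    mutualInfo (μ.compProd (addNoise (volume.withDensity fun z => ENNReal.ofReal (g z))))
      = ENNReal.ofReal (∫ q, (Real.log (g q.2) - Real.log (outputDensity μ g (q.1 + q.2)))
          ∂(μ.prod (volume.withDensity fun z => ENNReal.ofReal (g z)))) := by
  set γ : Measure ℝ := volume.withDensity fun z => ENNReal.ofReal (g z) with hγ
  set p := outputDensity μ g with hp_def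
  have hp : Measurable p := measurable_outputDensity hgm
  have hp0 : ∀ y, 0 < p y := outputDensity_pos hgm hg0 hgB
  set π := μ.compProd (addNoise γ) with hπ
  have hπmap : π = (μ.prod γ).map fun q => (q.1, q.1 + q.2) := compProd_addNoise μ γ
  have hfst : π.map Prod.fst = μ := Measure.fst_compProd _ _
  have hsnd : π.map Prod.snd = volume.withDensity fun y => ENNReal.ofReal (p y) := by
    refine Measure.ext_of_lintegral _ fun F hF => ?_
    rw [hπmap, Measure.map_map (by fun_prop) (by fun_prop), lintegral_map hF (by fun_prop),
      ← lintegral_add_noise hgm hgB hF]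
    rfl
  set ρ := μ.prod (volume.withDensity fun y => ENNReal.ofReal (p y)) with hρ
  have : IsProbabilityMeasure (volume.withDensity fun y => ENNReal.ofReal (p y)) := by
    rw [← hsnd]
    exact Measure.isProbabilityMeasure_map (by fun_prop)
  have hdens : π = ρ.withDensity fun q => ENNReal.ofReal (g (q.2 - q.1) / p q.2) := by
    refine Measure.ext_of_lintegral _ fun F hF => ?_
    rw [hπmap, lintegral_map hF (by fun_prop), lintegral_prod _ (by fun_prop),
      lintegral_withDensity_eq_lintegral_mul _ (by fun_prop) hF, hρ,
      lintegral_prod _ (by fun_prop)]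
    refine lintegral_congr fun x => ?_
    rw [hγ, lintegral_withDensity_eq_lintegral_mul _ (by fun_prop) (by fun_prop),
      lintegral_withDensity_eq_lintegral_mul _ (by fun_prop) (by fun_prop),
      ← lintegral_sub_right_eq_self _ x]
    refine lintegral_congr fun y => ?_
    simp only [Pi.mul_apply, add_sub_cancel]
    rw [← mul_assoc, ← ENNReal.ofReal_mul (hp0 y).le, mul_div_cancel₀ _ (hp0 y).ne']
  have hlog : (fun q => Real.log (π.rnDeriv ρ q).toReal)
      =ᵐ[π] fun q => Real.log (g (q.2 - q.1)) - Real.log (p q.2) := by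
    have hac : π ≪ ρ := hdens ▸ withDensity_absolutelyContinuous _ _
    have h : π.rnDeriv ρ =ᵐ[ρ] fun q => ENNReal.ofReal (g (q.2 - q.1) / p q.2) := by
      rw [hdens]
      exact Measure.rnDeriv_withDensity _ (by fun_prop)
    filter_upwards [hac.ae_le h] with q hq
    rw [hq, ENNReal.toReal_ofReal (div_pos (hg0 _) (hp0 _)).le,
      Real.log_div (hg0 _).ne' (hp0 _).ne']
  have hmeas : Measurable fun q : ℝ × ℝ => Real.log (g (q.2 - q.1)) - Real.log (p q.2) := by
    fun_prop
  rw [mutualInfo, hfst, hsnd, klDiv, if_pos]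
  · rw [integral_congr_ae hlog, hπmap,
      integral_map (by fun_prop) hmeas.aestronglyMeasurable]
    simp [hγ]
  · refine ⟨hdens ▸ withDensity_absolutelyContinuous _ _, ?_⟩
    refine Integrable.congr ?_ hlog.symm
    rw [hπmap, integrable_map_measure hmeas.aestronglyMeasurable (by fun_prop)]
    simpa [Function.comp_def] using hint

end AddNoise

section TestDensity

/-- An unnormalised Cauchy density. -/
def cauchyBump (t : ℝ) : ℝ := (1 + t ^ 2)⁻¹

theorem cauchyBump_pos (t : ℝ) : 0 < cauchyBump t := by
  unfold cauchyBump; positivity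

theorem cauchyBump_le_one (t : ℝ) : cauchyBump t ≤ 1 :=
  inv_le_one_of_one_le₀ (by nlinarith [sq_nonneg t])

@[fun_prop]
theorem measurable_cauchyBump : Measurable cauchyBump := by
  unfold cauchyBump; fun_prop

theorem lintegral_cauchyBump : ∫⁻ t, ENNReal.ofReal (cauchyBump t) = ENNReal.ofReal Real.pi := by
  rw [← integral_univ_inv_one_add_sq, ofReal_integral_eq_lintegral_ofReal
    integrable_inv_one_add_sq (Eventually.of_forall fun t => (cauchyBump_pos t).le)]
  rfl

variable {μ : Measure ℝ} [IsProbabilityMeasure μ] {m : ℕ} {ε : ℝ}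

theorem lintegral_outputDensity {g : ℝ → ℝ} {B : ℝ} (hgm : Measurable g) (hgB : ∀ z, g z ≤ B) :
    ∫⁻ y, ENNReal.ofReal (outputDensity μ g y) = ∫⁻ z, ENNReal.ofReal (g z) := by
  have h := lintegral_add_noise (μ := μ) hgm hgB (F := 1) measurable_const
  simp only [Pi.one_apply, lintegral_one] at h
  rw [← univ_prod_univ, Measure.prod_prod, measure_univ, one_mul,
    withDensity_apply _ MeasurableSet.univ, withDensity_apply _ MeasurableSet.univ] at h
  simpa using h.symm

/-- The piecewise constant approximation of the density of `μ`, with heavy tails added. -/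
def testDensity (μ : Measure ℝ) (m : ℕ) (ε y : ℝ) : ℝ :=
  m * gridMass μ m ⌊(m : ℝ) * y⌋ + ε * outputDensity μ cauchyBump y

theorem measurable_testDensity : Measurable (testDensity μ m ε) := by
  have h1 : Measurable fun x : ℝ => gridMass μ m ⌊(m : ℝ) * x⌋ := measurable_gridMass_floor
  have h2 := measurable_outputDensity (μ := μ) measurable_cauchyBump
  unfold testDensity
  fun_prop

theorem testDensity_pos (hε : 0 < ε) (y : ℝ) : 0 < testDensity μ m ε y := by
  have h1 := gridMass_nonneg (μ := μ) (m := m) ⌊(m : ℝ) * y⌋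
  have h2 := outputDensity_pos (μ := μ) measurable_cauchyBump cauchyBump_pos cauchyBump_le_one y
  unfold testDensity
  positivity

theorem lintegral_testDensity (hm : 0 < m) (hε : 0 < ε) :
    ∫⁻ y, ENNReal.ofReal (testDensity μ m ε y) = ENNReal.ofReal (1 + ε * Real.pi) := by
  have h1 : Measurable fun x : ℝ => gridMass μ m ⌊(m : ℝ) * x⌋ := measurable_gridMass_floor
  have h2 := measurable_outputDensity (μ := μ) measurable_cauchyBump
  have h3 := outputDensity_pos (μ := μ) measurable_cauchyBump cauchyBump_pos cauchyBump_le_one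
  have h4 := gridMass_nonneg (μ := μ) (m := m)
  calc ∫⁻ y, ENNReal.ofReal (testDensity μ m ε y)
      = ∫⁻ y, (ENNReal.ofReal (m * gridMass μ m ⌊(m : ℝ) * y⌋)
          + ENNReal.ofReal ε * ENNReal.ofReal (outputDensity μ cauchyBump y)) := by
        refine lintegral_congr fun y => ?_
        have := h3 y
        have := h4 ⌊(m : ℝ) * y⌋
        rw [testDensity, ENNReal.ofReal_add (by positivity) (by positivity),
          ENNReal.ofReal_mul hε.le]
    _ = 1 + ENNReal.ofReal ε * ENNReal.ofReal Real.pi := by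
        rw [lintegral_add_left (by fun_prop), lintegral_gridMass hm,
          lintegral_const_mul _ (by fun_prop),
          lintegral_outputDensity measurable_cauchyBump cauchyBump_le_one, lintegral_cauchyBump]
    _ = _ := by
        rw [ENNReal.ofReal_add zero_le_one (by positivity), ENNReal.ofReal_one,
          ENNReal.ofReal_mul hε.le]

theorem log_one_add_le {r t : ℝ} (hr : 0 < r) (ht : 0 ≤ t) :
    Real.log (1 + t) ≤ Real.log 2 + t ^ r / r := by
  rcases le_total t 1 with h | h
  · have h1 : Real.log (1 + t) ≤ Real.log 2 := Real.log_le_log (by positivity) (by linarith)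
    have : 0 ≤ t ^ r / r := by positivity
    linarith
  · have ht0 : 0 < t := by linarith
    have h1 : Real.log (1 + t) ≤ Real.log (2 * t) := Real.log_le_log (by positivity) (by linarith)
    rw [Real.log_mul two_ne_zero ht0.ne'] at h1
    have h2 := Real.log_le_sub_one_of_pos (Real.rpow_pos_of_pos ht0 r)
    rw [Real.log_rpow ht0] at h2
    have : Real.log t ≤ t ^ r / r := by
      rw [le_div_iff₀ hr]; linarith
    linarith

theorem abs_sub_le_one_of_floor_mul_eq (hm : 0 < m) {x y : ℝ}
    (h : ⌊(m : ℝ) * x⌋ = ⌊(m : ℝ) * y⌋) : |x - y| ≤ 1 := by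
  have hm' : (1 : ℝ) ≤ m := Nat.one_le_cast.2 hm
  have h1 := Int.abs_sub_lt_one_of_floor_eq_floor h
  rw [← mul_sub, abs_mul, Nat.abs_cast] at h1
  nlinarith [abs_nonneg (x - y)]

theorem gridMass_mul_le_outputDensity (hm : 0 < m) (x z : ℝ) :
    gridMass μ m ⌊(m : ℝ) * x⌋ * (2 * (1 + |z|) ^ 2)⁻¹ ≤ outputDensity μ cauchyBump (x + z) := by
  have hz : 0 < (2 * (1 + |z|) ^ 2)⁻¹ := by positivity
  rw [← ENNReal.ofReal_le_ofReal_iff (outputDensity_pos measurable_cauchyBump cauchyBump_pos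
    cauchyBump_le_one _).le, ofReal_outputDensity cauchyBump_le_one,
    ENNReal.ofReal_mul (gridMass_nonneg _), gridMass, ofReal_measureReal, mul_comm]
  have hmeas : MeasurableSet {y : ℝ | ⌊(m : ℝ) * y⌋ = ⌊(m : ℝ) * x⌋} :=
    measurable_floor_mul m (measurableSet_singleton _)
  rw [← setLIntegral_const]
  refine (setLIntegral_mono' hmeas fun y hy => ENNReal.ofReal_le_ofReal ?_).trans
    (setLIntegral_le_lintegral _ _)
  have h1 : |x - y| ≤ 1 := abs_sub_le_one_of_floor_mul_eq hm (Eq.symm hy)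
  have h2 : |x + z - y| ≤ 1 + |z| := by
    calc |x + z - y| = |(x - y) + z| := by ring_nf
      _ ≤ |x - y| + |z| := abs_add_le _ _
      _ ≤ _ := by gcongr
  unfold cauchyBump
  refine inv_anti₀ (by positivity) ?_
  have h3 : (x + z - y) ^ 2 ≤ (1 + |z|) ^ 2 := by
    rw [← sq_abs (x + z - y)]; gcongr
  nlinarith [abs_nonneg z]

theorem le_log_testDensity {r : ℝ} (hr : 0 < r) (hm : 0 < m) (hε : 0 < ε) {x : ℝ} (z : ℝ)
    (hx : 0 < gridMass μ m ⌊(m : ℝ) * x⌋) :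
    Real.log (gridMass μ m ⌊(m : ℝ) * x⌋) + Real.log m
        - {q : ℝ × ℝ | ⌊(m : ℝ) * (q.1 + q.2)⌋ ≠ ⌊(m : ℝ) * q.1⌋}.indicator
          (fun _ => Real.log m + |Real.log ε| + 3 * Real.log 2) (x, z)
        - 2 / r * |z| ^ r
      ≤ Real.log (testDensity μ m ε (x + z)) := by
  have hm' : (0 : ℝ) < m := Nat.cast_pos.2 hm
  have hc := outputDensity_pos (μ := μ) measurable_cauchyBump cauchyBump_pos cauchyBump_le_one
    (x + z)
  have hzr : 0 ≤ 2 / r * |z| ^ r := by positivity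
  by_cases h : ⌊(m : ℝ) * (x + z)⌋ = ⌊(m : ℝ) * x⌋
  · rw [indicator_of_notMem (by simpa using h), sub_zero]
    have : Real.log (m * gridMass μ m ⌊(m : ℝ) * x⌋) ≤ Real.log (testDensity μ m ε (x + z)) := by
      refine Real.log_le_log (by positivity) ?_
      rw [testDensity, h]
      have : 0 ≤ ε * outputDensity μ cauchyBump (x + z) := by positivity
      linarith
    rw [Real.log_mul hm'.ne' hx.ne'] at this
    linarith
  · rw [indicator_of_mem (by simpa using h)]
    have h1 : Real.log (ε * (gridMass μ m ⌊(m : ℝ) * x⌋ * (2 * (1 + |z|) ^ 2)⁻¹))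
        ≤ Real.log (testDensity μ m ε (x + z)) := by
      refine Real.log_le_log (by positivity) ?_
      rw [testDensity]
      have h2 : 0 ≤ m * gridMass μ m ⌊(m : ℝ) * (x + z)⌋ :=
        mul_nonneg hm'.le (gridMass_nonneg _)
      have h3 := mul_le_mul_of_nonneg_left (gridMass_mul_le_outputDensity (μ := μ) hm x z) hε.le
      linarith
    rw [Real.log_mul hε.ne' (by positivity), Real.log_mul hx.ne' (by positivity), Real.log_inv,
      Real.log_mul two_ne_zero (by positivity), Real.log_pow] at h1
    have h4 := log_one_add_le hr (abs_nonneg z)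
    have h5 := neg_abs_le (Real.log ε)
    have h6 : 2 / r * |z| ^ r = 2 * (|z| ^ r / r) := by ring
    push_cast at h1
    linarith

end TestDensity

section NoiseChannel

variable {μ : Measure ℝ} [IsProbabilityMeasure μ] {m : ℕ} {ε r D : ℝ}

/-- The exponential power law with `r`-th absolute moment `D`. -/
def expPowNoise (r D : ℝ) : Measure ℝ :=
  volume.withDensity fun z => ENNReal.ofReal (expPowDensity r (1 / (r * D)) z)

theorem isProbabilityMeasure_expPowNoise (hr : 0 < r) (hD : 0 < D) :
    IsProbabilityMeasure (expPowNoise r D) :=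
  isProbabilityMeasure_withDensity_ofReal (lintegral_expPowDensity hr (by positivity))

theorem lintegral_rpow_expPowNoise (hr : 0 < r) (hD : 0 < D) :
    ∫⁻ z, ENNReal.ofReal (|z| ^ r) ∂(expPowNoise r D) = ENNReal.ofReal D := by
  rw [expPowNoise, lintegral_withDensity_eq_lintegral_mul _ (by fun_prop) (by fun_prop)]
  have h := lintegral_rpow_mul_expPowDensity hr (s := 1 / (r * D)) (by positivity)
  simp only [Pi.mul_apply]
  simp only [mul_comm (ENNReal.ofReal (expPowDensity _ _ _))]
  rw [h]
  congr 1
  field_simp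

theorem integrable_rpow_expPowNoise (hr : 0 < r) (hD : 0 < D) :
    Integrable (fun z => |z| ^ r) (expPowNoise r D) := by
  refine ⟨Measurable.aestronglyMeasurable (by fun_prop), ?_⟩
  rw [hasFiniteIntegral_iff_ofReal (Eventually.of_forall fun z => by positivity),
    lintegral_rpow_expPowNoise hr hD]
  exact ENNReal.ofReal_lt_top

theorem integral_rpow_expPowNoise (hr : 0 < r) (hD : 0 < D) :
    ∫ z, |z| ^ r ∂(expPowNoise r D) = D := by
  rw [integral_eq_lintegral_of_nonneg_ae (Eventually.of_forall fun z => by positivity)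
    (Measurable.aestronglyMeasurable (by fun_prop)), lintegral_rpow_expPowNoise hr hD,
    ENNReal.toReal_ofReal hD.le]

/-- The event that the noise moves a point to another cell of the grid of mesh `1 / m`. -/
def cellChange (m : ℕ) : Set (ℝ × ℝ) :=
  {q | ⌊(m : ℝ) * (q.1 + q.2)⌋ ≠ ⌊(m : ℝ) * q.1⌋}

theorem measurableSet_cellChange (m : ℕ) : MeasurableSet (cellChange m) := by
  have h := measurable_floor_mul m
  have h1 : Measurable fun q : ℝ × ℝ => ⌊(m : ℝ) * (q.1 + q.2)⌋ := h.comp (by fun_prop)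
  have h2 : Measurable fun q : ℝ × ℝ => ⌊(m : ℝ) * q.1⌋ := h.comp measurable_fst
  exact (measurableSet_eq_fun h1 h2).compl

theorem RDfun_le_of_testDensity (hr : 0 < r) (hD : 0 < D) (hm : 0 < m) (hε : 0 < ε)
    (hgm : Integrable (fun x => Real.log (gridMass μ m ⌊(m : ℝ) * x⌋)) μ) :
    RDfun μ (fun x => |x|) r D ≤ ENNReal.ofReal
      (Real.log (expPowNorm r * (1 / (r * D)) ^ (1 / r)) - 1 / r + Real.log (1 + ε * Real.pi)
        - ∫ x, Real.log (gridMass μ m ⌊(m : ℝ) * x⌋) ∂μ - Real.log m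
        + (μ.prod (expPowNoise r D)).real (cellChange m)
          * (Real.log m + |Real.log ε| + 3 * Real.log 2) + 2 / r * D) := by
  have hs : 0 < 1 / (r * D) := by positivity
  set s := 1 / (r * D) with hs_def
  set g := expPowDensity r s with hg
  set B := expPowNorm r * s ^ (1 / r) with hB
  have hB0 : 0 < B := expPowNorm_mul_pos hr hs
  have hgmeas : Measurable g := measurable_expPowDensity
  have hg0 : ∀ z, 0 < g z := expPowDensity_pos hr hs
  have hgB : ∀ z, g z ≤ B := expPowDensity_le hr hs
  have hγ := isProbabilityMeasure_expPowNoise hr hD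
  set γ := expPowNoise r D with hγ_def
  have hγ' : γ = volume.withDensity fun z => ENNReal.ofReal (g z) := rfl
  set P := μ.prod γ with hP
  set p := outputDensity μ g with hp_def
  have hp : Measurable p := measurable_outputDensity hgmeas
  have hp0 : ∀ y, 0 < p y := outputDensity_pos hgmeas hg0 hgB
  have hpB : ∀ y, p y ≤ B := outputDensity_le hB0.le hgB
  set v := testDensity μ m ε with hv_def
  have hv : Measurable v := measurable_testDensity
  have hv0 : ∀ y, 0 < v y := testDensity_pos hε
  set K := Real.log m + |Real.log ε| + 3 * Real.log 2 with hK
  set l : ℝ × ℝ → ℝ := fun q => Real.log (gridMass μ m ⌊(m : ℝ) * q.1⌋) + Real.log m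
    - (cellChange m).indicator (fun _ => K) q - 2 / r * |q.2| ^ r with hl
  have hrpow : Integrable (fun q : ℝ × ℝ => |q.2| ^ r) P :=
    (integrable_rpow_expPowNoise hr hD).comp_snd μ
  have hgmP : Integrable (fun q : ℝ × ℝ => Real.log (gridMass μ m ⌊(m : ℝ) * q.1⌋)) P :=
    hgm.comp_fst γ
  have hind : Integrable ((cellChange m).indicator fun _ => K) P :=
    (integrable_const K).indicator (measurableSet_cellChange m)
  have hl_int : Integrable l P :=
    ((hgmP.add (integrable_const _)).sub hind).sub (hrpow.const_mul _)
  have hl_val : ∫ q, l q ∂P = ∫ x, Real.log (gridMass μ m ⌊(m : ℝ) * x⌋) ∂μ + Real.log m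
      - P.real (cellChange m) * K - 2 / r * D := by
    have h1 : Integrable (fun q : ℝ × ℝ => Real.log (gridMass μ m ⌊(m : ℝ) * q.1⌋)
        + Real.log m) P := hgmP.add (integrable_const _)
    have h2 : Integrable (fun q : ℝ × ℝ => Real.log (gridMass μ m ⌊(m : ℝ) * q.1⌋)
        + Real.log m - (cellChange m).indicator (fun _ => K) q) P := h1.sub hind
    simp only [hl]
    rw [integral_sub h2 (hrpow.const_mul _), integral_sub h1 hind,
      integral_add hgmP (integrable_const _), integral_const_mul,
      integral_indicator_const _ (measurableSet_cellChange m), hP,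
      integral_fun_fst (fun x => Real.log (gridMass μ m ⌊(m : ℝ) * x⌋)),
      integral_fun_snd (fun z : ℝ => |z| ^ r), integral_rpow_expPowNoise hr hD]
    simp
  have hl_le : ∀ᵐ q ∂P, l q ≤ Real.log (v (q.1 + q.2)) := by
    have h := (Measure.quasiMeasurePreserving_fst (μ := μ) (ν := γ)).ae (ae_gridMass_pos hm)
    filter_upwards [h] with q hq
    exact le_log_testDensity hr hm hε q.2 hq
  set φ : ℝ × ℝ → ℝ := fun q => v (q.1 + q.2) / p (q.1 + q.2) with hφ
  have hφ0 : ∀ q, 0 < φ q := fun q => div_pos (hv0 _) (hp0 _)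
  have hφm : Measurable φ := by fun_prop
  have hφle : ∫⁻ q, ENNReal.ofReal (φ q) ∂P ≤ ENNReal.ofReal (1 + ε * Real.pi) := by
    rw [← lintegral_testDensity (μ := μ) hm hε]
    have h := lintegral_add_noise (μ := μ) hgmeas hgB
      (F := fun y => ENNReal.ofReal (v y / p y)) (by fun_prop)
    rw [← hγ'] at h
    exact h.trans_le (lintegral_div_density_le hp rfl hv)
  have hφi : Integrable φ P := by
    refine ⟨hφm.aestronglyMeasurable, ?_⟩
    rw [hasFiniteIntegral_iff_ofReal (Eventually.of_forall fun q => (hφ0 q).le)]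
    exact hφle.trans_lt ENNReal.ofReal_lt_top
  have hlogφ : ∀ q, Real.log (φ q) = Real.log (v (q.1 + q.2)) - Real.log (p (q.1 + q.2)) :=
    fun q => Real.log_div (hv0 _).ne' (hp0 _).ne'
  have hlogp : Integrable (fun q : ℝ × ℝ => Real.log (p (q.1 + q.2))) P := by
    refine Integrable.mono' (((integrable_const |Real.log B|).add hφi).add hl_int.abs)
      (Measurable.aestronglyMeasurable (by fun_prop)) ?_
    filter_upwards [hl_le] with q hq
    have h1 : Real.log (p (q.1 + q.2)) ≤ Real.log B := Real.log_le_log (hp0 _) (hpB _)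
    have h2 := Real.log_le_sub_one_of_pos (hφ0 q)
    rw [hlogφ] at h2
    have h3 := hφ0 q
    simp only [Pi.add_apply, Real.norm_eq_abs]
    rw [abs_le]
    constructor <;> linarith [abs_nonneg (l q), neg_abs_le (l q), le_abs_self (Real.log B),
      abs_nonneg (Real.log B)]
  have hgibbs := integral_le_log_of_le_log (by positivity) hφm.aemeasurable
    (Eventually.of_forall hφ0) (hl_int.sub hlogp)
    (hl_le.mono fun q hq => by rw [hlogφ]; exact sub_le_sub_right hq _) hφle
  simp only [Pi.sub_apply] at hgibbs
  rw [integral_sub hl_int hlogp, hl_val] at hgibbs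
  have hlogg : ∀ q : ℝ × ℝ, Real.log (g q.2) = Real.log B - s * |q.2| ^ r :=
    fun q => log_expPowDensity hr hs q.2
  have hloggi : Integrable (fun q : ℝ × ℝ => Real.log (g q.2)) P := by
    simp only [hlogg]
    exact (integrable_const _).sub (hrpow.const_mul _)
  have hloggv : ∫ q, Real.log (g q.2) ∂P = Real.log B - 1 / r := by
    simp only [hlogg]
    rw [integral_sub (integrable_const _) (hrpow.const_mul _), integral_const_mul, hP,
      integral_fun_snd (fun z : ℝ => |z| ^ r), integral_rpow_expPowNoise hr hD]
    simp only [integral_const, probReal_univ, one_smul, hs_def]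
    field_simp
  have hdist : ∫⁻ q, ENNReal.ofReal (|q.1 - q.2| ^ r) ∂(μ.compProd (addNoise γ))
      ≤ ENNReal.ofReal D := by
    rw [compProd_addNoise, lintegral_map (by fun_prop) (by fun_prop)]
    simp only [sub_add_cancel_left, abs_neg]
    rw [← lintegral_rpow_expPowNoise hr hD, lintegral_prod _ (by fun_prop)]
    simp [hγ_def]
  have hγ'' : IsProbabilityMeasure (volume.withDensity fun z => ENNReal.ofReal (g z)) := hγ
  have hMI := mutualInfo_compProd_addNoise (μ := μ) hgmeas hg0 hgB (hloggi.sub hlogp)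
  have hRD : RDfun μ (fun x => |x|) r D ≤ mutualInfo (μ.compProd (addNoise γ)) :=
    iInf_le_of_le (addNoise γ) (iInf_le_of_le inferInstance (iInf_le_of_le hdist le_rfl))
  refine (hRD.trans_eq hMI).trans (ENNReal.ofReal_le_ofReal ?_)
  rw [← hγ', ← hP, integral_sub hloggi hlogp, hloggv]
  linarith

end NoiseChannel

section RateDistortionUpper

variable {μ : Measure ℝ} [IsProbabilityMeasure μ] {m : ℕ} {r : ℝ} {f : ℝ → ℝ}

theorem cellChange_subset (hm : 0 < m) (η : ℝ) :
    cellChange m ⊆ {x : ℝ | Int.fract ((m : ℝ) * x) < η ∨ 1 - η < Int.fract ((m : ℝ) * x)} ×ˢ univ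
      ∪ univ ×ˢ {z : ℝ | η / m ≤ |z|} := by
  have hm' : (0 : ℝ) < m := Nat.cast_pos.2 hm
  rintro ⟨x, z⟩ hxz
  by_contra hcon
  simp only [mem_union, mem_prod, mem_univ, mem_ofPred_eq, and_true, true_and, not_or, not_lt,
    not_le] at hcon
  obtain ⟨⟨h1, h2⟩, h3⟩ := hcon
  rw [lt_div_iff₀ hm', ← Nat.abs_cast, ← abs_mul, abs_lt] at h3
  refine hxz ?_
  have h4 := Int.floor_add_fract ((m : ℝ) * x)
  rw [Int.floor_eq_iff]
  dsimp only
  constructor <;> linarith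

theorem exists_measure_fract_lt (hm : 0 < m) (hμ : μ ≪ volume) {δ : ℝ≥0∞} (hδ : 0 < δ) :
    ∃ η : ℝ, 0 < η ∧
      μ {x : ℝ | Int.fract ((m : ℝ) * x) < η ∨ 1 - η < Int.fract ((m : ℝ) * x)} < δ := by
  have hm' : (m : ℝ) ≠ 0 := Nat.cast_ne_zero.2 hm.ne'
  let u : ℕ → ℝ := fun k => 1 / ((k : ℝ) + 1)
  have hu : Tendsto u atTop (𝓝 0) := tendsto_one_div_add_atTop_nhds_zero_nat
  have hu_anti : Antitone u := fun a b hab => by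
    have : (a : ℝ) ≤ b := Nat.cast_le.2 hab
    simp only [u]
    gcongr
  let s : ℕ → Set ℝ := fun k =>
    {x | Int.fract ((m : ℝ) * x) < u k ∨ 1 - u k < Int.fract ((m : ℝ) * x)}
  have hfr : Measurable fun x : ℝ => Int.fract ((m : ℝ) * x) :=
    measurable_fract.comp (measurable_const_mul _)
  have hs : ∀ k, MeasurableSet (s k) := fun k =>
    (measurableSet_lt hfr measurable_const).union (measurableSet_lt measurable_const hfr)
  have hanti : Antitone s := fun a b hab x hx =>
    hx.imp (fun h => h.trans_le (hu_anti hab)) fun h => by linarith [hu_anti hab]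
  have hnull : μ (⋂ k, s k) = 0 := by
    refine hμ (measure_mono_null (t := range fun n : ℤ => (n : ℝ) / m) ?_
      ((countable_range _).measure_zero _))
    intro x hx
    rw [mem_iInter] at hx
    have h0 : Int.fract ((m : ℝ) * x) = 0 := by
      by_contra hne
      have h1 : 0 < Int.fract ((m : ℝ) * x) := lt_of_le_of_ne (Int.fract_nonneg _) (Ne.symm hne)
      have h2 : 0 < 1 - Int.fract ((m : ℝ) * x) := sub_pos.2 (Int.fract_lt_one _)
      obtain ⟨k, hk1, hk2⟩ := ((hu.eventually_lt_const h1).and (hu.eventually_lt_const h2)).exists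
      rcases hx k with h | h <;> linarith
    obtain ⟨n, hn⟩ := Int.fract_eq_zero_iff.1 h0
    refine ⟨n, ?_⟩
    dsimp only
    rw [hn, mul_div_cancel_left₀ _ hm']
  have hlim := tendsto_measure_iInter_atTop (μ := μ) (fun k => (hs k).nullMeasurableSet) hanti
    ⟨0, measure_ne_top _ _⟩
  rw [hnull] at hlim
  obtain ⟨k, hk⟩ := (hlim.eventually_lt_const hδ).exists
  exact ⟨u k, by positivity, hk⟩

theorem measureReal_expPowNoise_le (hr : 0 < r) {D a : ℝ} (hD : 0 < D) (ha : 0 < a) :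
    (expPowNoise r D).real {z : ℝ | a ≤ |z|} ≤ D / a ^ r := by
  have := isProbabilityMeasure_expPowNoise hr hD
  have h := mul_meas_ge_le_integral_of_nonneg (μ := expPowNoise r D) (f := fun z : ℝ => |z| ^ r)
    (Eventually.of_forall fun z => by positivity) (integrable_rpow_expPowNoise hr hD) (a ^ r)
  rw [integral_rpow_expPowNoise hr hD] at h
  simp only [Real.rpow_le_rpow_iff ha.le (abs_nonneg _) hr] at h
  rw [le_div_iff₀' (by positivity)]
  exact h

theorem eventually_measureReal_cellChange_le (hr : 0 < r) (hm : 0 < m) (hμ : μ ≪ volume)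
    {δ : ℝ} (hδ : 0 < δ) :
    ∀ᶠ D in 𝓝[>] (0 : ℝ), (μ.prod (expPowNoise r D)).real (cellChange m) ≤ δ := by
  have hm' : (0 : ℝ) < m := Nat.cast_pos.2 hm
  obtain ⟨η, hη, hηδ⟩ := exists_measure_fract_lt hm hμ (ENNReal.ofReal_pos.2 (half_pos hδ))
  set a := η / m with ha_def
  have ha : 0 < a := by positivity
  have hev : ∀ᶠ D in 𝓝[>] (0 : ℝ), D < δ / 2 * a ^ r :=
    eventually_nhdsWithin_of_eventually_nhds (eventually_lt_nhds (by positivity))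
  filter_upwards [self_mem_nhdsWithin, hev] with D hD hDlt
  rw [mem_Ioi] at hD
  have := isProbabilityMeasure_expPowNoise hr hD
  refine (measureReal_mono (cellChange_subset hm η)).trans ((measureReal_union_le _ _).trans ?_)
  rw [measureReal_prod_prod, measureReal_prod_prod, probReal_univ, probReal_univ, mul_one, one_mul]
  have h1 := ENNReal.toReal_le_of_le_ofReal (half_pos hδ).le hηδ.le
  have h2 := measureReal_expPowNoise_le hr hD ha
  have h3 : D / a ^ r ≤ δ / 2 := by
    rw [div_le_iff₀ (by positivity)]; exact hDlt.le
  rw [← measureReal_def] at h1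
  linarith

theorem eventually_RDfun_le (hr : 0 < r) (hfm : Measurable f)
    (hf0 : ∀ x, 0 ≤ f x) (hμf : μ = volume.withDensity fun x => ENNReal.ofReal (f x))
    (hlogf : Integrable (fun x => Real.log (f x)) μ)
    (hfloor : Summable fun k : ℤ => Real.negMulLog (μ {x | ⌊x⌋ = k}).toReal)
    {τ : ℝ} (hτ : 0 < τ) :
    ∀ᶠ D in 𝓝[>] (0 : ℝ),
      RDfun μ (fun x => |x|) r D ≤ ENNReal.ofReal (shannonBound μ f r D + τ) := by
  have hμv : μ ≪ volume := hμf ▸ withDensity_absolutelyContinuous _ _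
  obtain ⟨m, hmH, hm⟩ := ((eventually_neg_integral_log_gridMass_le hfm hf0 hμf hlogf hfloor
    (τ := τ / 4) (by positivity)).and (eventually_gt_atTop 0)).exists
  have hm1 : (1 : ℝ) ≤ m := Nat.one_le_cast.2 hm
  set ε := τ / (4 * Real.pi) with hε_def
  have hε : 0 < ε := by positivity
  have hεπ : Real.log (1 + ε * Real.pi) ≤ τ / 4 := by
    have h := Real.log_le_sub_one_of_pos (x := 1 + ε * Real.pi) (by positivity)
    have : ε * Real.pi = τ / 4 := by rw [hε_def]; field_simp
    linarith
  set K := Real.log m + |Real.log ε| + 3 * Real.log 2 with hK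
  have hK0 : 0 ≤ K := by
    have h1 := Real.log_nonneg hm1
    have h2 := Real.log_nonneg one_le_two
    positivity
  have hev : ∀ᶠ D in 𝓝[>] (0 : ℝ), D < r * τ / 8 :=
    eventually_nhdsWithin_of_eventually_nhds (eventually_lt_nhds (by positivity))
  filter_upwards [self_mem_nhdsWithin, hev, eventually_measureReal_cellChange_le hr hm hμv
    (δ := τ / 4 / (K + 1)) (by positivity)] with D hD hDlt hP
  rw [mem_Ioi] at hD
  refine (RDfun_le_of_testDensity hr hD hm hε (integrable_log_gridMass hfloor hm)).trans
    (ENNReal.ofReal_le_ofReal ?_)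
  have h1 : (μ.prod (expPowNoise r D)).real (cellChange m) * K ≤ τ / 4 := by
    calc _ ≤ τ / 4 / (K + 1) * (K + 1) := by gcongr; linarith
      _ = τ / 4 := by field_simp
  have h2 : 2 / r * D ≤ τ / 4 := by
    calc 2 / r * D ≤ 2 / r * (r * τ / 8) := by gcongr
      _ = τ / 4 := by field_simp; norm_num
  unfold shannonBound
  linarith

end RateDistortionUpper

section ExcessRate

variable {μ : Measure ℝ} {f : ℝ → ℝ} {r : ℝ}

theorem tendsto_toReal_sub_zero {α : Type*} {l : Filter α} {X : α → ℝ≥0∞} {S : α → ℝ}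
    (hS : Tendsto S l atTop)
    (hlo : ∀ τ, 0 < τ → ∀ᶠ a in l, ENNReal.ofReal (S a - τ) ≤ X a)
    (hup : ∀ τ, 0 < τ → ∀ᶠ a in l, X a ≤ ENNReal.ofReal (S a + τ)) :
    Tendsto (fun a => (X a).toReal - S a) l (𝓝 0) := by
  rw [Metric.tendsto_nhds]
  intro τ hτ
  filter_upwards [hlo (τ / 2) (half_pos hτ), hup (τ / 2) (half_pos hτ),
    hS.eventually_ge_atTop 0] with a h1 h2 h3
  rw [ENNReal.ofReal_le_iff_le_toReal (ne_top_of_le_ne_top ENNReal.ofReal_ne_top h2)] at h1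
  have h4 := ENNReal.toReal_le_of_le_ofReal (by positivity) h2
  rw [Real.dist_eq, sub_zero, abs_lt]
  constructor <;> linarith

/-- The asymptotic entropy of an optimal scalar quantizer with `r`-th power distortion `D`. -/
def scalarRate (μ : Measure ℝ) (f : ℝ → ℝ) (r D : ℝ) : ℝ :=
  -∫ x, Real.log (f x) ∂μ - 1 / r * Real.log (2 ^ r * (r + 1) * D)

theorem tendsto_scalarRate (hr : 0 < r) : Tendsto (scalarRate μ f r) (𝓝[>] 0) atTop := by
  have hc : 0 < 2 ^ r * (r + 1) := by positivity
  have h : Tendsto (fun D : ℝ => (-∫ x, Real.log (f x) ∂μ - 1 / r * Real.log (2 ^ r * (r + 1)))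
      + -(1 / r) * Real.log D) (𝓝[>] 0) atTop :=
    tendsto_atTop_add_const_left _ _
      (Real.tendsto_log_nhdsGT_zero.const_mul_atBot_of_neg (by simpa using hr))
  refine h.congr' ?_
  filter_upwards [self_mem_nhdsWithin] with D hD
  rw [scalarRate, Real.log_mul hc.ne' (ne_of_gt hD)]
  ring

theorem scalarRate_sub_shannonBound (hr : 0 < r) {D : ℝ} (hD : 0 < D) :
    scalarRate μ f r D - shannonBound μ f r D
      = 1 / r * Real.log (Real.Gamma (1 + 1 / r) ^ r * Real.exp 1 / (1 + 1 / r)) := by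
  have hΓ : 0 < Real.Gamma (1 + 1 / r) := Real.Gamma_pos_of_pos (by positivity)
  have h1 : 1 + 1 / r = (r + 1) / r := by field_simp
  have h2 : Real.log (1 + 1 / r) = Real.log (r + 1) - Real.log r := by
    rw [h1, Real.log_div (by positivity) hr.ne']
  have hc : Real.log (Real.Gamma (1 + 1 / r) ^ r * Real.exp 1 / (1 + 1 / r))
      = r * Real.log (Real.Gamma (1 + 1 / r)) + 1 - (Real.log (r + 1) - Real.log r) := by
    rw [Real.log_div (by positivity) (by positivity), h2,
      Real.log_mul (by positivity) (by positivity), Real.log_rpow hΓ, Real.log_exp]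
  rw [hc, scalarRate, shannonBound, log_expPowNorm_mul hr (by positivity),
    Real.log_mul (by positivity) hD.ne',
    Real.log_mul (by positivity) (by positivity), Real.log_rpow two_pos,
    Real.log_mul two_ne_zero hΓ.ne', one_div (r * D), Real.log_inv, Real.log_mul hr.ne' hD.ne']
  field_simp
  ring

theorem tendsto_shannonBound (hr : 0 < r) : Tendsto (shannonBound μ f r) (𝓝[>] 0) atTop := by
  refine (tendsto_atTop_add_const_right _
    (-(1 / r * Real.log (Real.Gamma (1 + 1 / r) ^ r * Real.exp 1 / (1 + 1 / r))))
    (tendsto_scalarRate (μ := μ) (f := f) hr)).congr' ?_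
  filter_upwards [self_mem_nhdsWithin] with D hD
  rw [← scalarRate_sub_shannonBound (μ := μ) (f := f) hr hD]
  ring

variable [IsProbabilityMeasure μ]

theorem tendsto_toReal_sub_RDfun (hr : 0 < r) (hfm : Measurable f)
    (hf0 : ∀ x, 0 ≤ f x) (hμf : μ = volume.withDensity fun x => ENNReal.ofReal (f x))
    (hlogf : Integrable (fun x => Real.log (f x)) μ)
    (hfloor : Summable fun k : ℤ => Real.negMulLog (μ {x | ⌊x⌋ = k}).toReal)
    {X : ℝ → ℝ≥0∞}
    (hlo : ∀ τ, 0 < τ → ∀ᶠ D in 𝓝[>] 0, ENNReal.ofReal (scalarRate μ f r D - τ) ≤ X D)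
    (hup : ∀ τ, 0 < τ → ∀ᶠ D in 𝓝[>] 0, X D ≤ ENNReal.ofReal (scalarRate μ f r D + τ)) :
    Tendsto (fun D => (X D).toReal - (RDfun μ (fun x => |x|) r D).toReal) (𝓝[>] 0)
      (𝓝 (1 / r * Real.log (Real.Gamma (1 + 1 / r) ^ r * Real.exp 1 / (1 + 1 / r)))) := by
  have h1 := tendsto_toReal_sub_zero (tendsto_scalarRate hr) hlo hup
  have h2 : Tendsto (fun D => (RDfun μ (fun x => |x|) r D).toReal - shannonBound μ f r D)
      (𝓝[>] 0) (𝓝 0) := by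
    refine tendsto_toReal_sub_zero (tendsto_shannonBound hr) (fun τ hτ => ?_) fun τ hτ =>
      eventually_RDfun_le hr hfm hf0 hμf hlogf hfloor hτ
    filter_upwards [self_mem_nhdsWithin] with D hD
    exact (ENNReal.ofReal_le_ofReal (by linarith)).trans
      (shannonBound_le_RDfun hr hD hfm hμf hlogf)
  have h3 := (h1.sub h2).add_const
    (1 / r * Real.log (Real.Gamma (1 + 1 / r) ^ r * Real.exp 1 / (1 + 1 / r)))
  rw [sub_zero, zero_add] at h3
  refine h3.congr' ?_
  filter_upwards [self_mem_nhdsWithin] with D hD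
  rw [← scalarRate_sub_shannonBound (μ := μ) (f := f) hr hD]
  ring

theorem excessRate_abs_eq (hr : 0 < r) (hfm : Measurable f)
    (hf0 : ∀ x, 0 ≤ f x) (hμf : μ = volume.withDensity fun x => ENNReal.ofReal (f x))
    (hlogf : Integrable (fun x => Real.log (f x)) μ)
    (hfloor : Summable fun k : ℤ => Real.negMulLog (μ {x | ⌊x⌋ = k}).toReal) :
    excessRate μ (fun x => |x|) r
      = 1 / r * Real.log (Real.Gamma (1 + 1 / r) ^ r * Real.exp 1 / (1 + 1 / r)) := by
  obtain ⟨n, hn, hdist, hent⟩ := exists_uniformQuantizer_entropy_le hr hfm hf0 hμf hlogf hfloor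
  refine (tendsto_toReal_sub_RDfun hr hfm hf0 hμf hlogf hfloor
    (fun τ hτ => eventually_le_RQfun hr hτ hfm hμf hlogf) fun τ hτ => ?_).liminf_eq
  filter_upwards [self_mem_nhdsWithin, hent τ hτ] with D hD h
  have hRQ : RQfun μ (fun x => |x|) r D ≤ (uniformQuantizer (n D) (hn D)).entropy μ :=
    iInf₂_le (uniformQuantizer (n D) (hn D)) (hdist D hD)
  exact hRQ.trans (ENNReal.ofReal_toReal (entropy_uniformQuantizer_ne_top hfloor (hn D)) ▸
    ENNReal.ofReal_le_ofReal h)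

theorem Quantizer.entropyR_eq_toReal (q : Quantizer ℝ) : q.entropyR μ = (q.entropy μ).toReal := by
  rw [Quantizer.entropy, ENNReal.tsum_toReal_eq fun _ => ENNReal.ofReal_ne_top]
  exact tsum_congr fun i => (ENNReal.toReal_ofReal
    (Real.negMulLog_nonneg measureReal_nonneg measureReal_le_one)).symm

theorem half_mul_log_Gamma_sq :
    1 / (2 : ℝ) * Real.log (Real.Gamma (1 + 1 / 2) ^ (2 : ℝ) * Real.exp 1 / (1 + 1 / 2))
      = 1 / 2 * Real.log (Real.pi * Real.exp 1 / 6) := by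
  have h : Real.Gamma (1 + 1 / 2) ^ (2 : ℝ) = Real.pi / 4 := by
    rw [add_comm, Real.Gamma_add_one (by norm_num), Real.Gamma_one_half_eq, Real.rpow_two,
      mul_pow, Real.sq_sqrt Real.pi_pos.le]
    ring
  rw [h]
  congr 2
  ring

end ExcessRate

/-- Gish-Pierce: the excess rate of scalar quantization equals
`(1/r) log( Γ(1+1/r)^r e / (1+1/r) )`; for quadratic distortion it equals
`(1/2) log(π e / 6)` and is achieved by uniform quantizers as the distortion vanishes. -/
theorem scalar_excess_rate_eq {r : ℝ} (hr : 0 < r)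
    (μ : Measure ℝ) [IsProbabilityMeasure μ]
    (f : ℝ → ℝ) (hfm : Measurable f) (hf0 : ∀ x, 0 ≤ f x)
    (hμf : μ = volume.withDensity fun x => ENNReal.ofReal (f x))
    (hent : Integrable (fun x => f x * Real.log (f x)))
    (hfloor : Summable fun k : ℤ => Real.negMulLog (μ {x | ⌊x⌋ = k}).toReal) :
    excessRate μ (fun x => |x|) r
        = (1 / r) * Real.log (Real.Gamma (1 + 1 / r) ^ r * Real.exp 1 / (1 + 1 / r))
    ∧ excessRate μ (fun x => |x|) 2 = (1 / 2) * Real.log (Real.pi * Real.exp 1 / 6)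
    ∧ ∃ (qf : ℝ → Quantizer ℝ) (Δ : ℝ → ℝ),
        (∀ D, 0 < D →
          0 < Δ D ∧
          (∀ i : ℤ, (qf D).S i = Set.Ico (i * Δ D) ((i + 1) * Δ D)) ∧
          (∀ i : ℤ, (qf D).c i = i * Δ D + Δ D / 2) ∧
          (qf D).distortion μ (fun x => |x|) 2 ≤ ENNReal.ofReal D) ∧
        Tendsto (fun D => (qf D).entropyR μ - (RDfun μ (fun x => |x|) 2 D).toReal)
          (𝓝[>] (0:ℝ)) (𝓝 ((1 / 2) * Real.log (Real.pi * Real.exp 1 / 6))) := by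
  have hlogf := integrable_log_density hfm hf0 hμf hent
  refine ⟨excessRate_abs_eq hr hfm hf0 hμf hlogf hfloor, ?_, ?_⟩
  · rw [excessRate_abs_eq two_pos hfm hf0 hμf hlogf hfloor, half_mul_log_Gamma_sq]
  obtain ⟨n, hn, hdist, hle⟩ :=
    exists_uniformQuantizer_entropy_le two_pos hfm hf0 hμf hlogf hfloor
  refine ⟨fun D => uniformQuantizer (n D) (hn D), fun D => 1 / n D, fun D hD => ?_, ?_⟩
  · exact ⟨one_div_pos.2 (Nat.cast_pos.2 (hn D)), fun _ => rfl, fun _ => rfl, hdist D hD⟩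
  simp only [Quantizer.entropyR_eq_toReal]
  rw [← half_mul_log_Gamma_sq]
  refine tendsto_toReal_sub_RDfun two_pos hfm hf0 hμf hlogf hfloor (fun τ hτ => ?_) fun τ hτ => ?_
  · filter_upwards [self_mem_nhdsWithin,
      Quantizer.eventually_le_entropy two_pos hτ hfm hμf hlogf] with D hD h
    exact h _ (hdist D hD)
  · filter_upwards [hle τ hτ] with D h
    exact ENNReal.ofReal_toReal (entropy_uniformQuantizer_ne_top hfloor (hn D)) ▸
      ENNReal.ofReal_le_ofReal h

end
end
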